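/- There is an absolute constant C > 0 such that the following holds. Let G be a finite abelian group, M ≥ 1, and let f : G → ℤ satisfy ‖f‖_{A(G)} ≤ M. Then there is a function z : W(G) → ℤ such that f = ∑_{W ∈ W(G)} z(W)·1_W and ∑_{W ∈ W(G)} |z(W)| ≤ exp(C·M⁴·log⁸(2M)). -/

import Mathlib

open scoped BigOperators Pointwise ENNReal ENat
open Real

namespace Paper

noncomputable section

/-- For `z` on the unit circle, `circNorm z = min {|θ| : z = exp(2πiθ)}`. -/
def circNorm (z : ℂ) : ℝ := |z.arg| / (2 * Real.pi)

variable {G : Type} [AddCommGroup G]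

/-- The (generalised) Bohr set with frequency set `Γ` and width function `δ`. -/
def bohrSet (Γ : Set (AddChar G ℂ)) (δ : AddChar G ℂ → ℝ) : Set G :=
  {x | ∀ γ ∈ Γ, circNorm (γ x) < δ γ}

/-- `(Γ, δ)` generates the family of sets `F` as a Bohr system. -/
def IsBohrGen (Γ : Set (AddChar G ℂ)) (δ : AddChar G ℂ → ℝ) (F : ℝ → Set G) : Prop :=
  (∀ γ ∈ Γ, 0 < δ γ) ∧ ∀ η : ℝ, 0 < η → η ≤ 1 → F η = bohrSet Γ (fun γ => η * δ γ)

/-- A Bohr system: a family `(B_η)_{η ∈ (0,1]}` of subsets of `G` of the form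
`B_η = Bohr(Γ, ηδ)` for some generating pair `(Γ, δ)`. -/
structure BohrSystem (G : Type) [AddCommGroup G] where
  sets : ℝ → Set G
  exists_gen : ∃ Γ δ, IsBohrGen Γ δ sets

/-- The covering number `C(S;T) = min {|X| : S ⊆ X + T}`, valued in `ℕ∞`. -/
def coveringNumber {H : Type} [AddCommGroup H] (S T : Set H) : ℕ∞ :=
  sInf {n : ℕ∞ | ∃ X : Finset H, (X.card : ℕ∞) = n ∧ S ⊆ (X : Set H) + T}

/-- Auxiliary quantity for the difference covering number, for a fixed target group `H`. -/
def dCovAux (S T : Set G) (H : Type) [AddCommGroup H] : ℕ∞ :=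
  ⨅ (φ : G →+ H) (U : Set H) (V : Set H) (_ : S ⊆ φ ⁻¹' U) (_ : φ ⁻¹' (V - V) ⊆ T),
    coveringNumber U V

/-- The difference covering number `C^Δ(S;T)`: the infimum of `C_H(U;V)` over all abelian
groups `H`, homomorphisms `φ : G → H` and sets `U, V ⊆ H` with `S ⊆ φ⁻¹(U)` and
`φ⁻¹(V − V) ⊆ T`. -/
def dCoveringNumber (S T : Set G) : ℕ∞ :=
  ⨅ (H : Type) (inst : AddCommGroup H), @dCovAux G _ S T H inst

/-- Interpret an extended natural number as a real number. -/
def enatReal (n : ℕ∞) : ℝ := (n.toNat : ℝ)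

/-- The dimension of a family of sets: `sup {log₂ C^Δ(F_η; F_{η/2}) : η ∈ (0,1]}`. -/
def dimOfSets (F : ℝ → Set G) : ℝ :=
  sSup {r : ℝ | ∃ η : ℝ, 0 < η ∧ η ≤ 1 ∧
    r = Real.logb 2 (enatReal (dCoveringNumber (F η) (F (η / 2))))}

/-- The dimension `dim B` of a Bohr system. -/
def BohrSystem.dim (B : BohrSystem G) : ℝ := dimOfSets B.sets

/-- The doubling dimension of a family of sets:
`sup {log₂ C(F_η; F_{η/2}) : η ∈ (0,1]}`. -/
def dimStarOfSets (F : ℝ → Set G) : ℝ :=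
  sSup {r : ℝ | ∃ η : ℝ, 0 < η ∧ η ≤ 1 ∧
    r = Real.logb 2 (enatReal (coveringNumber (F η) (F (η / 2))))}

/-- The doubling dimension `dim* B` of a Bohr system. -/
def BohrSystem.dimStar (B : BohrSystem G) : ℝ := dimStarOfSets B.sets

/-- `B' ≤ B` for Bohr systems, i.e. `B' ∧ B = B'`, i.e. `B'_η ⊆ B_η` for all `η ∈ (0,1]`. -/
def BohrSystem.le (B' B : BohrSystem G) : Prop :=
  ∀ η : ℝ, 0 < η → η ≤ 1 → B'.sets η ⊆ B.sets η

/-- The width of a Bohr system: `inf {‖δ‖_{ℓ∞(Γ)} : (Γ,δ) generates B}`. -/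
def BohrSystem.width (B : BohrSystem G) : ℝ :=
  sInf {r : ℝ | ∃ Γ δ, IsBohrGen Γ δ B.sets ∧ r = sSup (δ '' Γ)}

/-- The `n`-fold sumset `nS = S + ⋯ + S`. -/
def iterSum : ℕ → Set G → Set G
  | 0, _ => {0}
  | n + 1, S => S + iterSum n S

/-- The set of all cosets of subgroups of `G`. -/
def cosets (G : Type) [AddCommGroup G] : Set (Set G) :=
  {W | ∃ (H : AddSubgroup G) (x : G), W = (fun h => x + h) '' (H : Set G)}

/-- The set of cosets of a fixed subgroup `H` of `G`. -/
def cosetsOf (H : AddSubgroup G) : Set (Set G) :=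
  {W | ∃ x : G, W = (fun h => x + h) '' (H : Set G)}

/-- `f` is `ε`-almost integer-valued, with integer part `fZ`. -/
def AlmostInt (ε : ℝ) (f : G → ℂ) (fZ : G → ℤ) : Prop :=
  ∀ x, ‖f x - (fZ x : ℂ)‖ ≤ ε

/-- The `ρ`-approximate annihilator `N(S,ρ)` of a set `S ⊆ G`. -/
def annihilator (S : Set G) (ρ : ℝ) : Set (AddChar G ℂ) :=
  {γ | ∀ x ∈ S, ‖(1 : ℂ) - γ x‖ < ρ}

/-- `A` is `(m,l)`-arithmetically connected. -/
def ArithConnected (m l : ℕ) (A : Set G) : Prop :=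
  ∀ x : Fin m → G, (∀ i, x i ∈ A) →
    ∃ σ : Fin m → ℤ, (∑ i, (σ i).natAbs) ≤ l ∧
      (∃ i j, i ≠ j ∧ (σ i).natAbs = 1 ∧ (σ j).natAbs = 1) ∧
      (∑ i, σ i • x i) ∈ A

variable [Fintype G]

/-- The Haar probability measure of a subset of the finite group `G`. -/
def haar (S : Set G) : ℝ := (Nat.card S : ℝ) / (Fintype.card G : ℝ)

/-- A probability measure on the finite group `G`, given by its weight function. -/
def IsProb (w : G → ℝ) : Prop := (∀ x, 0 ≤ w x) ∧ ∑ x, w x = 1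

/-- The measure of `S` under the weight function `w`. -/
def wMeasure (w : G → ℝ) (S : Set G) : ℝ := ∑ x, S.indicator w x

/-- The probability measure `μ_S`: `μ` restricted to `S` and normalised. -/
def restrictProb (w : G → ℝ) (S : Set G) : G → ℝ :=
  fun x => S.indicator w x / wMeasure w S

/-- The probability measure `w` is `F`-approximately invariant: for every `η ∈ (0,1]` there
are probability measures `w⁺, w⁻` with `(1−η)·w⁻ ≤ τ_x(w) ≤ (1+η)·w⁺` for all `x ∈ F η`. -/
def ApproxInvariant (F : ℝ → Set G) (w : G → ℝ) : Prop :=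
  ∀ η : ℝ, 0 < η → η ≤ 1 → ∃ wp wm : G → ℝ, IsProb wp ∧ IsProb wm ∧
    ∀ x ∈ F η, ∀ y : G, (1 - η) * wm y ≤ w (y - x) ∧ w (y - x) ≤ (1 + η) * wp y

/-- The Fourier coefficient `f̂(γ) = (1/|G|) ∑_x f(x) conj(γ(x))`. -/
def fourierCoeff (f : G → ℂ) (γ : AddChar G ℂ) : ℂ :=
  (Fintype.card G : ℂ)⁻¹ * ∑ x, f x * (starRingEnd ℂ) (γ x)

/-- The Wiener norm `‖f‖_{A(G)} = ∑_γ |f̂(γ)|`. -/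
def wienerNorm (f : G → ℂ) : ℝ := ∑ᶠ γ : AddChar G ℂ, ‖fourierCoeff f γ‖

/-- The Fourier transform `μ̂(γ) = ∫ conj(γ(x)) dμ(x)` of a measure with weight `w`. -/
def fourierWeight (w : G → ℝ) (γ : AddChar G ℂ) : ℂ :=
  ∑ x, (starRingEnd ℂ) (γ x) * (w x : ℂ)

/-- Convolution `f ∗ μ (x) = ∫ f(x−y) dμ(y)` of a complex function with a measure. -/
def convC (f : G → ℂ) (w : G → ℝ) (x : G) : ℂ := ∑ y, f (x - y) * (w y : ℂ)

/-- Convolution `f ∗ μ (x) = ∫ f(x−y) dμ(y)` of a real function with a measure. -/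
def convR (f : G → ℝ) (w : G → ℝ) (x : G) : ℝ := ∑ y, f (x - y) * w y

/-- Convolution of functions w.r.t. Haar measure: `f ∗ g (x) = (1/|G|) ∑_y f(y) g(x−y)`. -/
def convFun (f g : G → ℝ) (x : G) : ℝ := (Fintype.card G : ℝ)⁻¹ * ∑ y, f y * g (x - y)

/-- The `L_p` norm `(∫ |f|^p dν)^{1/p}` w.r.t. the measure with weight `w`. -/
def LpW (p : ℝ) (w : G → ℝ) (f : G → ℂ) : ℝ := (∑ y, w y * ‖f y‖ ^ p) ^ (1 / p)

/-- `X` has relative polynomial growth of order `d`. -/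
def HasRPG (X : Set G) (d : ℝ) : Prop :=
  ∀ n : ℕ, 1 ≤ n → haar (iterSum n X) ≤ (n : ℝ) ^ d * haar X

end

section P1
open scoped Classical
open Finset

lemma exp_le_add_exp_sq (s : ℝ) : Real.exp s ≤ s + Real.exp (s ^ 2) := by
  rcases le_total s 0 with h | h
  · -- s ≤ 0
    have h1 : 1 + s^2 ≤ Real.exp (s^2) := by linarith [Real.add_one_le_exp (s^2)]
    have h2 : Real.exp s ≤ 1 + s + s^2 := by
      have h3 := Real.quadratic_le_exp_of_nonneg (x := -s) (by linarith)
      have h4 : 0 < Real.exp (-s) := Real.exp_pos _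
      have h5 : Real.exp s * Real.exp (-s) = 1 := by rw [← Real.exp_add]; simp
      have h6 : 0 < 1 + s + s^2 := by nlinarith [sq_nonneg (s+1/2)]
      have h7 : 1 ≤ (1 + s + s^2) * (1 + -s + (-s)^2/2) := by
        nlinarith [sq_nonneg (s+1/2), sq_nonneg s, sq_nonneg (s^2), mul_nonneg (sq_nonneg s) (neg_nonneg.2 h)]
      have h8 : 1 ≤ (1+s+s^2) * Real.exp (-s) := le_trans h7 (mul_le_mul_of_nonneg_left h3 h6.le)
      nlinarith
    linarith
  · rcases le_total s 1 with h1 | h1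
    · have h3 : 1 + s^2 ≤ Real.exp (s^2) := by linarith [Real.add_one_le_exp (s^2)]
      have h4 := Real.abs_exp_sub_one_sub_id_le (x := s) (by rw [abs_of_nonneg h]; exact h1)
      have := (abs_le.1 h4).2
      linarith
    · have : Real.exp s ≤ Real.exp (s^2) := Real.exp_le_exp.2 (by nlinarith)
      linarith

lemma hoeff_real {I : Type*} [Fintype I] (q : I → ℝ) (hq0 : ∀ i, 0 ≤ q i) (hq1 : ∑ i, q i = 1)
    (X : I → ℝ) (hX : ∀ i, |X i| ≤ 2) (hm : ∑ i, q i * X i = 0) (k : ℕ) (ε : ℝ) (hε : 0 ≤ ε) :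
    ∑ v : Fin k → I, (∏ j, q (v j)) * (if k * ε / 2 < ∑ j, X (v j) then 1 else 0)
      ≤ Real.exp (-(k * ε ^ 2 / 64)) := by
  set lam := ε / 16 with hl
  have hl0 : 0 ≤ lam := by positivity
  have h1 : ∑ i, q i * Real.exp (lam * X i) ≤ Real.exp (4 * lam ^ 2) := by
    calc ∑ i, q i * Real.exp (lam * X i) ≤ ∑ i, q i * (lam * X i + Real.exp (4 * lam^2)) := by
          apply sum_le_sum; intro i _
          apply mul_le_mul_of_nonneg_left _ (hq0 i)
          refine (exp_le_add_exp_sq _).trans ?_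
          gcongr
          rw [mul_pow, mul_comm]
          have : X i ^ 2 ≤ 4 := by
            have := hX i
            have := abs_le.1 this
            nlinarith
          nlinarith [sq_nonneg lam]
      _ = lam * ∑ i, q i * X i + (∑ i, q i) * Real.exp (4 * lam^2) := by
          rw [mul_sum, sum_mul, ← sum_add_distrib]; apply sum_congr rfl; intros; ring
      _ = _ := by rw [hm, hq1]; ring
  calc ∑ v : Fin k → I, (∏ j, q (v j)) * (if k * ε / 2 < ∑ j, X (v j) then (1:ℝ) else 0)
      ≤ ∑ v : Fin k → I, (∏ j, q (v j) * Real.exp (lam * X (v j))) * Real.exp (-(lam * (k * ε / 2))) := by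
        apply sum_le_sum; intro v _
        rw [prod_mul_distrib, mul_assoc]
        apply mul_le_mul_of_nonneg_left _ (prod_nonneg fun j _ => hq0 _)
        rw [← Real.exp_sum, ← Real.exp_add, ← mul_sum]
        split_ifs with h
        · apply Real.one_le_exp
          nlinarith
        · positivity
    _ = (∑ i, q i * Real.exp (lam * X i)) ^ k * Real.exp (-(lam * (k * ε / 2))) := by
        rw [← sum_mul]
        congr 1
        rw [Finset.sum_pow', Fintype.piFinset_univ]
    _ ≤ Real.exp (4 * lam ^ 2) ^ k * Real.exp (-(lam * (k * ε / 2))) := by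
        gcongr
        exact sum_nonneg fun i _ => mul_nonneg (hq0 i) (Real.exp_pos _).le
    _ = _ := by
        rw [← Real.exp_nat_mul, ← Real.exp_add]; congr 1; rw [hl]; ring

end P1

section P2
open scoped Classical
open Finset

lemma sample_one {I : Type*} [Fintype I] (q : I → ℝ) (hq0 : ∀ i, 0 ≤ q i) (hq1 : ∑ i, q i = 1)
    (φ : I → ℂ) (hφ : ∀ i, ‖φ i‖ ≤ 1) (k p : ℕ) (ε : ℝ) (hε : 0 < ε)
    (hk : 64 * (p + 2 : ℝ) ≤ k * ε ^ 2) :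
    ∑ v : Fin k → I, (∏ j, q (v j)) *
      (if ε < ‖(1 / k : ℂ) * ∑ j, φ (v j) - ∑ i, (q i : ℂ) * φ i‖ then 1 else 0)
      ≤ (1 / 2) ^ p := by
  have hk0 : (0:ℝ) < k := by
    by_contra h
    have : (k:ℝ) = 0 := le_antisymm (not_lt.1 h) (Nat.cast_nonneg _)
    rw [this] at hk
    have : (0:ℝ) ≤ p := Nat.cast_nonneg _
    nlinarith
  set m : ℂ := ∑ i, (q i : ℂ) * φ i with hm
  have hmn : ‖m‖ ≤ 1 := by
    calc ‖m‖ ≤ ∑ i, ‖(q i : ℂ) * φ i‖ := norm_sum_le _ _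
      _ ≤ ∑ i, q i := by
        apply sum_le_sum; intro i _
        rw [norm_mul, Complex.norm_real, Real.norm_of_nonneg (hq0 i)]
        exact mul_le_of_le_one_right (hq0 i) (hφ i)
      _ = 1 := hq1
  have key : ∀ (L : ℂ →ₗ[ℝ] ℝ), (∀ z, |L z| ≤ ‖z‖) →
      ∑ v : Fin k → I, (∏ j, q (v j)) * (if k * ε / 2 < ∑ j, L (φ (v j) - m) then 1 else 0)
      ≤ Real.exp (-(k * ε ^ 2 / 64)) := by
    intro L hL
    refine hoeff_real q hq0 hq1 (fun i => L (φ i - m)) ?_ ?_ k ε hε.le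
    · intro i
      refine (hL _).trans ((norm_sub_le _ _).trans ?_)
      linarith [hφ i]
    · have : ∑ i, q i * L (φ i - m) = L (∑ i, q i • (φ i - m)) := by
        rw [map_sum]; simp only [map_smul, smul_eq_mul]
      rw [this]
      have : ∑ i, q i • (φ i - m) = 0 := by
        simp only [smul_sub, sum_sub_distrib, ← sum_smul, hq1, one_smul]
        rw [hm]; simp
      rw [this, map_zero]
  have hre := key Complex.reLm (fun z => Complex.abs_re_le_norm z)
  have him := key Complex.imLm (fun z => Complex.abs_im_le_norm z)
  have hre' := key (-Complex.reLm) (fun z => by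
    simp only [LinearMap.neg_apply, abs_neg]; exact Complex.abs_re_le_norm z)
  have him' := key (-Complex.imLm) (fun z => by
    simp only [LinearMap.neg_apply, abs_neg]; exact Complex.abs_im_le_norm z)
  have hexp : Real.exp (-(k * ε ^ 2 / 64)) ≤ (1/2)^(p+2) := by
    have h1 : Real.exp (-(k * ε ^ 2 / 64)) ≤ Real.exp (-((p+2:ℕ):ℝ)) := by
      apply Real.exp_le_exp.2; push_cast; linarith
    refine h1.trans ?_
    rw [show (-((p+2:ℕ):ℝ)) = ((p+2:ℕ):ℝ) * (-1) by ring, Real.exp_nat_mul]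
    apply pow_le_pow_left₀ (Real.exp_pos _).le
    rw [Real.exp_neg, one_div]
    apply inv_anti₀ (by norm_num)
    have := Real.add_one_le_exp (1:ℝ); linarith
  calc _ ≤ ∑ v : Fin k → I, ((∏ j, q (v j)) * (if k * ε / 2 < ∑ j, Complex.reLm (φ (v j) - m) then 1 else 0)
        + (∏ j, q (v j)) * (if k * ε / 2 < ∑ j, Complex.imLm (φ (v j) - m) then 1 else 0)
        + (∏ j, q (v j)) * (if k * ε / 2 < ∑ j, (-Complex.reLm) (φ (v j) - m) then 1 else 0)
        + (∏ j, q (v j)) * (if k * ε / 2 < ∑ j, (-Complex.imLm) (φ (v j) - m) then 1 else 0)) := by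
        apply sum_le_sum; intro v _
        have hP : 0 ≤ ∏ j, q (v j) := prod_nonneg fun j _ => hq0 _
        rw [← mul_add, ← mul_add, ← mul_add]
        apply mul_le_mul_of_nonneg_left _ hP
        split_ifs with h0 h1 h2 h3 h4 <;> try norm_num
        exfalso
        set S : ℂ := ∑ j, (φ (v j) - m) with hS
        have e1 : (1 / k : ℂ) * ∑ j, φ (v j) - m = (1 / k : ℂ) * S := by
          rw [hS, sum_sub_distrib]; simp
          have : (k:ℂ) ≠ 0 := by exact_mod_cast hk0.ne'
          field_simp
        rw [e1, norm_mul] at h0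
        have e2 : ‖(1/k:ℂ)‖ = 1/k := by simp
        rw [e2] at h0
        have e3 : k * ε < ‖S‖ := by
          rw [one_div, ← div_eq_inv_mul, lt_div_iff₀ hk0] at h0; linarith
        have hr : ∑ j, Complex.reLm (φ (v j) - m) = S.re := by
          rw [← map_sum]; rfl
        have hi : ∑ j, Complex.imLm (φ (v j) - m) = S.im := by
          rw [← map_sum]; rfl
        rename_i g2 g3 g4
        simp only [LinearMap.neg_apply, sum_neg_distrib, hr, hi] at h1 g2 g3 g4
        have := Complex.norm_le_abs_re_add_abs_im S
        rcases abs_cases S.re with ⟨a, _⟩ | ⟨a, _⟩ <;> rcases abs_cases S.im with ⟨b, _⟩ | ⟨b, _⟩ <;> linarith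
    _ ≤ (1/2)^(p+2) + (1/2)^(p+2) + (1/2)^(p+2) + (1/2)^(p+2) := by
        rw [sum_add_distrib, sum_add_distrib, sum_add_distrib]; linarith
    _ = (1/2)^p := by rw [pow_add]; ring

lemma sum_prod_q {I : Type*} [Fintype I] (q : I → ℝ) (hq1 : ∑ i, q i = 1) (k : ℕ) :
    ∑ v : Fin k → I, ∏ j, q (v j) = 1 := by
  have := Finset.sum_pow' (R := ℝ) univ q k
  rw [hq1, one_pow, Fintype.piFinset_univ] at this
  exact this.symm

/-- sampling lemma -/
lemma sample_sum {I Y : Type*} [Fintype I] (q : I → ℝ) (hq0 : ∀ i, 0 ≤ q i) (hq1 : ∑ i, q i = 1)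
    (φ : I → Y → ℂ) (hφ : ∀ i y, ‖φ i y‖ ≤ 1) (s : Finset Y) (k p : ℕ) (ε : ℝ) (hε : 0 < ε)
    (hk : 64 * (p + 2 : ℝ) ≤ k * ε ^ 2) :
    ∑ v : Fin k → I, (∏ j, q (v j)) *
      ((s.filter fun y => ε < ‖(1 / k : ℂ) * ∑ j, φ (v j) y - ∑ i, (q i : ℂ) * φ i y‖).card : ℝ)
      ≤ (1 / 2) ^ p * s.card := by
  have : ∀ v : Fin k → I, (∏ j, q (v j)) *
      ((s.filter fun y => ε < ‖(1 / k : ℂ) * ∑ j, φ (v j) y - ∑ i, (q i : ℂ) * φ i y‖).card : ℝ)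
      = ∑ y ∈ s, (∏ j, q (v j)) *
        (if ε < ‖(1 / k : ℂ) * ∑ j, φ (v j) y - ∑ i, (q i : ℂ) * φ i y‖ then 1 else 0) := by
    intro v
    rw [card_filter, ← mul_sum]; push_cast; rfl
  simp only [this]
  rw [sum_comm]
  calc _ ≤ ∑ y ∈ s, ((1:ℝ)/2)^p := sum_le_sum fun y _ => sample_one q hq0 hq1 (fun i => φ i y) (fun i => hφ i y) k p ε hε hk
    _ = _ := by rw [sum_const, nsmul_eq_mul, mul_comm]

/-- existence version -/
lemma sample_exists {I Y : Type*} [Fintype I] (q : I → ℝ) (hq0 : ∀ i, 0 ≤ q i) (hq1 : ∑ i, q i = 1)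
    (φ : I → Y → ℂ) (hφ : ∀ i y, ‖φ i y‖ ≤ 1) (s : Finset Y) (k p : ℕ) (ε : ℝ) (hε : 0 < ε)
    (hk : 64 * (p + 2 : ℝ) ≤ k * ε ^ 2) :
    ∃ v : Fin k → I, 
      ((s.filter fun y => ε < ‖(1 / k : ℂ) * ∑ j, φ (v j) y - ∑ i, (q i : ℂ) * φ i y‖).card : ℝ)
      ≤ (1 / 2) ^ p * s.card := by
  by_contra! h
  have h1 := sample_sum q hq0 hq1 φ hφ s k p ε hε hk
  have h2 : ∑ v : Fin k → I, (∏ j, q (v j)) * ((1 / 2) ^ p * s.card : ℝ) = (1 / 2) ^ p * s.card := by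
    rw [← sum_mul, sum_prod_q q hq1, one_mul]
  have h3 : ∃ v : Fin k → I, (0:ℝ) < ∏ j, q (v j) := by
    by_contra! hh
    have := sum_prod_q q hq1 k
    have h4 : ∑ v : Fin k → I, ∏ j, q (v j) ≤ 0 := sum_nonpos fun v _ => hh v
    linarith
  obtain ⟨v0, hv0⟩ := h3
  have : ∑ v : Fin k → I, (∏ j, q (v j)) * ((1 / 2) ^ p * s.card : ℝ) < ∑ v : Fin k → I, (∏ j, q (v j)) *
      ((s.filter fun y => ε < ‖(1 / k : ℂ) * ∑ j, φ (v j) y - ∑ i, (q i : ℂ) * φ i y‖).card : ℝ) := by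
    apply sum_lt_sum
    · intro v _
      exact mul_le_mul_of_nonneg_left (h v).le (prod_nonneg fun j _ => hq0 _)
    · exact ⟨v0, mem_univ _, mul_lt_mul_of_pos_left (h v0) hv0⟩
  linarith

end P2

section P3
open scoped Classical
open Finset

variable {G : Type} [AddCommGroup G] [Fintype G]

noncomputable def Bo (Λ : Finset (AddChar G ℂ)) (ρ : ℝ) : Finset G :=
  univ.filter (fun t => ∀ γ ∈ Λ, ‖1 - γ t‖ ≤ ρ)

lemma mem_Bo {Λ : Finset (AddChar G ℂ)} {ρ : ℝ} {t : G} :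
    t ∈ Bo Λ ρ ↔ ∀ γ ∈ Λ, ‖1 - γ t‖ ≤ ρ := by simp [Bo]

lemma norm_char (γ : AddChar G ℂ) (x : G) : ‖γ x‖ = 1 := γ.norm_apply x

lemma char_sub_norm (γ : AddChar G ℂ) (x y : G) : ‖1 - γ (x - y)‖ = ‖γ x - γ y‖ := by
  have h : γ x = γ (x - y) * γ y := by rw [← AddChar.map_add_eq_mul]; simp
  rw [h, show γ (x-y) * γ y - γ y = (γ (x-y) - 1) * γ y by ring, norm_mul, norm_char, mul_one, norm_sub_rev]

lemma char_add_norm (γ : AddChar G ℂ) (x y : G) : ‖1 - γ (x + y)‖ ≤ ‖1 - γ x‖ + ‖1 - γ y‖ := by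
  rw [AddChar.map_add_eq_mul, show 1 - γ x * γ y = (1 - γ x) + γ x * (1 - γ y) by ring]
  refine (norm_add_le _ _).trans ?_
  rw [norm_mul, norm_char, one_mul]

lemma char_neg_norm (γ : AddChar G ℂ) (x : G) : ‖1 - γ (-x)‖ = ‖1 - γ x‖ := by
  have := char_sub_norm γ 0 x
  simpa using this

lemma Bo_zero_mem (Λ : Finset (AddChar G ℂ)) {ρ : ℝ} (h : 0 ≤ ρ) : (0 : G) ∈ Bo Λ ρ := by
  rw [mem_Bo]; intro γ _; simpa using h

lemma Bo_neg_mem {Λ : Finset (AddChar G ℂ)} {ρ : ℝ} {t : G} (h : t ∈ Bo Λ ρ) : -t ∈ Bo Λ ρ := by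
  rw [mem_Bo] at *; intro γ hγ; rw [char_neg_norm]; exact h γ hγ

lemma Bo_add_mem {Λ : Finset (AddChar G ℂ)} {ρ σ : ℝ} {t u : G} (h : t ∈ Bo Λ ρ) (h' : u ∈ Bo Λ σ) :
    t + u ∈ Bo Λ (ρ + σ) := by
  rw [mem_Bo] at *; intro γ hγ
  exact (char_add_norm γ t u).trans (add_le_add (h γ hγ) (h' γ hγ))

lemma Bo_mono {Λ Λ' : Finset (AddChar G ℂ)} {ρ σ : ℝ} (h : Λ' ⊆ Λ) (hρ : ρ ≤ σ) : Bo Λ ρ ⊆ Bo Λ' σ := by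
  intro t ht; rw [mem_Bo] at *; intro γ hγ; exact (ht γ (h hγ)).trans hρ

lemma cell_exists (T0 : Finset G) (Γ : Finset (AddChar G ℂ)) (m : ℕ) (hm : 1 ≤ m) :
    ∃ T1 ⊆ T0, T0.card ≤ (2 * m + 1) ^ (2 * Γ.card) * T1.card ∧
      ∀ t ∈ T1, ∀ t' ∈ T1, ∀ γ ∈ Γ, ‖γ t - γ t'‖ ≤ 2 / m := by
  have hm0 : (0:ℝ) < m := by exact_mod_cast hm
  let cell : G → (Γ → ℤ × ℤ) := fun t γ => (⌊(γ.1 t).re * m⌋, ⌊(γ.1 t).im * m⌋)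
  let box : Finset (Γ → ℤ × ℤ) := Fintype.piFinset fun _ => (Finset.Icc (-(m:ℤ)) m) ×ˢ (Finset.Icc (-(m:ℤ)) m)
  have hbox : box.card = (2*m+1)^(2*Γ.card) := by
    simp only [box, Fintype.card_piFinset, card_product, Int.card_Icc, prod_const, card_univ, Fintype.card_coe]
    rw [show ((m:ℤ) + 1 - -(m:ℤ)).toNat = 2*m+1 by omega, ← sq, ← pow_mul]
  have hfl : ∀ a : ℝ, |a| ≤ 1 → ⌊a * m⌋ ∈ Finset.Icc (-(m:ℤ)) m := by
    intro a ha
    rw [Finset.mem_Icc]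
    have := abs_le.1 ha
    constructor
    · rw [Int.le_floor]; push_cast; nlinarith
    · have : ((⌊a*m⌋:ℤ):ℝ) ≤ (m:ℤ) := (Int.floor_le _).trans (by push_cast; nlinarith)
      exact_mod_cast this
  have hmaps : ∀ t ∈ T0, cell t ∈ box := by
    intro t _
    rw [Fintype.mem_piFinset]
    intro γ
    rw [mem_product]
    exact ⟨hfl _ ((Complex.abs_re_le_norm _).trans (norm_char _ _).le), hfl _ ((Complex.abs_im_le_norm _).trans (norm_char _ _).le)⟩
  have hne : box.Nonempty := by
    rw [← card_pos, hbox]; positivity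
  obtain ⟨b, _, hb⟩ : ∃ b ∈ box, T0.card ≤ box.card * (T0.filter fun t => cell t = b).card := by
    by_contra! h
    have h1 := card_eq_sum_card_fiberwise hmaps
    have h2 : ∑ b ∈ box, box.card * (T0.filter fun t => cell t = b).card < ∑ b ∈ box, T0.card :=
      sum_lt_sum_of_nonempty hne h
    rw [← mul_sum, ← h1, sum_const, smul_eq_mul] at h2
    exact lt_irrefl _ h2
  refine ⟨_, filter_subset _ _, by rw [hbox] at hb; exact hb, ?_⟩
  intro t ht t' ht' γ hγ
  have e : cell t = cell t' := (mem_filter.1 ht).2.trans (mem_filter.1 ht').2.symm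
  have e1 := congr_fun e ⟨γ, hγ⟩
  simp only [cell, Prod.mk.injEq] at e1
  have a1 := Int.abs_sub_lt_one_of_floor_eq_floor e1.1
  have a2 := Int.abs_sub_lt_one_of_floor_eq_floor e1.2
  rw [← sub_mul, abs_mul, abs_of_pos hm0] at a1 a2
  refine (Complex.norm_le_abs_re_add_abs_im _).trans ?_
  rw [Complex.sub_re, Complex.sub_im, le_div_iff₀ hm0]
  linarith

/-- differences of a cell -/
lemma card_le_Bo_of_sub (T1 : Finset G) (Λ : Finset (AddChar G ℂ)) (ρ : ℝ) 
    (h : ∀ t ∈ T1, ∀ t' ∈ T1, ∀ γ ∈ Λ, ‖γ t - γ t'‖ ≤ ρ) : T1.card ≤ (Bo Λ ρ).card := by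
  rcases T1.eq_empty_or_nonempty with rfl | ⟨t0, h0⟩
  · simp
  · apply card_le_card_of_injOn (fun t => t - t0)
    · intro t ht
      rw [mem_coe, mem_Bo]; intro γ hγ
      rw [char_sub_norm]; exact h t ht t0 h0 γ hγ
    · intro a _ b _ hab; simpa using hab

lemma Bo_union_card (Λ Γ : Finset (AddChar G ℂ)) (m : ℕ) (hm : 1 ≤ m) :
    (Bo Λ (1 / m)).card ≤ (2 * m + 1) ^ (2 * Γ.card) * (Bo (Λ ∪ Γ) (2 / m)).card := by
  obtain ⟨T1, h1, h2, h3⟩ := cell_exists (Bo Λ (1/m)) Γ m hm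
  refine h2.trans (Nat.mul_le_mul_left _ (card_le_Bo_of_sub _ _ _ ?_))
  intro t ht t' ht' γ hγ
  rcases mem_union.1 hγ with h | h
  · have := mem_Bo.1 (h1 ht) γ h
    have := mem_Bo.1 (h1 ht') γ h
    calc ‖γ t - γ t'‖ = ‖(1 - γ t') - (1 - γ t)‖ := by congr 1; ring
      _ ≤ ‖1 - γ t'‖ + ‖1 - γ t‖ := norm_sub_le _ _
      _ ≤ 1/m + 1/m := by linarith
      _ = 2/m := by ring
  · exact h3 t ht t' ht' γ h

lemma reg_exists (f : ℝ → ℕ) (hf : Monotone f) (a : ℝ) (ha : 0 < a) (n K : ℕ) (hn : 1 ≤ n)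
    (hpos : 0 < f a) (hK : f (2 * a) ≤ 2 ^ K * f a) :
    ∃ ρ, a ≤ ρ ∧ ρ ≤ 2 * a ∧ (f (ρ + a / (n * (K + 1))) : ℝ) ≤ (1 + 1 / n) * f ρ := by
  have hn0 : (0:ℝ) < n := by exact_mod_cast hn
  have hK0 : (0:ℝ) < (K:ℝ) + 1 := by positivity
  set δ := a / (n * (K+1)) with hδ
  have hδ0 : 0 < δ := by positivity
  have hNδ : ((n * (K+1) : ℕ):ℝ) * δ = a := by rw [hδ]; push_cast; field_simp
  by_contra! h
  have key : ∀ i : ℕ, i ≤ n * (K+1) → (1 + 1/(n:ℝ))^i * f a ≤ f (a + i * δ) := by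
    intro i
    induction i with
    | zero => intro _; simp
    | succ i ih =>
      intro hi
      have h1 := ih (by omega)
      have h2 := h (a + i * δ) (by nlinarith [(Nat.cast_nonneg i : (0:ℝ) ≤ i)]) (by
        have : (i:ℝ) * δ ≤ ((n*(K+1):ℕ):ℝ) * δ := by
          apply mul_le_mul_of_nonneg_right _ hδ0.le; exact_mod_cast (by omega : i ≤ n*(K+1))
        linarith)
      rw [show a + i * δ + δ = a + ((i+1:ℕ):ℝ) * δ by push_cast; ring] at h2
      refine le_trans ?_ h2.le
      rw [pow_succ, mul_comm (_ ^ i), mul_assoc]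
      apply mul_le_mul_of_nonneg_left h1
      positivity
  have h1 := key _ le_rfl
  rw [hNδ, show a + a = 2 * a by ring] at h1
  have h2 : (2:ℝ) ≤ (1 + 1/(n:ℝ))^n := by
    have := one_add_mul_le_pow (a := 1/(n:ℝ)) (by have : 0 < 1/(n:ℝ) := by positivity
                                                  linarith) n
    have e : (n:ℝ) * (1/n) = 1 := by field_simp
    linarith
  have h3 : (2:ℝ)^(K+1) ≤ (1 + 1/(n:ℝ))^(n*(K+1)) := by
    rw [pow_mul]; exact pow_le_pow_left₀ (by norm_num) h2 _
  have h4 : (f (2*a) : ℝ) ≤ 2^K * f a := by exact_mod_cast hK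
  have h5 : (0:ℝ) < f a := by exact_mod_cast hpos
  have h6 : (2:ℝ)^(K+1) * f a ≤ (1 + 1/(n:ℝ))^(n*(K+1)) * f a := mul_le_mul_of_nonneg_right h3 h5.le
  have h7 : (0:ℝ) < 2^K * f a := by positivity
  rw [pow_succ] at h6
  linarith

lemma Bo_card_mono (Λ : Finset (AddChar G ℂ)) : Monotone fun ρ => (Bo Λ ρ).card :=
  fun _ _ h => card_le_card (Bo_mono (Subset.refl _) h)

lemma Bo_reg (Λ : Finset (AddChar G ℂ)) (a : ℝ) (ha : 0 < a) (n K : ℕ) (hn : 1 ≤ n)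
    (hK : (Bo Λ (2 * a)).card ≤ 2 ^ K * (Bo Λ a).card) :
    ∃ ρ, a ≤ ρ ∧ ρ ≤ 2 * a ∧ ((Bo Λ (ρ + a / (n * (K + 1)))).card : ℝ) ≤ (1 + 1 / n) * (Bo Λ ρ).card :=
  reg_exists (fun ρ => (Bo Λ ρ).card) (Bo_card_mono Λ) a ha n K hn 
    (card_pos.2 ⟨0, Bo_zero_mem Λ ha.le⟩) hK

end P3

section P4
open scoped Classical
open Finset

variable {G : Type} [AddCommGroup G] [Fintype G]

lemma dyadic_level (b : ℝ) (n : ℕ) (hb1 : b ≤ 1) (hb : (1/2:ℝ)^n < b) :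
    ∃ j < n, (1/2:ℝ)^(j+1) < b ∧ b ≤ (1/2)^j := by
  induction n with
  | zero => simp at hb; linarith
  | succ n ih =>
    by_cases h : (1/2:ℝ)^n < b
    · obtain ⟨j, hj, h1⟩ := ih h
      exact ⟨j, by omega, h1⟩
    · exact ⟨n, by omega, hb, not_lt.1 h⟩

lemma step_dyadic {I : Type*} (s : Finset I) (w b : I → ℝ) (hw : ∀ i, 0 ≤ w i) 
    (hb1 : ∀ i, b i ≤ 1) (ℓ : ℕ) (hW : ∑ i ∈ s, w i ≤ 2 ^ ℓ) (h : 3 / 16 ≤ ∑ i ∈ s, w i * b i) :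
    ∃ j < ℓ + 4, 2 ^ j / (8 * (ℓ + 4 : ℝ)) ≤
      ∑ i ∈ s.filter (fun i => (1/2:ℝ)^(j+1) < b i ∧ b i ≤ (1/2)^j), w i := by
  by_contra! hc
  have h1 : ∀ i ∈ s, w i * b i ≤ w i * (1/2)^(ℓ+4) + ∑ j ∈ range (ℓ+4),
      (1/2)^j * (if (1/2:ℝ)^(j+1) < b i ∧ b i ≤ (1/2)^j then w i else 0) := by
    intro i _
    have hnn : ∀ j ∈ range (ℓ+4), 0 ≤ (1/2:ℝ)^j * (if (1/2:ℝ)^(j+1) < b i ∧ b i ≤ (1/2)^j then w i else 0) := by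
      intro j _
      have := hw i
      positivity
    by_cases hb : (1/2:ℝ)^(ℓ+4) < b i
    · obtain ⟨j, hj, h2, h3⟩ := dyadic_level (b i) _ (hb1 i) hb
      have h4 := single_le_sum hnn (mem_range.2 hj)
      simp only [h2, h3, and_self, if_true] at h4
      have h5 : w i * b i ≤ (1/2)^j * w i := by rw [mul_comm]; exact mul_le_mul_of_nonneg_right h3 (hw i)
      have h6 : 0 ≤ w i * (1/2:ℝ)^(ℓ+4) := by have := hw i; positivity
      linarith
    · have h5 : w i * b i ≤ w i * (1/2)^(ℓ+4) := mul_le_mul_of_nonneg_left (not_lt.1 hb) (hw i)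
      have := sum_nonneg hnn
      linarith
  have h2 := sum_le_sum h1
  rw [sum_add_distrib, ← sum_mul, sum_comm] at h2
  have h3 : (∑ i ∈ s, w i) * (1/2)^(ℓ+4) ≤ 1/16 := by
    calc (∑ i ∈ s, w i) * (1/2)^(ℓ+4) ≤ 2^ℓ * (1/2)^(ℓ+4) := by gcongr
      _ = 1/16 := by rw [pow_add, ← mul_assoc, ← mul_pow]; norm_num
  have h4 : ∑ j ∈ range (ℓ+4), ∑ i ∈ s, (1/2:ℝ)^j * (if (1/2:ℝ)^(j+1) < b i ∧ b i ≤ (1/2)^j then w i else 0)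
      < ∑ j ∈ range (ℓ+4), 1/(8*(ℓ+4:ℝ)) := by
    apply sum_lt_sum_of_nonempty ⟨0, by simp⟩
    intro j hj
    have h5 := hc j (mem_range.1 hj)
    rw [← mul_sum, ← sum_filter]
    calc _ < (1/2:ℝ)^j * (2^j/(8*(ℓ+4:ℝ))) := by gcongr
      _ = _ := by rw [← mul_div_assoc, ← mul_pow]; norm_num
  rw [sum_const, card_range, nsmul_eq_mul] at h4
  have h5 : ((ℓ+4:ℕ):ℝ) * (1/(8*(ℓ+4:ℝ))) = 1/8 := by
    push_cast
    have : (ℓ:ℝ)+4 ≠ 0 := by positivity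
    field_simp
  linarith

/-- phases -/
lemma exists_phase (z : ℂ) : ∃ h : ℂ, ‖h‖ ≤ 1 ∧ h * z = (‖z‖ : ℂ) := by
  by_cases hz : z = 0
  · exact ⟨0, by simp, by simp [hz]⟩
  · refine ⟨(starRingEnd ℂ) z / ‖z‖, ?_, ?_⟩
    · rw [norm_div, RCLike.norm_conj, Complex.norm_real, norm_norm]
      exact div_self_le_one _
    · have : (‖z‖:ℂ) ≠ 0 := by simpa using hz
      rw [div_mul_eq_mul_div, mul_comm, Complex.mul_conj, Complex.normSq_eq_norm_sq]
      field_simp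
      push_cast; ring

lemma step_sample (E T S1 : Finset G) (x : G) (h : G → ℂ) (hh : ∀ y, ‖h y‖ ≤ 1) (hET : E ⊆ T)
    (h0 : (0:G) ∈ S1) (hTS : (T + S1).card ≤ 2 * T.card) (a j p : ℕ) (hp : a + j + 7 ≤ p)
    (hE : (1/2:ℝ)^a * T.card < E.card) (q : AddChar G ℂ → ℝ) (hq0 : ∀ γ, 0 ≤ q γ) (hq1 : ∑ γ, q γ = 1)
    (b : AddChar G ℂ → ℝ)
    (hb : ∀ γ, b γ = ‖(1 / E.card : ℂ) * ∑ y ∈ E, h y * γ (x + y)‖)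
    (hbq : ∀ γ, q γ ≠ 0 → (1/2:ℝ)^(j+1) ≤ b γ) :
    ∃ Γ : Finset (AddChar G ℂ), Γ.card ≤ 64 * (p + 2) * 4 ^ (j + 5) ∧
      ∀ s ∈ S1, (∀ γ ∈ Γ, ‖1 - γ s‖ ≤ (1/2:ℝ)^(j+6)) →
        (1/2:ℝ)^(j+2) ≤ (∑ γ, (q γ * b γ : ℂ) * γ s).re := by
  have hTne : (0:ℝ) ≤ T.card := Nat.cast_nonneg _
  have hE0 : (0:ℝ) < E.card := lt_of_le_of_lt (by positivity) hE
  set ht : AddChar G ℂ → ℂ := fun γ => (1 / E.card : ℂ) * ∑ y ∈ E, h y * γ (x + y) with hht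
  choose σ hσ1 hσ2 using fun γ => exists_phase (ht γ)
  set k := 64 * (p + 2) * 4 ^ (j + 5) with hk
  set ε : ℝ := (1/2)^(j+5) with hε
  have hε0 : 0 < ε := by positivity
  have hkε : 64 * (p + 2 : ℝ) ≤ k * ε^2 := by
    rw [hk, hε]; push_cast
    rw [← pow_mul, mul_comm (j+5) 2, pow_mul, mul_assoc, ← mul_pow]; norm_num
  have hk0 : (0:ℝ) < k := by rw [hk]; positivity
  obtain ⟨v, hv⟩ := sample_exists q hq0 hq1 (fun γ (y:G) => σ γ * γ (x + y)) (fun γ y => by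
    rw [norm_mul, norm_char, mul_one]; exact hσ1 γ) (T + S1) k p ε hε0 hkε
  set V : G → ℂ := fun y => ∑ γ, (q γ : ℂ) * (σ γ * γ (x + y)) with hV
  set A : G → ℂ := fun y => (1 / k : ℂ) * ∑ i, σ (v i) * v i (x + y) with hA
  set Bd := (T + S1).filter fun y => ε < ‖A y - V y‖ with hBd
  have hVn : ∀ y, ‖V y‖ ≤ 1 := by
    intro y
    calc ‖V y‖ ≤ ∑ γ, ‖(q γ : ℂ) * (σ γ * γ (x + y))‖ := norm_sum_le _ _
      _ ≤ ∑ γ, q γ := by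
        apply sum_le_sum; intro i _
        rw [norm_mul, norm_mul, norm_char, mul_one, Complex.norm_real, Real.norm_of_nonneg (hq0 i)]
        exact mul_le_of_le_one_right (hq0 i) (hσ1 i)
      _ = 1 := hq1
  have hBdc : 4 * (Bd.card:ℝ) ≤ (1/2)^(j+4) * E.card := by
    have e1 : (Bd.card:ℝ) ≤ (1/2)^p * (2 * T.card) := hv.trans (by
      gcongr; exact_mod_cast hTS)
    have e2 : (1/2:ℝ)^p ≤ (1/2)^(a + j + 7) := pow_le_pow_of_le_one (by norm_num) (by norm_num) hp
    calc 4 * (Bd.card:ℝ) ≤ 4 * ((1/2)^(a+j+7) * (2 * T.card)) := by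
          refine mul_le_mul_of_nonneg_left (e1.trans ?_) (by norm_num); gcongr
      _ = (1/2)^(j+4) * ((1/2)^a * T.card) := by rw [pow_add, pow_add, pow_add]; ring
      _ ≤ _ := by gcongr
  refine ⟨univ.image v, card_image_le.trans (by simp), ?_⟩
  intro s hs hsmall
  -- main identity
  have hid : ∀ s : G, (1 / E.card : ℂ) * ∑ y ∈ E, h y * V (y + s) = ∑ γ, (q γ * b γ : ℂ) * γ s := by
    intro s
    have : ∀ γ, (q γ * b γ : ℂ) * γ s = (1 / E.card : ℂ) * ∑ y ∈ E, h y * (q γ * (σ γ * γ (x + (y + s)))) := by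
      intro γ
      have e1 : (b γ : ℂ) = σ γ * ht γ := by rw [hσ2, hb]
      rw [e1]; simp only [hht]; simp only [mul_sum, sum_mul]
      apply sum_congr rfl; intro y _
      rw [← add_assoc, AddChar.map_add_eq_mul γ (x+y) s]; ring
    rw [sum_congr rfl fun γ _ => this γ, ← mul_sum, sum_comm]
    simp only [hV, mul_sum]
  have hAs : ∀ y, ‖A (y + s) - A y‖ ≤ (1/2)^(j+6) := by
    intro y
    have : A (y + s) - A y = (1 / k : ℂ) * ∑ i, σ (v i) * (v i (x + y) * (v i s - 1)) := by
      simp only [hA]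
      rw [← mul_sub, ← sum_sub_distrib]; congr 1
      apply sum_congr rfl; intro i _
      rw [← add_assoc, AddChar.map_add_eq_mul]; ring
    rw [this, norm_mul]
    have e1 : ‖∑ i, σ (v i) * (v i (x + y) * (v i s - 1))‖ ≤ k * (1/2)^(j+6) := by
      refine (norm_sum_le _ _).trans ?_
      have : ∀ i ∈ (univ : Finset (Fin k)), ‖σ (v i) * (v i (x + y) * (v i s - 1))‖ ≤ (1/2)^(j+6) := by
        intro i _
        rw [norm_mul, norm_mul, norm_char, one_mul, norm_sub_rev]
        have h3 := hsmall (v i) (mem_image_of_mem _ (mem_univ _))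
        have h4 := hσ1 (v i)
        nlinarith [norm_nonneg (σ (v i)), norm_nonneg (1 - v i s)]
      refine (sum_le_sum this).trans ?_
      simp
    have e2 : ‖(1/k:ℂ)‖ = 1/k := by simp
    rw [e2]
    calc 1/(k:ℝ) * _ ≤ 1/(k:ℝ) * (k * (1/2)^(j+6)) := by gcongr
      _ = _ := by field_simp
  -- pointwise difference
  have hpt : ∀ y ∈ E, ‖h y * V (y + s) - h y * V y‖ ≤ 
      (2 * ε + (1/2)^(j+6)) + (2 * (if y ∈ Bd then 1 else 0) + 2 * (if y + s ∈ Bd then 1 else 0)) := by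
    intro y hy
    rw [← mul_sub, norm_mul]
    have e0 : ‖h y‖ * ‖V (y+s) - V y‖ ≤ ‖V (y+s) - V y‖ := mul_le_of_le_one_left (norm_nonneg _) (hh y)
    refine e0.trans ?_
    have e2 : ‖V (y+s) - V y‖ ≤ 2 := by
      refine (norm_sub_le _ _).trans ?_
      linarith [hVn (y+s), hVn y]
    have pos : 0 ≤ 2 * ε + (1/2)^(j+6) := by positivity
    by_cases c1 : y ∈ Bd
    · rw [if_pos c1]
      have : (0:ℝ) ≤ (if y + s ∈ Bd then 1 else 0) := by split_ifs <;> norm_num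
      linarith
    by_cases c2 : y + s ∈ Bd
    · rw [if_pos c2, if_neg c1]; linarith
    rw [if_neg c1, if_neg c2]
    have m1 : y ∈ T + S1 := by simpa using add_mem_add (hET hy) h0
    have m2 : y + s ∈ T + S1 := add_mem_add (hET hy) hs
    have f1 : ‖A y - V y‖ ≤ ε := by
      by_contra hcc; exact c1 (mem_filter.2 ⟨m1, not_le.1 hcc⟩)
    have f2 : ‖A (y+s) - V (y+s)‖ ≤ ε := by
      by_contra hcc; exact c2 (mem_filter.2 ⟨m2, not_le.1 hcc⟩)
    have f3 := hAs y
    calc ‖V (y+s) - V y‖ = ‖(A y - V y) - (A (y+s) - V (y+s)) + (A (y+s) - A y)‖ := by congr 1; ring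
      _ ≤ ‖A y - V y‖ + ‖A (y+s) - V (y+s)‖ + ‖A (y+s) - A y‖ := 
        (norm_add_le _ _).trans (add_le_add_left (norm_sub_le _ _) _)
      _ ≤ _ := by linarith
  have hcount1 : ∑ y ∈ E, (if y ∈ Bd then (1:ℝ) else 0) ≤ Bd.card := by
    rw [← sum_filter, sum_const, nsmul_eq_mul, mul_one]
    exact_mod_cast card_le_card (fun y hy => (mem_filter.1 hy).2)
  have hcount2 : ∑ y ∈ E, (if y + s ∈ Bd then (1:ℝ) else 0) ≤ Bd.card := by
    rw [← sum_filter, sum_const, nsmul_eq_mul, mul_one]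
    have : (E.filter fun y => y + s ∈ Bd).card ≤ Bd.card := 
      card_le_card_of_injOn (fun y => y + s) (fun y hy => (mem_filter.1 hy).2) (fun a _ b _ hab => by simpa using hab)
    exact_mod_cast this
  have hdiff : ‖(1 / E.card : ℂ) * ∑ y ∈ E, h y * V (y + s) - (1 / E.card : ℂ) * ∑ y ∈ E, h y * V (y + 0)‖ 
      ≤ (1/2)^(j+2) := by
    rw [← mul_sub, ← sum_sub_distrib, norm_mul]
    simp only [add_zero]
    have e2 : ‖(1/E.card:ℂ)‖ = 1/E.card := by simp
    rw [e2, one_div, ← div_eq_inv_mul, div_le_iff₀ hE0]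
    refine (norm_sum_le _ _).trans ((sum_le_sum hpt).trans ?_)
    rw [sum_add_distrib, sum_const, sum_add_distrib, nsmul_eq_mul, ← mul_sum, ← mul_sum]
    have e3 : 2 * ε + (1/2)^(j+6) = (1/2)^j * (5/64) := by rw [hε, pow_add, pow_add]; ring
    have e4 : (1/2:ℝ)^(j+4) = (1/2)^j * (1/16) := by rw [pow_add]; norm_num
    have e5 : (1/2:ℝ)^(j+2) = (1/2)^j * (1/4) := by rw [pow_add]; norm_num
    rw [e4] at hBdc
    rw [e3, e5]
    have : 0 < (1/2:ℝ)^j * E.card := by positivity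
    nlinarith
  rw [hid, hid] at hdiff
  have hbase : (1/2:ℝ)^(j+1) ≤ (∑ γ, (q γ * b γ : ℂ) * γ 0).re := by
    have : ∑ γ, (q γ * b γ : ℂ) * γ 0 = ((∑ γ, q γ * b γ : ℝ) : ℂ) := by
      push_cast; simp
    rw [this, Complex.ofReal_re]
    calc (1/2:ℝ)^(j+1) = ∑ γ, q γ * (1/2)^(j+1) := by rw [← sum_mul, hq1, one_mul]
      _ ≤ _ := by
        apply sum_le_sum; intro γ _
        by_cases c : q γ = 0
        · simp [c]
        · exact mul_le_mul_of_nonneg_left (hbq γ c) (hq0 γ)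
  have h5 := (Complex.abs_re_le_norm _).trans hdiff
  rw [Complex.sub_re] at h5
  have h6 := (abs_le.1 h5).1
  have e5 : (1/2:ℝ)^(j+1) = 2 * (1/2)^(j+2) := by rw [pow_add, pow_add]; ring
  linarith

end P4

section P5
open scoped Classical
open Finset

variable {G : Type} [AddCommGroup G] [Fintype G]

noncomputable def Cap (M : ℕ) (T : Finset G) : Finset (AddChar G ℂ) :=
  univ.filter (fun γ => ∀ t ∈ T, ‖1 - γ t‖ ≤ 1 / (8 * M))

lemma Cap_anti (M : ℕ) {T T' : Finset G} (h : T' ⊆ T) : Cap M T ⊆ Cap M T' := by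
  intro γ hγ
  simp only [Cap, mem_filter, mem_univ, true_and] at *
  exact fun t ht => hγ t (h ht)

noncomputable def wt (c : AddChar G ℂ → ℂ) (M : ℕ) (T : Finset G) : ℝ := ∑ γ ∈ Cap M T, ‖c γ‖

noncomputable def phi (c : AddChar G ℂ → ℂ) (M : ℕ) (T : Finset G) (x : G) : ℂ := ∑ γ ∈ Cap M T, c γ * γ x

noncomputable def gfun (c : AddChar G ℂ → ℂ) (x : G) : ℂ := ∑ γ, c γ * γ x

def Good (c : AddChar G ℂ → ℂ) (F : G → ℤ) (M a : ℕ) (T : Finset G) : Prop :=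
  ∀ x, ((T.filter fun y => 1/4 < ‖(F (x + y) : ℂ) - phi c M T (x + y)‖).card : ℝ) ≤ (1/2)^a * T.card

/-- bias from approximate invariance -/
lemma char_close_of_avg (γ : AddChar G ℂ) (S : Finset G) (t : G) (M : ℕ) (hM : 1 ≤ M) (hS : S.Nonempty)
    (h1 : ((S.image (· + t) \ S).card : ℝ) ≤ S.card / (128 * M))
    (h2 : (S.card : ℝ) / 8 ≤ ‖∑ s ∈ S, γ s‖) : ‖1 - γ t‖ ≤ 1 / (8 * M) := by
  have hM0 : (0:ℝ) < M := by exact_mod_cast hM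
  have hS0 : (0:ℝ) < S.card := by exact_mod_cast hS.card_pos
  set S2 := S.image (· + t) with hS2
  have hcard : S2.card = S.card := card_image_of_injective _ (add_left_injective t)
  have e1 : γ t * ∑ s ∈ S, γ s = ∑ s ∈ S2, γ s := by
    rw [hS2, sum_image (fun a _ b _ h => by simpa using h), mul_sum]
    apply sum_congr rfl; intro s _; rw [AddChar.map_add_eq_mul, mul_comm]
  have e2 : ∑ s ∈ S2, γ s - ∑ s ∈ S, γ s = ∑ s ∈ S2 \ S, γ s - ∑ s ∈ S \ S2, γ s := by
    rw [← sum_inter_add_sum_sdiff S2 S, ← sum_inter_add_sum_sdiff S S2, inter_comm S S2]; ring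
  have e3 : ∀ R : Finset G, ‖∑ s ∈ R, γ s‖ ≤ R.card := by
    intro R
    refine (norm_sum_le _ _).trans ?_
    simp [norm_char]
  have e4 : (S \ S2).card = (S2 \ S).card := by
    have := card_sdiff_add_card_inter S S2
    have := card_sdiff_add_card_inter S2 S
    rw [inter_comm] at this; omega
  have e5 : ‖1 - γ t‖ * ‖∑ s ∈ S, γ s‖ ≤ S.card / (64 * M) := by
    rw [← norm_mul, show (1 - γ t) * ∑ s ∈ S, γ s = -(∑ s ∈ S2, γ s - ∑ s ∈ S, γ s) by rw [← e1]; ring, norm_neg, e2]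
    refine (norm_sub_le _ _).trans ?_
    have := e3 (S2 \ S)
    have h' := e3 (S \ S2)
    rw [e4] at h'
    have : (S.card : ℝ) / (64 * M) = 2 * (S.card / (128 * M)) := by ring
    linarith
  have e6 : ‖1 - γ t‖ * (S.card / 8) ≤ S.card / (64 * M) := 
    (mul_le_mul_of_nonneg_left h2 (norm_nonneg _)).trans e5
  have e7 : (S.card : ℝ) / (64 * M) = (1 / (8 * M)) * (S.card / 8) := by field_simp; norm_num
  rw [e7] at e6
  exact le_of_mul_le_mul_right e6 (by positivity)

lemma step_lemma (c : AddChar G ℂ → ℂ) (F : G → ℤ) (M ℓ a : ℕ) (hM : 1 ≤ M) (hMℓ : M ≤ 2 ^ ℓ)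
    (hc : ∑ γ, ‖c γ‖ ≤ M) (hF : ∀ x, ‖gfun c x - F x‖ ≤ 1 / 16) (T S1 : Finset G) 
    (h0 : (0:G) ∈ S1) (hTS : (T + S1).card ≤ 2 * T.card) (hbad : ¬ Good c F M a T) :
    ∃ j < ℓ + 4, ∃ Γ : Finset (AddChar G ℂ), Γ.card ≤ 64 * (a + ℓ + 10 + 2) * 4 ^ (j + 5) ∧
      ∀ S' ⊆ S1, S'.Nonempty → (∀ t ∈ S', ∀ γ ∈ Γ, ‖1 - γ t‖ ≤ (1/2:ℝ)^(j+6)) →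
        ∀ T' ⊆ T, (∀ t ∈ T', ((S'.image (· + t) \ S').card : ℝ) ≤ S'.card / (128 * M)) →
          wt c M T + 2 ^ j / (64 * (ℓ + 4 : ℝ)) ≤ wt c M T' := by
  have hM0 : (0:ℝ) < M := by exact_mod_cast hM
  unfold Good at hbad
  push Not at hbad
  obtain ⟨x, hx⟩ := hbad
  set E := T.filter fun y => 1/4 < ‖(F (x + y) : ℂ) - phi c M T (x + y)‖ with hE
  have hTne : (0:ℝ) ≤ T.card := Nat.cast_nonneg _
  have hE0 : (0:ℝ) < E.card := lt_of_le_of_lt (by positivity) hx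
  set D := univ \ Cap M T with hD
  set u : G → ℂ := fun y => ∑ γ ∈ D, c γ * γ (x + y) with hu
  have hug : ∀ y, u y = gfun c (x + y) - phi c M T (x + y) := by
    intro y
    rw [hu, gfun, phi, eq_sub_iff_add_eq]
    exact sum_sdiff (subset_univ _)
  have hun : ∀ y ∈ E, 3/16 ≤ ‖u y‖ := by
    intro y hy
    have h1 := (mem_filter.1 hy).2
    have h2 := hF (x + y)
    rw [hug]
    have : (F (x+y) : ℂ) - phi c M T (x+y) = (gfun c (x+y) - phi c M T (x+y)) - (gfun c (x+y) - F (x+y)) := by ring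
    rw [this] at h1
    have := norm_sub_le (gfun c (x+y) - phi c M T (x+y)) (gfun c (x+y) - F (x+y))
    linarith
  choose h hh1 hh2 using fun y => exists_phase (u y)
  set b : AddChar G ℂ → ℝ := fun γ => ‖(1 / E.card : ℂ) * ∑ y ∈ E, h y * γ (x + y)‖ with hb
  have hEn : ‖(1/E.card:ℂ)‖ = 1/E.card := by simp
  have hb1 : ∀ γ, b γ ≤ 1 := by
    intro γ
    simp only [hb]
    rw [norm_mul, hEn, one_div, ← div_eq_inv_mul, div_le_one hE0]
    refine (norm_sum_le _ _).trans ?_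
    calc ∑ y ∈ E, ‖h y * γ (x+y)‖ ≤ ∑ y ∈ E, (1:ℝ) := by
          apply sum_le_sum; intro y _; rw [norm_mul, norm_char, mul_one]; exact hh1 y
      _ = E.card := by simp
  have hmain : 3/16 ≤ ∑ γ ∈ D, ‖c γ‖ * b γ := by
    have e1 : (1 / E.card : ℂ) * ∑ y ∈ E, h y * u y = ∑ γ ∈ D, c γ * ((1 / E.card : ℂ) * ∑ y ∈ E, h y * γ (x + y)) := by
      simp only [hu, mul_sum]
      rw [sum_comm]
      apply sum_congr rfl; intro γ _
      apply sum_congr rfl; intro y _; ring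
    have e2 : (1 / E.card : ℂ) * ∑ y ∈ E, h y * u y = ((1 / E.card * ∑ y ∈ E, ‖u y‖ : ℝ) : ℂ) := by
      push_cast
      congr 1
      exact sum_congr rfl fun y _ => hh2 y
    have e3 : 3/16 ≤ 1 / E.card * ∑ y ∈ E, ‖u y‖ := by
      rw [one_div, ← div_eq_inv_mul, le_div_iff₀ hE0]
      calc 3/16 * (E.card:ℝ) = ∑ y ∈ E, (3/16:ℝ) := by simp [mul_comm]
        _ ≤ _ := sum_le_sum hun
    refine e3.trans ?_
    calc 1 / E.card * ∑ y ∈ E, ‖u y‖ ≤ ‖((1 / E.card * ∑ y ∈ E, ‖u y‖ : ℝ) : ℂ)‖ := by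
          rw [Complex.norm_real]; exact le_norm_self _
      _ ≤ _ := by
        rw [← e2, e1]
        refine (norm_sum_le _ _).trans (le_of_eq ?_)
        apply sum_congr rfl; intro γ _
        rw [norm_mul]
  obtain ⟨j, hj, hW⟩ := step_dyadic D (fun γ => ‖c γ‖) b (fun γ => norm_nonneg _) hb1 ℓ (by
    calc ∑ γ ∈ D, ‖c γ‖ ≤ ∑ γ, ‖c γ‖ := sum_le_sum_of_subset_of_nonneg (subset_univ _) (fun _ _ _ => norm_nonneg _)
      _ ≤ M := hc
      _ ≤ 2^ℓ := by exact_mod_cast hMℓ) hmain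
  set Lj := D.filter (fun i => (1/2:ℝ)^(j+1) < b i ∧ b i ≤ (1/2)^j) with hLj
  set W := ∑ γ ∈ Lj, ‖c γ‖ with hWdef
  have hℓ0 : (0:ℝ) < ℓ + 4 := by positivity
  have hW0 : 0 < W := lt_of_lt_of_le (by positivity) hW
  set q : AddChar G ℂ → ℝ := fun γ => if γ ∈ Lj then ‖c γ‖ / W else 0 with hq
  have hq0 : ∀ γ, 0 ≤ q γ := by
    intro γ; simp only [hq]; split_ifs <;> positivity
  have hq1 : ∑ γ, q γ = 1 := by
    simp only [hq]
    rw [← sum_filter, filter_mem_eq_inter, univ_inter, ← sum_div, ← hWdef, div_self hW0.ne']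
  have hqL : ∀ γ, q γ ≠ 0 → γ ∈ Lj := by
    intro γ; simp only [hq]; intro hne; by_contra hcc; exact hne (if_neg hcc)
  obtain ⟨Γ, hΓ1, hΓ2⟩ := step_sample E T S1 x h hh1 (filter_subset _ _) h0 hTS a j (a + ℓ + 10) (by omega) hx
    q hq0 hq1 b (fun _ => rfl) (fun γ hγ => (mem_filter.1 (hqL γ hγ)).2.1.le)
  refine ⟨j, hj, Γ, hΓ1, ?_⟩
  intro S' hS' hne hsm T' hT' hreg
  have hS0 : (0:ℝ) < S'.card := by exact_mod_cast hne.card_pos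
  -- average over S'
  have hav : S'.card * (1/2:ℝ)^(j+2) ≤ ∑ γ, q γ * (1/2)^j * ‖∑ s ∈ S', γ s‖ := by
    calc S'.card * (1/2:ℝ)^(j+2) = ∑ s ∈ S', (1/2:ℝ)^(j+2) := by simp
      _ ≤ ∑ s ∈ S', (∑ γ, (q γ * b γ : ℂ) * γ s).re := 
        sum_le_sum fun s hs => hΓ2 s (hS' hs) (hsm s hs)
      _ = (∑ γ, (q γ * b γ : ℂ) * ∑ s ∈ S', γ s).re := by
        rw [← Complex.re_sum, sum_comm]; simp only [mul_sum]
      _ ≤ ‖∑ γ, (q γ * b γ : ℂ) * ∑ s ∈ S', γ s‖ := Complex.re_le_norm _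
      _ ≤ ∑ γ, ‖(q γ * b γ : ℂ) * ∑ s ∈ S', γ s‖ := norm_sum_le _ _
      _ ≤ _ := by
        apply sum_le_sum; intro γ _
        rw [norm_mul, norm_mul, Complex.norm_real, Complex.norm_real, Real.norm_of_nonneg (hq0 γ), 
          Real.norm_of_nonneg (norm_nonneg _ : 0 ≤ b γ)]
        apply mul_le_mul_of_nonneg_right _ (norm_nonneg _)
        by_cases hz : q γ = 0
        · simp [hz]
        · exact mul_le_mul_of_nonneg_left (mem_filter.1 (hqL γ hz)).2.2 (hq0 γ)
  set B := Lj.filter fun γ => (S'.card : ℝ)/8 ≤ ‖∑ s ∈ S', γ s‖ with hB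
  have hpt : ∀ γ, q γ * (1/2)^j * ‖∑ s ∈ S', γ s‖ ≤ (1/2)^j * S'.card * ((if γ ∈ B then ‖c γ‖ / W else 0) + q γ / 8) := by
    intro γ
    have hn : ‖∑ s ∈ S', γ s‖ ≤ S'.card := by
      refine (norm_sum_le _ _).trans ?_
      simp [norm_char]
    have hp : (0:ℝ) < (1/2)^j := by positivity
    by_cases hz : q γ = 0
    · rw [hz]
      have : 0 ≤ (if γ ∈ B then ‖c γ‖ / W else 0) := by split_ifs <;> positivity
      have : 0 ≤ (1/2)^j * S'.card * ((if γ ∈ B then ‖c γ‖ / W else 0) + 0 / 8) := by positivity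
      simpa using this
    · have hL := hqL γ hz
      by_cases hb' : γ ∈ B
      · rw [if_pos hb']
        have e : q γ = ‖c γ‖ / W := by simp only [hq]; rw [if_pos hL]
        rw [← e]
        calc q γ * (1/2)^j * ‖∑ s ∈ S', γ s‖ ≤ q γ * (1/2)^j * S'.card := by
              apply mul_le_mul_of_nonneg_left hn; have := hq0 γ; positivity
          _ = (1/2)^j * S'.card * (q γ) := by ring
          _ ≤ _ := by apply mul_le_mul_of_nonneg_left _ (by positivity); linarith [hq0 γ]
      · rw [if_neg hb']
        have : ‖∑ s ∈ S', γ s‖ ≤ S'.card/8 := by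
          by_contra hcc; exact hb' (mem_filter.2 ⟨hL, (not_le.1 hcc).le⟩)
        calc q γ * (1/2)^j * ‖∑ s ∈ S', γ s‖ ≤ q γ * (1/2)^j * (S'.card/8) := by
              apply mul_le_mul_of_nonneg_left this; have := hq0 γ; positivity
          _ = _ := by ring
  have hmass : W / 8 ≤ ∑ γ ∈ B, ‖c γ‖ := by
    have h1 := hav.trans (sum_le_sum fun γ _ => hpt γ)
    rw [← mul_sum, sum_add_distrib, ← sum_filter, filter_mem_eq_inter, univ_inter, ← sum_div, ← sum_div, hq1] at h1
    have h2 : (S'.card:ℝ) * (1/2:ℝ)^(j+2) = (1/2)^j * S'.card * (1/4) := by rw [pow_add]; ring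
    rw [h2] at h1
    have h3 := le_of_mul_le_mul_left h1 (by positivity)
    have h4 : 1/8 ≤ (∑ γ ∈ B, ‖c γ‖)/W := by linarith
    rw [le_div_iff₀ hW0] at h4; linarith
  have hsub : Cap M T ∪ B ⊆ Cap M T' := by
    apply union_subset (Cap_anti M hT')
    intro γ hγ
    simp only [Cap, mem_filter, mem_univ, true_and]
    intro t ht
    exact char_close_of_avg γ S' t M hM hne (hreg t ht) (mem_filter.1 hγ).2
  have hdisj : Disjoint (Cap M T) B := by
    rw [Finset.disjoint_left]
    intro γ h1 h2
    have h3 := (mem_filter.1 (mem_filter.1 h2).1).1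
    exact (mem_sdiff.1 h3).2 h1
  have hfin : wt c M T + ∑ γ ∈ B, ‖c γ‖ ≤ wt c M T' := by
    rw [wt, wt, ← sum_union hdisj]
    exact sum_le_sum_of_subset_of_nonneg hsub fun _ _ _ => norm_nonneg _
  have : (2:ℝ) ^ j / (64 * (ℓ + 4 : ℝ)) = 2 ^ j / (8 * (ℓ + 4 : ℝ)) / 8 := by field_simp; norm_num
  rw [this]
  linarith

end P5

section P6
open scoped Classical
open Finset

variable {G : Type} [AddCommGroup G] [Fintype G]

lemma wt_le (c : AddChar G ℂ → ℂ) (M : ℕ) (T : Finset G) (hc : ∑ γ, ‖c γ‖ ≤ M) : wt c M T ≤ M :=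
  (sum_le_sum_of_subset_of_nonneg (subset_univ _) fun _ _ _ => norm_nonneg _).trans hc

lemma wt_nonneg (c : AddChar G ℂ → ℂ) (M : ℕ) (T : Finset G) : 0 ≤ wt c M T :=
  sum_nonneg fun _ _ => norm_nonneg _

lemma wt_anti (c : AddChar G ℂ → ℂ) (M : ℕ) {T T' : Finset G} (h : T' ⊆ T) : wt c M T ≤ wt c M T' :=
  sum_le_sum_of_subset_of_nonneg (Cap_anti M h) fun _ _ _ => norm_nonneg _

lemma Bo_reg2 (Λ : Finset (AddChar G ℂ)) (r n K Δ : ℕ) (hn : 1 ≤ n) (hΔ : 2 * n * (K + 1) ≤ 2 ^ Δ)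
    (hK : (Bo Λ ((1/2)^r)).card ≤ 2 ^ K * (Bo Λ ((1/2)^(r+1))).card) :
    ∃ ρ : ℝ, (1/2)^(r+1) ≤ ρ ∧ ρ ≤ (1/2)^r ∧ 
      ((Bo Λ (ρ + (1/2)^(r+Δ))).card : ℝ) ≤ (1 + 1 / n) * (Bo Λ ρ).card := by
  have e : (2:ℝ) * (1/2)^(r+1) = (1/2)^r := by rw [pow_succ]; ring
  obtain ⟨ρ, h1, h2, h3⟩ := Bo_reg Λ ((1/2)^(r+1)) (by positivity) n K hn (by rw [e]; exact hK)
  rw [e] at h2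
  refine ⟨ρ, h1, h2, le_trans ?_ h3⟩
  have : (1/2:ℝ)^(r+Δ) ≤ (1/2)^(r+1) / (n * (K+1)) := by
    have hn0 : (0:ℝ) < n := by exact_mod_cast hn
    rw [le_div_iff₀ (by positivity), pow_add, pow_succ, mul_assoc]
    apply mul_le_mul_of_nonneg_left _ (by positivity)
    have h4 : (2:ℝ) * n * (K+1) ≤ 2^Δ := by exact_mod_cast hΔ
    have h5 : (1/2:ℝ)^Δ * 2^Δ = 1 := by rw [← mul_pow]; norm_num
    have h6 : (0:ℝ) < (1/2)^Δ := by positivity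
    nlinarith
  have h7 : (Bo Λ (ρ + (1/2)^(r+Δ))).card ≤ (Bo Λ (ρ + (1/2)^(r+1) / (n * (K+1)))).card :=
    card_le_card (Bo_mono (Subset.refl _) (by linarith))
  exact_mod_cast h7

lemma iterate (c : AddChar G ℂ → ℂ) (F : G → ℤ) (M ℓ a : ℕ) (hM : 1 ≤ M) (hMℓ : M ≤ 2 ^ ℓ)
    (hc : ∑ γ, ‖c γ‖ ≤ M) (hF : ∀ x, ‖gfun c x - F x‖ ≤ 1 / 16) (Λ0 : Finset (AddChar G ℂ))
    (K Δ : ℕ) (hΔ : 2 * (128 * M) * (K + 1) ≤ 2 ^ Δ) (hΔ' : ℓ + 10 ≤ Δ)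
    (hK : ∀ (Γ : Finset (AddChar G ℂ)) (r : ℕ), 
      Γ.card ≤ 2^16 * (a + ℓ + 12) * ((64 * (ℓ + 4) * M)^2 + 4^(ℓ+3)) → 
      r ≤ 2 * Δ * (64 * (ℓ + 4) * M) + Δ →
      (Bo (Λ0 ∪ Γ) ((1/2)^r)).card ≤ 2 ^ K * (Bo (Λ0 ∪ Γ) ((1/2)^(r+1))).card) :
    ∃ (Γ : Finset (AddChar G ℂ)) (r : ℕ) (ρ : ℝ), Γ.card ≤ 2^16 * (a + ℓ + 12) * (64 * (ℓ + 4) * M)^2 ∧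
      r ≤ 2 * Δ * (64 * (ℓ + 4) * M) ∧ (1/2)^(r+1) ≤ ρ ∧ ρ ≤ (1/2)^r ∧ Good c F M a (Bo (Λ0 ∪ Γ) ρ) := by
  set Wm : ℕ := 64 * (ℓ + 4) * M with hWm
  set P : ℕ := a + ℓ + 12 with hP
  set w : Finset G → ℝ := fun T => 64 * (ℓ + 4) * wt c M T with hw
  have hwm : ∀ T, w T ≤ Wm := by
    intro T
    simp only [hw, hWm]; push_cast
    exact mul_le_mul_of_nonneg_left (wt_le c M T hc) (by positivity)
  have hw0 : ∀ T, 0 ≤ w T := by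
    intro T
    have := wt_nonneg c M T
    simp only [hw]; positivity
  have hM0 : (0:ℝ) < M := by exact_mod_cast hM
  suffices H : ∀ (N : ℕ) (Γ : Finset (AddChar G ℂ)) (r : ℕ), 
      (Γ.card : ℝ) ≤ 2^16 * P * (w (Bo (Λ0 ∪ Γ) ((1/2)^r)))^2 → (r:ℝ) ≤ 2 * Δ * w (Bo (Λ0 ∪ Γ) ((1/2)^r)) →
      (Wm:ℝ) < w (Bo (Λ0 ∪ Γ) ((1/2)^r)) + N → 
      ∃ (Γ : Finset (AddChar G ℂ)) (r : ℕ) (ρ : ℝ), Γ.card ≤ 2^16 * P * Wm^2 ∧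
      r ≤ 2 * Δ * Wm ∧ (1/2)^(r+1) ≤ ρ ∧ ρ ≤ (1/2)^r ∧ Good c F M a (Bo (Λ0 ∪ Γ) ρ) by
    refine H (Wm + 1) ∅ 0 ?_ ?_ ?_
    · have := hw0 (Bo (Λ0 ∪ ∅) ((1/2)^0)); simp only [card_empty]; push_cast; positivity
    · have := hw0 (Bo (Λ0 ∪ ∅) ((1/2)^0)); push_cast; positivity
    · have := hw0 (Bo (Λ0 ∪ ∅) ((1/2)^0)); push_cast; linarith
  intro N
  induction N with
  | zero => intro Γ r _ _ h; have := hwm (Bo (Λ0 ∪ Γ) ((1/2)^r)); push_cast at h; linarith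
  | succ N ih =>
    intro Γ r h1 h2 h3
    set Λ := Λ0 ∪ Γ with hΛ
    set w0 := w (Bo Λ ((1/2)^r)) with hw0'
    have w0n : 0 ≤ w0 := hw0 _
    have w0m : w0 ≤ Wm := hwm _
    have hΓc : Γ.card ≤ 2^16 * P * Wm^2 := by
      have : (Γ.card : ℝ) ≤ 2^16 * P * Wm^2 := h1.trans (by gcongr)
      exact_mod_cast this
    have hrc : r ≤ 2 * Δ * Wm := by
      have : (r : ℝ) ≤ 2 * Δ * Wm := h2.trans (by gcongr)
      exact_mod_cast this
    have hn : 1 ≤ 128 * M := by omega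
    obtain ⟨ρ, hρ1, hρ2, hρ3⟩ := Bo_reg2 Λ r (128 * M) K Δ hn hΔ (hK Γ r (hΓc.trans (by gcongr; exact Nat.le_add_right _ _)) (by omega))
    by_cases hgood : Good c F M a (Bo Λ ρ)
    · exact ⟨Γ, r, ρ, hΓc, hrc, hρ1, hρ2, hgood⟩
    have hT : (Bo Λ ρ + Bo Λ ((1/2)^(r+Δ))).card ≤ 2 * (Bo Λ ρ).card := by
      have e1 : (Bo Λ ρ + Bo Λ ((1/2)^(r+Δ))) ⊆ Bo Λ (ρ + (1/2)^(r+Δ)) := by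
        intro z hz
        obtain ⟨x, hx, y, hy, rfl⟩ := mem_add.1 hz
        exact Bo_add_mem hx hy
      have e2 : ((Bo Λ ρ + Bo Λ ((1/2)^(r+Δ))).card : ℝ) ≤ 2 * (Bo Λ ρ).card := by
        refine le_trans (by exact_mod_cast card_le_card e1) (hρ3.trans ?_)
        apply mul_le_mul_of_nonneg_right _ (Nat.cast_nonneg _)
        have : (1:ℝ) / ((128 * M : ℕ):ℝ) ≤ 1 := by
          rw [div_le_one (by exact_mod_cast hn)]; exact_mod_cast hn
        linarith
      exact_mod_cast e2
    obtain ⟨j, hj, Γ', hΓ', hstep⟩ := step_lemma c F M ℓ a hM hMℓ hc hF (Bo Λ ρ) (Bo Λ ((1/2)^(r+Δ)))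
      (Bo_zero_mem _ (by positivity)) hT hgood
    have hΓ'2 : Γ'.card ≤ 2^16 * P * 4^j := by
      refine hΓ'.trans (le_of_eq ?_)
      rw [hP, pow_add]; ring
    have hΓΓ : (Γ ∪ Γ').card ≤ 2^16 * P * (Wm^2 + 4^(ℓ+3)) := by
      refine (card_union_le _ _).trans ?_
      have : 4^j ≤ 4^(ℓ+3) := Nat.pow_le_pow_right (by norm_num) (by omega)
      calc Γ.card + Γ'.card ≤ 2^16 * P * Wm^2 + 2^16 * P * 4^(ℓ+3) := by
            apply add_le_add hΓc (hΓ'2.trans _); gcongr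
        _ = _ := by ring
    set Λ' := Λ0 ∪ (Γ ∪ Γ') with hΛ'
    have hsub1 : Λ ⊆ Λ' := union_subset_union_right subset_union_left
    have hsub2 : Γ' ⊆ Λ' := subset_union_right.trans subset_union_right
    obtain ⟨ρ', hρ1', hρ2', hρ3'⟩ := Bo_reg2 Λ' (r + Δ) (128 * M) K Δ hn hΔ (hK _ (r+Δ) hΓΓ (by omega))
    have hmono : ∀ {m n : ℕ}, m ≤ n → (1/2:ℝ)^n ≤ (1/2)^m := fun h => 
      pow_le_pow_of_le_one (by norm_num) (by norm_num) h
    have hρ'0 : 0 ≤ ρ' := le_trans (by positivity) hρ1'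
    have hfin := hstep (Bo Λ' ρ') (Bo_mono hsub1 hρ2') ⟨0, Bo_zero_mem _ hρ'0⟩ (by
      intro t ht γ hγ
      refine (mem_Bo.1 ht γ (hsub2 hγ)).trans (hρ2'.trans (hmono (by omega)))) 
      (Bo Λ' ((1/2)^(r + Δ + Δ))) (Bo_mono hsub1 (le_trans (hmono (by omega)) hρ1)) (by
      intro t ht
      have e1 : (Bo Λ' ρ').image (· + t) \ Bo Λ' ρ' ⊆ Bo Λ' (ρ' + (1/2)^(r+Δ+Δ)) \ Bo Λ' ρ' := by
        apply sdiff_subset_sdiff _ (Subset.refl _)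
        intro z hz
        obtain ⟨s, hs, rfl⟩ := mem_image.1 hz
        exact Bo_add_mem hs ht
      have e2 : Bo Λ' ρ' ⊆ Bo Λ' (ρ' + (1/2)^(r+Δ+Δ)) := 
        Bo_mono (Subset.refl _) (le_add_of_nonneg_right (by positivity))
      have e3 := card_sdiff_add_card_eq_card e2
      have e4 := card_le_card e1
      have e5 : (((Bo Λ' (ρ' + (1/2)^(r+Δ+Δ)) \ Bo Λ' ρ').card : ℝ)) + (Bo Λ' ρ').card = (Bo Λ' (ρ' + (1/2)^(r+Δ+Δ))).card := by
        exact_mod_cast e3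
      have e6 : ((((Bo Λ' ρ').image (· + t) \ Bo Λ' ρ').card : ℝ)) ≤ (Bo Λ' (ρ' + (1/2)^(r+Δ+Δ)) \ Bo Λ' ρ').card := by
        exact_mod_cast e4
      have e7 : (1 + 1 / ((128 * M : ℕ):ℝ)) * (Bo Λ' ρ').card = (Bo Λ' ρ').card + (Bo Λ' ρ').card / (128 * M) := by
        push_cast; ring
      rw [e7] at hρ3'
      linarith)
    have hw' : w0 + 2^j ≤ w (Bo Λ' ((1/2)^(r+Δ+Δ))) := by
      have g1 : wt c M (Bo Λ ((1/2)^r)) ≤ wt c M (Bo Λ ρ) := wt_anti c M (Bo_mono (Subset.refl _) hρ2)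
      have g2 : wt c M (Bo Λ ((1/2)^r)) + 2 ^ j / (64 * (ℓ + 4 : ℝ)) ≤ wt c M (Bo Λ' ((1/2)^(r+Δ+Δ))) := by linarith
      have g3 := mul_le_mul_of_nonneg_left g2 (by positivity : (0:ℝ) ≤ 64 * (ℓ + 4))
      rw [mul_add, mul_div_cancel₀ _ (by positivity)] at g3
      exact g3
    have hj1 : (1:ℝ) ≤ 2^j := one_le_pow₀ (by norm_num)
    refine ih (Γ ∪ Γ') (r + Δ + Δ) ?_ ?_ ?_
    · have g1 : ((Γ ∪ Γ').card : ℝ) ≤ Γ.card + Γ'.card := by exact_mod_cast card_union_le _ _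
      have g2 : (Γ'.card : ℝ) ≤ 2^16 * P * 4^j := by exact_mod_cast hΓ'2
      have g3 : (4:ℝ)^j = (2^j)^2 := by rw [← pow_mul, mul_comm, pow_mul]; norm_num
      rw [g3] at g2
      have g4 : w0^2 + (2^j)^2 ≤ (w (Bo Λ' ((1/2)^(r+Δ+Δ))))^2 := by nlinarith
      calc ((Γ ∪ Γ').card : ℝ) ≤ 2^16 * P * (w0^2 + (2^j)^2) := by linarith
        _ ≤ _ := by gcongr
    · push_cast
      have : (0:ℝ) ≤ Δ := Nat.cast_nonneg _
      calc (r:ℝ) + Δ + Δ ≤ 2 * Δ * (w0 + 1) := by linarith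
        _ ≤ 2 * Δ * w (Bo Λ' ((1/2)^(r+Δ+Δ))) := by gcongr; linarith
    · push_cast at h3
      linarith

end P6

section P7
open scoped Classical
open Finset

variable {G : Type} [AddCommGroup G] [Fintype G]

lemma int_eq_of_norm_lt (m n : ℤ) (h : ‖(m:ℂ) - n‖ < 1) : m = n := by
  have : ‖((m - n : ℤ) : ℂ)‖ < 1 := by push_cast; exact h
  rw [Complex.norm_intCast] at this
  have h2 : |m - n| < 1 := by exact_mod_cast this
  have := Int.abs_lt_one_iff.1 h2
  omega

noncomputable def Hf (H : AddSubgroup G) : Finset G := univ.filter (· ∈ H)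

lemma mem_Hf {H : AddSubgroup G} {x : G} : x ∈ Hf H ↔ x ∈ H := by simp [Hf]

lemma Hf_pos (H : AddSubgroup G) : 0 < (Hf H).card := card_pos.2 ⟨0, mem_Hf.2 H.zero_mem⟩

lemma final_struct (c : AddChar G ℂ → ℂ) (F : G → ℤ) (M a : ℕ) (ε : ℝ) (hM : 1 ≤ M) (ha : 1 ≤ a)
    (hc : ∑ γ, ‖c γ‖ ≤ M) (hε : ε ≤ 1/16) (hF : ∀ x, ‖gfun c x - F x‖ ≤ ε) (T : Finset G)
    (hTn : T.Nonempty) (hgood : Good c F M a T)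
    (x0 : G) (hx0 : (1/2:ℝ)^a * T.card < (T.filter fun s => F (x0 + s) ≠ 0).card) :
    ∃ (H : AddSubgroup G) (R : G → ℤ), T.card ≤ (Hf H).card ∧ (∀ x, ∀ h ∈ H, R (x + h) = R x) ∧
      (∀ x, ‖(1 / (Hf H).card : ℂ) * ∑ h ∈ Hf H, gfun c (x + h) - R x‖ ≤ ε + 2 * (M + 1) * (1/2)^a) ∧
      ∑ x, |R x| ≤ 2 * ∑ x, |F x| ∧ R x0 ≠ 0 := by
  have hM0 : (0:ℝ) < M := by exact_mod_cast hM
  have hT0 : (0:ℝ) < T.card := by exact_mod_cast hTn.card_pos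
  have hκ : (1/2:ℝ)^a ≤ 1/2 := by
    calc (1/2:ℝ)^a ≤ (1/2)^1 := pow_le_pow_of_le_one (by norm_num) (by norm_num) ha
      _ = 1/2 := by norm_num
  set φ := phi c M T with hφ
  have hinv : ∀ x, ∀ t ∈ T, ‖φ (x + t) - φ x‖ ≤ 1/8 := by
    intro x t ht
    have e : φ (x+t) - φ x = ∑ γ ∈ Cap M T, c γ * (γ x * (γ t - 1)) := by
      rw [hφ, phi, phi, ← sum_sub_distrib]
      apply sum_congr rfl; intro γ _; rw [AddChar.map_add_eq_mul]; ring
    rw [e]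
    calc _ ≤ ∑ γ ∈ Cap M T, ‖c γ‖ * (1/(8*M)) := by
          refine (norm_sum_le _ _).trans (sum_le_sum ?_)
          intro γ hγ
          rw [norm_mul, norm_mul, norm_char, one_mul, norm_sub_rev]
          simp only [Cap, mem_filter, mem_univ, true_and] at hγ
          exact mul_le_mul_of_nonneg_left (hγ t ht) (norm_nonneg _)
      _ = wt c M T * (1/(8*M)) := by rw [← sum_mul]; rfl
      _ ≤ M * (1/(8*M)) := by apply mul_le_mul_of_nonneg_right (wt_le c M T hc); positivity
      _ = 1/8 := by field_simp
  have hex : ∀ x, ∃ y ∈ T, ‖(F (x + y) : ℂ) - φ (x + y)‖ ≤ 1/4 := by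
    intro x
    by_contra! h
    have h1 := hgood x
    rw [filter_true_of_mem h] at h1
    nlinarith
  choose Y hY1 hY2 using hex
  set R : G → ℤ := fun x => F (x + Y x) with hR
  have hRφ : ∀ x, ‖(R x : ℂ) - φ x‖ ≤ 3/8 := by
    intro x
    have h1 := hY2 x
    have h2 := hinv x _ (hY1 x)
    calc ‖(R x : ℂ) - φ x‖ = ‖((F (x + Y x) : ℂ) - φ (x + Y x)) + (φ (x + Y x) - φ x)‖ := by
          congr 1; simp only [hR]; ring
      _ ≤ _ := (norm_add_le _ _).trans (by linarith)
  have hRt : ∀ x, ∀ t ∈ T, R (x + t) = R x := by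
    intro x t ht
    apply int_eq_of_norm_lt
    have h1 := hRφ x
    have h2 := hRφ (x+t)
    have h3 := hinv x t ht
    calc ‖(R (x+t) : ℂ) - R x‖ = ‖((R (x+t) : ℂ) - φ (x+t)) - ((R x : ℂ) - φ x) + (φ (x+t) - φ x)‖ := by
          congr 1; ring
      _ ≤ ‖(R (x+t) : ℂ) - φ (x+t)‖ + ‖(R x : ℂ) - φ x‖ + ‖φ (x+t) - φ x‖ :=
        (norm_add_le _ _).trans (add_le_add_left (norm_sub_le _ _) _)
      _ < 1 := by linarith
  set H := AddSubgroup.closure (T : Set G) with hH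
  have hRH : ∀ h ∈ H, ∀ x, R (x + h) = R x := by
    intro h hh
    induction hh using AddSubgroup.closure_induction with
    | mem t ht => exact fun x => hRt x t ht
    | zero => simp
    | add a b _ _ iha ihb => intro x; rw [← add_assoc, ihb, iha]
    | neg a _ iha => intro x; have := iha (x + -a); rw [← this]; simp
  have hTH : T ⊆ Hf H := fun t ht => mem_Hf.2 (AddSubgroup.subset_closure ht)
  have hH0 : (0:ℝ) < (Hf H).card := by exact_mod_cast Hf_pos H
  have hbadT : ∀ y, ((T.filter fun s => F (y + s) ≠ R y).card : ℝ) ≤ (1/2)^a * T.card := by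
    intro y
    refine le_trans ?_ (hgood y)
    have : (T.filter fun s => F (y + s) ≠ R y) ⊆ T.filter fun s => 1/4 < ‖(F (y + s) : ℂ) - phi c M T (y + s)‖ := by
      intro s hs
      rw [mem_filter] at *
      refine ⟨hs.1, ?_⟩
      by_contra hcc
      apply hs.2
      rw [← hRt y s hs.1]
      apply int_eq_of_norm_lt
      have h1 := hRφ (y+s)
      have h2 := not_lt.1 hcc
      calc ‖(F (y+s) : ℂ) - R (y+s)‖ = ‖((F (y+s) : ℂ) - φ (y+s)) - ((R (y+s):ℂ) - φ (y+s))‖ := by congr 1; ring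
        _ ≤ _ := norm_sub_le _ _
        _ < 1 := by rw [hφ] at *; linarith
    exact_mod_cast card_le_card this
  have hbadH : ∀ x, (((Hf H).filter fun h => F (x + h) ≠ R x).card : ℝ) ≤ (1/2)^a * (Hf H).card := by
    intro x
    have e1 : ∑ h ∈ Hf H, ((T.filter fun s => F (x + h + s) ≠ R (x + h)).card : ℝ) 
        = T.card * ((Hf H).filter fun h => F (x + h) ≠ R x).card := by
      have : ∀ s ∈ T, ∑ h ∈ Hf H, (if F (x + h + s) ≠ R (x + h) then (1:ℝ) else 0) 
          = ((Hf H).filter fun h => F (x + h) ≠ R x).card := by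
        intro s hs
        rw [card_filter]; push_cast
        apply sum_bij (fun h _ => h + s)
        · intro h hh; exact mem_Hf.2 (H.add_mem (mem_Hf.1 hh) (mem_Hf.1 (hTH hs)))
        · intro a _ b _ hab; simpa using hab
        · intro b hb
          exact ⟨b - s, mem_Hf.2 (H.sub_mem (mem_Hf.1 hb) (mem_Hf.1 (hTH hs))), by simp⟩
        · intro h hh
          rw [hRH h (mem_Hf.1 hh), add_assoc]
      have e2 : ∀ h, ((T.filter fun s => F (x + h + s) ≠ R (x + h)).card : ℝ) = 
          ∑ s ∈ T, (if F (x + h + s) ≠ R (x + h) then (1:ℝ) else 0) := by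
        intro h; rw [card_filter]; push_cast; rfl
      simp only [e2]
      rw [sum_comm, sum_congr rfl this, sum_const, nsmul_eq_mul]
    have e3 : ∑ h ∈ Hf H, ((T.filter fun s => F (x + h + s) ≠ R (x + h)).card : ℝ) ≤ (Hf H).card * ((1/2)^a * T.card) := by
      refine (sum_le_sum fun h _ => hbadT (x + h)).trans ?_
      rw [sum_const, nsmul_eq_mul]
    rw [e1] at e3
    have : (T.card:ℝ) * ((Hf H).filter fun h => F (x + h) ≠ R x).card ≤ T.card * ((1/2)^a * (Hf H).card) := by linarith
    exact le_of_mul_le_mul_left this hT0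
  have hFM : ∀ x, ‖(F x : ℂ)‖ ≤ M + 1 := by
    intro x
    have h1 := hF x
    have h2 : ‖gfun c x‖ ≤ M := by
      refine (norm_sum_le _ _).trans (le_trans (le_of_eq ?_) hc)
      apply sum_congr rfl; intro γ _; rw [norm_mul, norm_char, mul_one]
    calc ‖(F x : ℂ)‖ = ‖gfun c x - (gfun c x - F x)‖ := by congr 1; ring
      _ ≤ ‖gfun c x‖ + ‖gfun c x - F x‖ := norm_sub_le _ _
      _ ≤ _ := by linarith
  refine ⟨H, R, card_le_card hTH, fun x h hh => hRH h hh x, ?_, ?_, ?_⟩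
  · intro x
    have e1 : (1 / (Hf H).card : ℂ) * ∑ h ∈ Hf H, gfun c (x + h) - R x = 
        (1 / (Hf H).card : ℂ) * ∑ h ∈ Hf H, (gfun c (x + h) - R x) := by
      rw [sum_sub_distrib, sum_const, nsmul_eq_mul, mul_sub]
      congr 1
      have : ((Hf H).card : ℂ) ≠ 0 := by exact_mod_cast (Hf_pos H).ne'
      field_simp
    rw [e1, norm_mul]
    have e2 : ‖(1 / (Hf H).card : ℂ)‖ = 1 / (Hf H).card := by simp
    rw [e2, one_div, ← div_eq_inv_mul, div_le_iff₀ hH0]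
    have e3 : ∀ h ∈ Hf H, ‖gfun c (x + h) - R x‖ ≤ ε + 2 * (M+1) * (if F (x + h) ≠ R x then 1 else 0) := by
      intro h _
      have h1 := hF (x+h)
      split_ifs with h2
      · have h3 := hFM (x+h)
        have h4 := hFM (x + Y x)
        calc ‖gfun c (x+h) - R x‖ = ‖(gfun c (x+h) - F (x+h)) + ((F (x+h) : ℂ) - F (x + Y x))‖ := by
              congr 1; simp only [hR]; ring
          _ ≤ ‖gfun c (x+h) - F (x+h)‖ + (‖(F (x+h) : ℂ)‖ + ‖(F (x + Y x) : ℂ)‖) := 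
            (norm_add_le _ _).trans (add_le_add_right (norm_sub_le _ _) _)
          _ ≤ _ := by linarith
      · push Not at h2; rw [← h2]; linarith
    refine (norm_sum_le _ _).trans ((sum_le_sum e3).trans ?_)
    rw [sum_add_distrib, sum_const, nsmul_eq_mul, ← mul_sum, ← sum_filter, sum_const, nsmul_eq_mul, mul_one]
    have h5 := hbadH x
    have h6 : 2 * ((M:ℝ)+1) * (((Hf H).filter fun h => F (x + h) ≠ R x).card : ℝ) ≤ 2 * ((M:ℝ)+1) * ((1/2)^a * (Hf H).card) :=
      mul_le_mul_of_nonneg_left h5 (by positivity)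
    linarith
  · have e1 : ∀ x, (Hf H).card * |R x| ≤ 2 * ∑ h ∈ Hf H, |F (x + h)| := by
      intro x
      have h1 := card_filter_add_card_filter_not (s := Hf H) (fun h => F (x + h) ≠ R x)
      have h2 := hbadH x
      have h3 : (Hf H).card ≤ 2 * ((Hf H).filter fun h => ¬ (F (x + h) ≠ R x)).card := by
        have h1' : (((Hf H).filter fun h => F (x + h) ≠ R x).card : ℝ) + ((Hf H).filter fun h => ¬ (F (x + h) ≠ R x)).card = (Hf H).card := by
          exact_mod_cast h1
        have : ((Hf H).card : ℝ) ≤ 2 * ((Hf H).filter fun h => ¬ (F (x + h) ≠ R x)).card := by nlinarith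
        exact_mod_cast this
      calc ((Hf H).card : ℤ) * |R x| ≤ (2 * ((Hf H).filter fun h => ¬ (F (x + h) ≠ R x)).card : ℤ) * |R x| := by
            apply mul_le_mul_of_nonneg_right _ (abs_nonneg _); exact_mod_cast h3
        _ = 2 * ∑ h ∈ (Hf H).filter (fun h => ¬ (F (x + h) ≠ R x)), |R x| := by
            rw [sum_const, nsmul_eq_mul]; ring
        _ = 2 * ∑ h ∈ (Hf H).filter (fun h => ¬ (F (x + h) ≠ R x)), |F (x + h)| := by
            congr 1; apply sum_congr rfl; intro h hh
            have := (mem_filter.1 hh).2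
            push Not at this; rw [this]
        _ ≤ _ := by
            apply mul_le_mul_of_nonneg_left _ (by norm_num)
            exact sum_le_sum_of_subset_of_nonneg (filter_subset _ _) fun _ _ _ => abs_nonneg _
    have e2 := sum_le_sum fun x (_ : x ∈ univ) => e1 x
    rw [← mul_sum, ← mul_sum, sum_comm] at e2
    have e3 : ∀ h ∈ Hf H, ∑ x, |F (x + h)| = ∑ x, |F x| := by
      intro h _
      exact Fintype.sum_equiv (Equiv.addRight h) _ _ (fun x => rfl)
    rw [sum_congr rfl e3, sum_const, nsmul_eq_mul] at e2
    have : ((Hf H).card : ℤ) * ∑ x, |R x| ≤ (Hf H).card * (2 * ∑ x, |F x|) := by linarith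
    exact le_of_mul_le_mul_left this (by exact_mod_cast Hf_pos H)
  · intro h0
    have := hbadT x0
    rw [h0] at this
    linarith

end P7

section P8
open scoped Classical
open Finset

variable {G : Type} [AddCommGroup G] [Fintype G]

noncomputable def ft (u : G → ℂ) (γ : AddChar G ℂ) : ℂ := ∑ x, u x * (starRingEnd ℂ) (γ x)

lemma fourierCoeff_eq (u : G → ℂ) (γ : AddChar G ℂ) : fourierCoeff u γ = (Fintype.card G : ℂ)⁻¹ * ft u γ := rfl

lemma char_mul_conj (γ : AddChar G ℂ) (x y : G) : γ y * (starRingEnd ℂ) (γ x) = γ (y - x) := by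
  rw [← AddChar.map_neg_eq_conj, ← AddChar.map_add_eq_mul, sub_eq_add_neg]

lemma sum_char (x : G) : ∑ γ : AddChar G ℂ, γ x = if x = 0 then (Fintype.card G : ℂ) else 0 :=
  AddChar.sum_apply_eq_ite x

lemma parseval (u : G → ℂ) : ∑ γ, ‖ft u γ‖ ^ 2 = Fintype.card G * ∑ x, ‖u x‖ ^ 2 := by
  have h : ∀ γ, ((‖ft u γ‖ ^ 2 : ℝ) : ℂ) = ∑ x, ∑ y, u x * (starRingEnd ℂ) (u y) * γ (y - x) := by
    intro γ
    push_cast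
    rw [← Complex.mul_conj', ft, map_sum, sum_mul_sum]
    apply sum_congr rfl; intro x _
    apply sum_congr rfl; intro y _
    rw [map_mul, Complex.conj_conj, ← char_mul_conj]; ring
  have : ((∑ γ, ‖ft u γ‖ ^ 2 : ℝ) : ℂ) = ((Fintype.card G * ∑ x, ‖u x‖ ^ 2 : ℝ) : ℂ) := by
    rw [Complex.ofReal_sum, sum_congr rfl fun γ _ => h γ, sum_comm]
    simp only [sum_comm (s := (univ : Finset (AddChar G ℂ))), ← mul_sum, sum_char]
    push_cast
    rw [mul_sum]
    apply sum_congr rfl; intro x _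
    rw [sum_eq_single x]
    · simp; rw [Complex.mul_conj']; ring
    · intro y _ hy; rw [if_neg (sub_ne_zero.2 hy)]; simp
    · simp
  exact_mod_cast this

lemma inversion (u : G → ℂ) (x : G) : ∑ γ, fourierCoeff u γ * γ x = u x := by
  have hG : (Fintype.card G : ℂ) ≠ 0 := by exact_mod_cast Fintype.card_ne_zero
  simp only [fourierCoeff_eq, ft, mul_assoc, sum_mul, ← mul_sum]
  rw [sum_comm]
  have : ∀ y, ∑ γ : AddChar G ℂ, u y * ((starRingEnd ℂ) (γ y) * γ x) = u y * (if x - y = 0 then (Fintype.card G : ℂ) else 0) := by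
    intro y
    rw [← mul_sum, ← sum_char]; congr 1; apply sum_congr rfl; intro γ _; rw [mul_comm, char_mul_conj]
  simp only [this]
  rw [sum_eq_single x]
  · simp; field_simp
  · intro y _ hy; rw [if_neg (sub_ne_zero.2 hy.symm)]; simp
  · simp

lemma ft_sq (u : G → ℂ) (γ : AddChar G ℂ) : 
    ((‖ft u γ‖ ^ 2 : ℝ) : ℂ) = ft (fun t => ∑ x, u (x + t) * (starRingEnd ℂ) (u x)) γ := by
  push_cast
  rw [← Complex.mul_conj', ft, ft, map_sum, sum_mul_sum, sum_comm]
  simp only [sum_mul]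
  rw [sum_comm (s := univ) (t := univ) (f := fun t x => u (x + t) * (starRingEnd ℂ) (u x) * (starRingEnd ℂ) (γ t))]
  apply sum_congr rfl; intro x _
  apply Fintype.sum_equiv (Equiv.subRight x)
  intro y
  simp only [Equiv.subRight_apply, add_sub_cancel, map_mul, Complex.conj_conj]
  rw [← char_mul_conj γ x y, map_mul, Complex.conj_conj]; ring

noncomputable def rep (A : Finset G) (t : G) : ℕ := (A.filter fun x => x + t ∈ A).card

lemma energy_lower (c : AddChar G ℂ → ℂ) (F : G → ℤ) (M : ℕ) (hM : 1 ≤ M)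
    (hcF : ∀ γ, c γ = 0 ∨ c γ = fourierCoeff (fun x => (F x : ℂ)) γ)
    (hc : ∑ γ, ‖c γ‖ ≤ M) (hF : ∀ x, ‖gfun c x - F x‖ ≤ 1/16) (A : Finset G)
    (hA : A = univ.filter fun x => F x ≠ 0) :
    (A.card : ℝ) ^ 3 ≤ 8 * M ^ 2 * (M + 1) ^ 4 * ∑ t, (rep A t : ℝ) ^ 2 := by
  have hM0 : (0:ℝ) < M := by exact_mod_cast hM
  obtain ⟨N, hN⟩ : ∃ N : ℝ, N = (Fintype.card G : ℝ) := ⟨_, rfl⟩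
  have hN0 : 0 < N := by rw [hN]; exact_mod_cast Fintype.card_pos
  have hFM : ∀ x, ‖(F x : ℂ)‖ ≤ M + 1 := by
    intro x
    have h1 := hF x
    have h2 : ‖gfun c x‖ ≤ M := by
      refine (norm_sum_le _ _).trans (le_trans (le_of_eq ?_) hc)
      apply sum_congr rfl; intro γ _; rw [norm_mul, norm_char, mul_one]
    calc ‖(F x : ℂ)‖ = ‖gfun c x - (gfun c x - F x)‖ := by congr 1; ring
      _ ≤ ‖gfun c x‖ + ‖gfun c x - F x‖ := norm_sub_le _ _
      _ ≤ _ := by linarith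
  -- step 1
  have s1 : (A.card : ℝ) ≤ 2 * (N * ∑ γ, ‖c γ‖^2) := by
    have e1 : ∑ x, (F x : ℂ) * (starRingEnd ℂ) (gfun c x) = ((N * ∑ γ, ‖c γ‖^2 : ℝ) : ℂ) := by
      simp only [gfun, map_sum, map_mul, mul_sum]
      rw [sum_comm, hN]
      push_cast
      apply sum_congr rfl; intro γ _
      have : ∑ x, (F x : ℂ) * ((starRingEnd ℂ) (c γ) * (starRingEnd ℂ) (γ x)) = (starRingEnd ℂ) (c γ) * ft (fun x => (F x : ℂ)) γ := by
        rw [ft, mul_sum]; apply sum_congr rfl; intro x _; ring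
      rw [this]
      rcases hcF γ with h | h
      · simp [h]
      · have : ft (fun x => (F x : ℂ)) γ = Fintype.card G * c γ := by
          rw [h, fourierCoeff_eq, ← mul_assoc, mul_inv_cancel₀, one_mul]; exact_mod_cast Fintype.card_ne_zero
        rw [this, ← Complex.mul_conj']; ring
    have e2 : ∀ x, (if F x ≠ 0 then (1/2:ℝ) else 0) ≤ ((F x : ℂ) * (starRingEnd ℂ) (gfun c x)).re := by
      intro x
      have h1 := hF x
      set d := gfun c x - F x with hd
      have h2 : gfun c x = F x + d := by rw [hd]; ring
      rw [h2, map_add]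
      have h3 : ((F x : ℂ) * ((starRingEnd ℂ) (F x : ℂ) + (starRingEnd ℂ) d)).re = (F x : ℝ)^2 + F x * d.re := by
        simp; ring
      rw [h3]
      have h4 := abs_le.1 ((Complex.abs_re_le_norm d).trans h1)
      split_ifs with h5
      · have h6 : (1:ℝ) ≤ |(F x : ℝ)| := by exact_mod_cast Int.one_le_abs h5
        have h7 : |(F x : ℝ)| ≤ (F x : ℝ)^2 := by rw [← sq_abs]; nlinarith
        have h8 : |(F x : ℝ) * d.re| ≤ |(F x : ℝ)| * (1/16) := by
          rw [abs_mul]; exact mul_le_mul_of_nonneg_left (abs_le.2 h4) (abs_nonneg _)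
        have := (abs_le.1 h8).1
        linarith
      · push Not at h5; rw [h5]; simp
    have e3 : (A.card : ℝ) * (1/2) = ∑ x, (if F x ≠ 0 then (1/2:ℝ) else 0) := by
      rw [← sum_filter, ← hA, sum_const, nsmul_eq_mul]
    have e4 := sum_le_sum fun x (_ : x ∈ univ) => e2 x
    rw [← e3, ← Complex.re_sum, e1, Complex.ofReal_re] at e4
    linarith
  -- step 2
  set S1 := ∑ γ, ‖c γ‖
  set S2 := ∑ γ, ‖c γ‖^2
  set S3 := ∑ γ, ‖c γ‖^3
  set S4 := ∑ γ, ‖c γ‖^4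
  have c1 : S2^2 ≤ S1 * S3 := by
    have := sum_mul_sq_le_sq_mul_sq univ (fun γ => Real.sqrt ‖c γ‖) (fun γ => Real.sqrt (‖c γ‖^3))
    have e1 : ∀ γ, Real.sqrt ‖c γ‖ * Real.sqrt (‖c γ‖^3) = ‖c γ‖^2 := by
      intro γ
      rw [← Real.sqrt_mul (norm_nonneg _), show ‖c γ‖ * ‖c γ‖^3 = (‖c γ‖^2)^2 by ring, Real.sqrt_sq (by positivity)]
    simp only [e1] at this
    simpa only [Real.sq_sqrt (norm_nonneg _), Real.sq_sqrt (pow_nonneg (norm_nonneg _) 3)] using this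
  have c2 : S3^2 ≤ S2 * S4 := by
    have := sum_mul_sq_le_sq_mul_sq univ (fun γ => ‖c γ‖) (fun γ => ‖c γ‖^2)
    have e1 : S3 = ∑ γ, ‖c γ‖ * ‖c γ‖^2 := sum_congr rfl fun γ _ => by ring
    have e2 : S4 = ∑ γ, (‖c γ‖^2)^2 := sum_congr rfl fun γ _ => by ring
    rw [e1, e2]; exact this
  have p1 : 0 ≤ S1 := sum_nonneg fun _ _ => by positivity
  have p2 : 0 ≤ S2 := sum_nonneg fun _ _ => by positivity
  have p3 : 0 ≤ S3 := sum_nonneg fun _ _ => by positivity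
  have p4 : 0 ≤ S4 := sum_nonneg fun _ _ => by positivity
  have c3 : S2^3 ≤ M^2 * S4 := by
    rcases p2.eq_or_lt with h | h
    · have h' : S2 = 0 := h.symm
      rw [h', zero_pow (by norm_num)]; positivity
    · have : S2 * S2^3 ≤ S2 * (M^2 * S4) := by
        calc S2 * S2^3 = (S2^2)^2 := by ring
          _ ≤ (S1 * S3)^2 := by gcongr
          _ = S1^2 * S3^2 := by ring
          _ ≤ M^2 * (S2 * S4) := by gcongr
          _ = _ := by ring
      exact le_of_mul_le_mul_left this h
  -- step 3
  set r : G → ℂ := fun t => ∑ x, (F (x + t) : ℂ) * (starRingEnd ℂ) (F x : ℂ) with hr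
  have s3 : N^3 * S4 ≤ ∑ t, ‖r t‖^2 := by
    have e1 : N * ∑ t, ‖r t‖^2 = ∑ γ, ‖ft (fun x => (F x : ℂ)) γ‖^4 := by
      rw [hN, ← parseval]
      apply sum_congr rfl; intro γ _
      rw [show ft r γ = _ from (ft_sq (fun x => (F x : ℂ)) γ).symm, Complex.norm_real, Real.norm_of_nonneg (by positivity)]; ring
    have e2 : N^4 * S4 ≤ ∑ γ, ‖ft (fun x => (F x : ℂ)) γ‖^4 := by
      rw [mul_sum]
      apply sum_le_sum; intro γ _
      rcases hcF γ with h | h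
      · rw [h]; simp
      · rw [h, fourierCoeff_eq, norm_mul, norm_inv, Complex.norm_natCast, ← hN, mul_pow, ← mul_assoc, ← mul_pow,
          mul_inv_cancel₀ hN0.ne']; simp
    have : N * (N^3 * S4) ≤ N * ∑ t, ‖r t‖^2 := by rw [e1]; linarith
    exact le_of_mul_le_mul_left this hN0
  have s4 : ∀ t, ‖r t‖^2 ≤ ((M:ℝ)+1)^4 * (rep A t : ℝ)^2 := by
    intro t
    have : ‖r t‖ ≤ ((M:ℝ)+1)^2 * rep A t := by
      have e1 : ∀ x, ‖(F (x + t) : ℂ) * (starRingEnd ℂ) (F x : ℂ)‖ ≤ if (x ∈ A ∧ x + t ∈ A) then ((M:ℝ)+1)^2 else 0 := by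
        intro x
        rw [norm_mul, RCLike.norm_conj]
        split_ifs with h
        · rw [sq]; exact mul_le_mul (hFM _) (hFM _) (norm_nonneg _) (by positivity)
        · rw [hA] at h; simp only [mem_filter, mem_univ, true_and, not_and, not_not] at h
          by_cases h0 : F x = 0
          · simp [h0]
          · simp [h h0]
      refine (norm_sum_le _ _).trans ((sum_le_sum fun x _ => e1 x).trans (le_of_eq ?_))
      rw [← sum_filter, sum_const, nsmul_eq_mul, rep, mul_comm]
      congr 3
      ext x; simp
    calc ‖r t‖^2 ≤ (((M:ℝ)+1)^2 * rep A t)^2 := by gcongr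
      _ = _ := by ring
  have s5 : ∑ t, ‖r t‖^2 ≤ ((M:ℝ)+1)^4 * ∑ t, (rep A t : ℝ)^2 := by
    rw [mul_sum]; exact sum_le_sum fun t _ => s4 t
  calc (A.card : ℝ)^3 ≤ (2 * (N * S2))^3 := by gcongr
    _ = 8 * N^3 * S2^3 := by ring
    _ ≤ 8 * N^3 * (M^2 * S4) := by gcongr
    _ = 8 * M^2 * (N^3 * S4) := by ring
    _ ≤ 8 * M^2 * (((M:ℝ)+1)^4 * ∑ t, (rep A t : ℝ)^2) := mul_le_mul_of_nonneg_left (s3.trans s5) (by positivity)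
    _ = _ := by ring

end P8

section P9
open scoped Classical
open Finset

variable {G : Type} [AddCommGroup G] [Fintype G]

lemma sum_rep (A P : Finset G) : ∑ t ∈ P, rep A t = ∑ b ∈ A, (A.filter fun a => a - b ∈ P).card := by
  simp only [rep, card_filter]
  rw [sum_comm]
  apply sum_congr rfl; intro x _
  rw [← card_filter, ← card_filter]
  apply card_bij (fun t _ => x + t)
  · intro t ht; rw [mem_filter] at *; exact ⟨ht.2, by simpa using ht.1⟩
  · intro a _ b _ h; simpa using h
  · intro a ha; rw [mem_filter] at ha; exact ⟨a - x, by rw [mem_filter]; simpa using ⟨ha.2, ha.1⟩, by simp⟩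

lemma rep_le (A : Finset G) (t : G) : rep A t ≤ A.card := card_filter_le _ _

lemma bsg_pairs (A P : Finset G) (K : ℝ) (hK : 1 ≤ K) (hA : A.Nonempty)
    (he : (A.card : ℝ) ^ 2 ≤ 2 * K * ∑ b ∈ A, ((A.filter fun a => a - b ∈ P).card : ℝ)) :
    ∃ N ⊆ A, (A.card : ℝ) ≤ 4 * K * N.card ∧
      16 * (((N ×ˢ N).filter fun p => 
        128 * K ^ 2 * ((A.filter fun b => p.1 - b ∈ P ∧ p.2 - b ∈ P).card : ℝ) < A.card).card : ℝ) ≤ N.card ^ 2 := by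
  have hK0 : 0 < K := by linarith
  set n : ℝ := (A.card : ℝ) with hn
  have hn0 : 0 < n := by rw [hn]; exact_mod_cast hA.card_pos
  set N : G → Finset G := fun b => A.filter fun a => a - b ∈ P with hN
  set cd : G × G → ℝ := fun p => ((A.filter fun b => p.1 - b ∈ P ∧ p.2 - b ∈ P).card : ℝ) with hcd
  set bd : G → ℝ := fun b => (((N b ×ˢ N b).filter fun p => 128 * K^2 * cd p < n).card : ℝ) with hbd
  have hcs : n^3 ≤ 4 * K^2 * ∑ b ∈ A, ((N b).card : ℝ)^2 := by
    have h1 := sq_sum_le_card_mul_sum_sq (s := A) (f := fun b => ((N b).card : ℝ))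
    have h2 : (n^2)^2 ≤ (2 * K * ∑ b ∈ A, ((N b).card : ℝ))^2 := by gcongr
    have h3 : n * n^3 ≤ n * (4 * K^2 * ∑ b ∈ A, ((N b).card : ℝ)^2) := by
      calc n * n^3 = (n^2)^2 := by ring
        _ ≤ _ := h2
        _ = 4 * K^2 * (∑ b ∈ A, ((N b).card : ℝ))^2 := by ring
        _ ≤ 4 * K^2 * (n * ∑ b ∈ A, ((N b).card : ℝ)^2) := by gcongr
        _ = _ := by ring
    exact le_of_mul_le_mul_left h3 hn0
  have hbad : 128 * K^2 * ∑ b ∈ A, bd b ≤ n^3 := by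
    have e1 : ∑ b ∈ A, bd b = ∑ p ∈ (A ×ˢ A).filter (fun p => 128 * K^2 * cd p < n), cd p := by
      have : ∀ b, bd b = ∑ p ∈ (A ×ˢ A).filter (fun p => 128 * K^2 * cd p < n), (if p.1 - b ∈ P ∧ p.2 - b ∈ P then (1:ℝ) else 0) := by
        intro b
        rw [← sum_filter, sum_const, nsmul_eq_mul, mul_one]
        simp only [hbd]
        congr 2
        ext p
        simp only [hN, mem_filter, mem_product]; tauto
      rw [sum_congr rfl fun b _ => this b, sum_comm]
      apply sum_congr rfl; intro p _
      rw [← sum_filter, sum_const, nsmul_eq_mul, mul_one]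
    rw [e1, mul_sum]
    calc _ ≤ ∑ p ∈ (A ×ˢ A).filter (fun p => 128 * K^2 * cd p < n), n := 
          sum_le_sum fun p hp => (mem_filter.1 hp).2.le
      _ ≤ ∑ p ∈ (A ×ˢ A), n := sum_le_sum_of_subset_of_nonneg (filter_subset _ _) fun _ _ _ => hn0.le
      _ = n^3 := by rw [sum_const, card_product, nsmul_eq_mul]; push_cast; rw [← hn]; ring
  have hex : ∃ b ∈ A, n^2 ≤ 8 * K^2 * (((N b).card : ℝ)^2 - 16 * bd b) := by
    by_contra! h
    have h1 := sum_lt_sum_of_nonempty hA h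
    rw [sum_const, nsmul_eq_mul, ← mul_sum, sum_sub_distrib, ← mul_sum, ← hn] at h1
    nlinarith
  obtain ⟨b, _, hb⟩ := hex
  have hbd0 : 0 ≤ bd b := Nat.cast_nonneg _
  refine ⟨N b, filter_subset _ _, ?_, ?_⟩
  · have : n^2 ≤ (4 * K * (N b).card)^2 := by
      have : 0 ≤ K^2 * bd b := by positivity
      have : 0 ≤ K^2 * ((N b).card : ℝ)^2 := by positivity
      nlinarith
    exact le_of_sq_le_sq this (by positivity)
  · have h1 : 0 < 8 * K^2 * (((N b).card : ℝ)^2 - 16 * bd b) := lt_of_lt_of_le (by positivity) hb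
    have h2 : 0 < ((N b).card : ℝ)^2 - 16 * bd b := pos_of_mul_pos_right h1 (by positivity)
    linarith

lemma bsg (A : Finset G) (K : ℝ) (hK : 1 ≤ K) (hA : A.Nonempty)
    (hE : (A.card : ℝ) ^ 3 ≤ K * ∑ t, (rep A t : ℝ) ^ 2) :
    ∃ A' ⊆ A, A'.Nonempty ∧ (A.card : ℝ) ≤ 8 * K * A'.card ∧ ((A' - A').card : ℝ) ≤ 2^24 * K^10 * A'.card := by
  have hK0 : 0 < K := by linarith
  set n : ℝ := (A.card : ℝ) with hn
  have hn0 : 0 < n := by rw [hn]; exact_mod_cast hA.card_pos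
  set P : Finset G := univ.filter fun t => n ≤ 2 * K * rep A t with hP
  have hrepsum : ∑ t, (rep A t : ℝ) = n^2 := by
    have := sum_rep A univ
    simp only [mem_univ, filter_true, sum_const, smul_eq_mul] at this
    rw [hn, sq]; exact_mod_cast this
  have hrn : ∀ t, (rep A t : ℝ) ≤ n := fun t => by rw [hn]; exact_mod_cast rep_le A t
  have he : n^2 ≤ 2 * K * ∑ b ∈ A, ((A.filter fun a => a - b ∈ P).card : ℝ) := by
    have e1 : ∑ b ∈ A, ((A.filter fun a => a - b ∈ P).card : ℝ) = ∑ t ∈ P, (rep A t : ℝ) := by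
      exact_mod_cast (sum_rep A P).symm
    rw [e1]
    have e2 : ∀ t, 2 * K * (rep A t : ℝ)^2 ≤ 2 * K * n * (if t ∈ P then (rep A t : ℝ) else 0) + n * rep A t := by
      intro t
      have h0 : (0:ℝ) ≤ rep A t := Nat.cast_nonneg _
      have := hrn t
      split_ifs with h
      · have : (rep A t : ℝ)^2 ≤ n * rep A t := by nlinarith
        have : 2 * K * (rep A t : ℝ)^2 ≤ 2 * K * (n * rep A t) := by gcongr
        nlinarith [mul_nonneg hn0.le h0]
      · have : 2 * K * (rep A t : ℝ) < n := by
          by_contra hcc; exact h (mem_filter.2 ⟨mem_univ _, not_lt.1 hcc⟩)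
        nlinarith
    have e3 := sum_le_sum fun t (_ : t ∈ univ) => e2 t
    rw [← mul_sum, sum_add_distrib, ← mul_sum, ← mul_sum, hrepsum, ← sum_filter, filter_mem_eq_inter, univ_inter] at e3
    have e4 : n * n^2 ≤ n * (2 * K * ∑ t ∈ P, (rep A t : ℝ)) := by nlinarith
    exact le_of_mul_le_mul_left e4 hn0
  have hPc : (P.card : ℝ) ≤ 2 * K * n := by
    have : (P.card : ℝ) * n ≤ 2 * K * n * n := by
      calc (P.card : ℝ) * n = ∑ t ∈ P, n := by rw [sum_const, nsmul_eq_mul]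
        _ ≤ ∑ t ∈ P, 2 * K * rep A t := sum_le_sum fun t ht => (mem_filter.1 ht).2
        _ ≤ ∑ t, 2 * K * (rep A t : ℝ) := sum_le_sum_of_subset_of_nonneg (subset_univ _) fun _ _ _ => by positivity
        _ = _ := by rw [← mul_sum, hrepsum]; ring
    exact le_of_mul_le_mul_right this hn0
  obtain ⟨N, hNA, hN1, hN2⟩ := bsg_pairs A P K hK hA he
  set cd : G × G → Finset G := fun p => A.filter fun b => p.1 - b ∈ P ∧ p.2 - b ∈ P with hcd
  set bdp : G → Finset G := fun a => N.filter fun a' => 128 * K^2 * ((cd (a, a')).card : ℝ) < n with hbdp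
  have hNpos : (0:ℝ) < N.card := by
    by_contra h
    have : (N.card:ℝ) ≤ 0 := not_lt.1 h
    nlinarith
  set A' := N.filter fun a => 4 * (bdp a).card ≤ N.card with hA'
  have hbadsum : 16 * ∑ a ∈ N, ((bdp a).card : ℝ) ≤ N.card^2 := by
    convert hN2 using 2
    rw [← Nat.cast_sum]
    congr 1
    rw [card_filter, sum_product]
    apply sum_congr rfl; intro a _
    exact card_filter _ _
  have hA'c : (N.card : ℝ) ≤ 2 * A'.card := by
    have h1 : (N.card : ℝ) * (N.filter fun a => ¬ (4 * (bdp a).card ≤ N.card)).card ≤ 4 * ∑ a ∈ N, ((bdp a).card : ℝ) := by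
      calc _ = ∑ a ∈ N.filter fun a => ¬ (4 * (bdp a).card ≤ N.card), (N.card : ℝ) := by rw [sum_const, nsmul_eq_mul, mul_comm]
        _ ≤ ∑ a ∈ N.filter fun a => ¬ (4 * (bdp a).card ≤ N.card), 4 * ((bdp a).card : ℝ) := by
          apply sum_le_sum; intro a ha
          have := (mem_filter.1 ha).2
          push Not at this
          exact_mod_cast this.le
        _ ≤ ∑ a ∈ N, 4 * ((bdp a).card : ℝ) := sum_le_sum_of_subset_of_nonneg (filter_subset _ _) fun _ _ _ => by positivity
        _ = _ := by rw [mul_sum]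
    have h2 : ((N.filter fun a => ¬ (4 * (bdp a).card ≤ N.card)).card : ℝ) ≤ N.card / 4 := by
      have : (N.card : ℝ) * (N.filter fun a => ¬ (4 * (bdp a).card ≤ N.card)).card ≤ N.card * (N.card / 4) := by nlinarith
      exact le_of_mul_le_mul_left this hNpos
    have h3 : (A'.card : ℝ) + (N.filter fun a => ¬ (4 * (bdp a).card ≤ N.card)).card = N.card := by
      exact_mod_cast card_filter_add_card_filter_not (s := N) (fun a => 4 * (bdp a).card ≤ N.card)
    linarith
  have hA'pos : (0:ℝ) < A'.card := by linarith
  have hA'ne : A'.Nonempty := by rw [← card_pos]; exact_mod_cast hA'pos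
  refine ⟨A', (filter_subset _ _).trans hNA, hA'ne, by nlinarith, ?_⟩
  -- counting
  set Q : G → Finset (G × G × G × G) := fun d => (P ×ˢ P ×ˢ P ×ˢ P).filter fun q => q.1 - q.2.1 + q.2.2.1 - q.2.2.2 = d with hQ
  have hlow : ∀ d ∈ A' - A', (N.card : ℝ) / 2 * (n / (128 * K^2))^2 ≤ (Q d).card := by
    intro d hd
    obtain ⟨a1, h1, a2, h2, rfl⟩ := mem_sub.1 hd
    have h1' := mem_filter.1 h1
    have h2' := mem_filter.1 h2
    set J := N \ (bdp a1 ∪ bdp a2) with hJ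
    have hJc : (N.card : ℝ) / 2 ≤ J.card := by
      have e1 : N.card ≤ J.card + (bdp a1 ∪ bdp a2).card := by
        have : N.card - (bdp a1 ∪ bdp a2).card ≤ J.card := le_card_sdiff (bdp a1 ∪ bdp a2) N
        omega
      have e2 := card_union_le (bdp a1) (bdp a2)
      have b1 : 4 * (bdp a1).card ≤ N.card := h1'.2
      have b2 : 4 * (bdp a2).card ≤ N.card := h2'.2
      have e3 : N.card ≤ 2 * J.card := by omega
      have : (N.card : ℝ) ≤ 2 * J.card := by exact_mod_cast e3
      linarith
    set Tr := J.sigma fun a' => cd (a1, a') ×ˢ cd (a2, a') with hTr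
    have hTrc : (N.card : ℝ) / 2 * (n / (128 * K^2))^2 ≤ Tr.card := by
      rw [hTr, card_sigma]; push_cast
      calc _ ≤ (J.card : ℝ) * (n / (128 * K^2))^2 := by gcongr
        _ = ∑ a' ∈ J, (n / (128 * K^2))^2 := by rw [sum_const, nsmul_eq_mul]
        _ ≤ _ := by
          apply sum_le_sum; intro a' ha'
          rw [hJ, mem_sdiff, mem_union, not_or] at ha'
          have g : ∀ a, a' ∉ bdp a → n / (128 * K^2) ≤ (cd (a, a')).card := by
            intro a ha
            rw [div_le_iff₀ (by positivity)]
            by_contra hcc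
            apply ha
            rw [hbdp, mem_filter]
            exact ⟨ha'.1, by linarith⟩
          rw [card_product, sq]; push_cast
          exact mul_le_mul (g a1 ha'.2.1) (g a2 ha'.2.2) (by positivity) (Nat.cast_nonneg _)
    refine hTrc.trans ?_
    have : Tr.card ≤ (Q (a1 - a2)).card := by
      apply card_le_card_of_injOn (fun z => (a1 - z.2.1, z.1 - z.2.1, z.1 - z.2.2, a2 - z.2.2))
      · rintro ⟨a', b1, b2⟩ hz
        simp only [hTr, mem_coe, mem_sigma, mem_product, hcd, mem_filter] at hz
        simp only [hQ, mem_coe, mem_filter, mem_product]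
        refine ⟨⟨hz.2.1.2.1, hz.2.1.2.2, hz.2.2.2.2, hz.2.2.2.1⟩, ?_⟩
        abel
      · rintro ⟨a', b1, b2⟩ _ ⟨a'', c1, c2⟩ _ h
        simp only [Prod.mk.injEq] at h
        obtain ⟨g1, g2, g3, g4⟩ := h
        have e1 : b1 = c1 := by simpa using g1
        have e2 : b2 = c2 := by simpa using g4
        subst e1; subst e2
        have e3 : a' = a'' := by simpa using g2
        subst e3; rfl
    exact_mod_cast this
  have hup : ∑ d ∈ A' - A', ((Q d).card : ℝ) ≤ (P.card : ℝ)^4 := by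
    have e1 : ∑ d ∈ A' - A', (Q d).card ≤ (P ×ˢ P ×ˢ P ×ˢ P).card := by
      rw [← card_biUnion]
      · exact card_le_card (biUnion_subset.2 fun d _ => filter_subset _ _)
      · intro x _ y _ hxy
        simp only [Function.onFun]
        rw [Finset.disjoint_left]
        intro q h1 h2
        exact hxy ((mem_filter.1 h1).2.symm.trans (mem_filter.1 h2).2)
    have e2 : (P ×ˢ P ×ˢ P ×ˢ P).card = P.card^4 := by simp only [card_product]; ring
    rw [e2] at e1
    exact_mod_cast e1
  have h1 := (sum_le_sum hlow).trans hup
  rw [sum_const, nsmul_eq_mul] at h1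
  have h2 : ((A' - A').card : ℝ) * ((N.card : ℝ) / 2 * (n / (128 * K^2))^2) ≤ (2 * K * n)^4 := h1.trans (by gcongr)
  have h3 : ((A' - A').card : ℝ) * N.card ≤ 2^19 * K^8 * n^2 := by
    have e : ((A' - A').card : ℝ) * ((N.card : ℝ) / 2 * (n / (128 * K^2))^2) = (((A' - A').card : ℝ) * N.card) * (n^2 / (2^15 * K^4)) := by
      field_simp; ring
    have e' : (2 * K * n)^4 = (2^19 * K^8 * n^2) * (n^2 / (2^15 * K^4)) := by field_simp
    rw [e, e'] at h2
    exact le_of_mul_le_mul_right h2 (by positivity)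
  have h4 : ((A' - A').card : ℝ) * N.card ≤ (2^23 * K^10 * N.card) * N.card := by
    calc _ ≤ 2^19 * K^8 * n^2 := h3
      _ ≤ 2^19 * K^8 * (4 * K * N.card)^2 := by gcongr
      _ = _ := by ring
  have h5 := le_of_mul_le_mul_right h4 hNpos
  calc ((A' - A').card : ℝ) ≤ 2^23 * K^10 * N.card := h5
    _ ≤ 2^23 * K^10 * (2 * A'.card) := by gcongr
    _ = _ := by ring

end P9

section P10
open scoped Classical
open Finset
variable {G : Type} [AddCommGroup G] [Fintype G]

lemma plun (A : Finset G) (κ : ℕ) (hA : A.Nonempty) (h : (A - A).card ≤ 2^κ * A.card) (m n : ℕ) :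
    (m • A - n • A).card ≤ 2^(κ*(m+n)) * A.card := by
  have h1 := pluennecke_ruzsa_inequality_nsmul_sub_nsmul_sub hA A m n
  have hA0 : (0:ℚ≥0) < A.card := by exact_mod_cast hA.card_pos
  have h2 : ((A - A).card : ℚ≥0) / A.card ≤ 2^κ := by
    rw [div_le_iff₀ hA0]; exact_mod_cast h
  have h3 : ((m • A - n • A).card : ℚ≥0) ≤ (2^κ)^(m+n) * A.card := h1.trans (by gcongr)
  rw [← pow_mul] at h3
  exact_mod_cast h3

set_option maxHeartbeats 1000000 in
lemma cs_shift (A : Finset G) (κ : ℕ) (hA : A.Nonempty) (h : (A - A).card ≤ 2^κ * A.card)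
    (l p k : ℕ) (hl : 1 ≤ l) (hk : 1024 * (p + 2) * l^2 ≤ k) :
    ∃ T0 ⊆ A, A.card ≤ 2^(1+2*κ*k) * T0.card ∧ ∃ f : G → ℂ, (∀ y ∈ A, f y = 1) ∧
      (∀ y, f y ≠ 0 → y ∈ 2 • A - A) ∧
      ∀ t ∈ T0 - T0, ((univ.filter fun u => 1/(2*l:ℝ) < ‖f u - f (u+t)‖).card : ℝ) ≤
        4 * (1/2)^p * (2 • A - A).card := by
  set S := 2 • A - A with hS
  set W := A - A with hW
  have hSW : ∀ x ∈ A, ∀ w ∈ W, x + w ∈ S := by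
    intro x hx w hw
    obtain ⟨a, ha, b, hb, rfl⟩ := mem_sub.1 hw
    rw [hS, two_nsmul]
    exact mem_sub.2 ⟨x + a, add_mem_add hx ha, b, hb, by abel⟩
  have hSne : S.Nonempty := by
    obtain ⟨x, hx⟩ := hA
    exact ⟨_, hSW x hx (x - x) (sub_mem_sub hx hx)⟩
  have hS0 : (0:ℝ) < S.card := by exact_mod_cast hSne.card_pos
  set n : ℝ := (A.card : ℝ) with hn
  have hn0 : 0 < n := by rw [hn]; exact_mod_cast hA.card_pos
  have hl0 : (0:ℝ) < l := by exact_mod_cast hl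
  have hkpos : 0 < k := by
    have : 0 < 1024 * (p+2) * l^2 := by positivity
    omega
  set φ : {x // x ∈ A} → G → ℂ := fun x y => if y - x.1 ∈ W then 1 else 0 with hφ
  set q : {x // x ∈ A} → ℝ := fun _ => 1/n with hq
  have hq1 : ∑ i, q i = 1 := by
    rw [hq, sum_const, nsmul_eq_mul, card_univ, Fintype.card_coe, ← hn]; field_simp
  set ε : ℝ := 1/(4*l) with hε
  have hε0 : 0 < ε := by positivity
  have hsum := sample_sum q (fun _ => by rw [hq]; positivity) hq1 φ
    (fun i y => by simp only [hφ]; split_ifs <;> simp) S k p ε hε0 (by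
      have : (1024 * (p + 2) * l^2 : ℝ) ≤ k := by exact_mod_cast hk
      calc 64 * (p+2:ℝ) = (1024 * (p+2) * l^2) * ε^2 := by rw [hε]; field_simp; norm_num
        _ ≤ _ := by gcongr)
  set f : G → ℂ := fun y => ∑ i, (q i : ℂ) * φ i y with hf
  set bad : (Fin k → {x // x ∈ A}) → Finset G := fun v =>
    S.filter fun y => ε < ‖(1 / k : ℂ) * ∑ j, φ (v j) y - f y‖ with hbad
  set Good := univ.filter fun v => ((bad v).card : ℝ) ≤ 2 * (1/2)^p * S.card with hGood
  have hcardv : (Fintype.card (Fin k → {x // x ∈ A}) : ℝ) = n^k := by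
    rw [Fintype.card_fun, Fintype.card_fin, Fintype.card_coe]; push_cast; rfl
  have hG2 : n^k ≤ 2 * Good.card := by
    have e1 : ∑ v, ((bad v).card : ℝ) ≤ n^k * ((1/2)^p * S.card) := by
      have : ∑ v, ((bad v).card : ℝ) = n^k * ∑ v : Fin k → {x // x ∈ A}, (∏ j, q (v j)) * ((bad v).card : ℝ) := by
        rw [mul_sum]; apply sum_congr rfl; intro v _
        simp only [hq, prod_const, card_univ, Fintype.card_fin]
        rw [← mul_assoc, ← mul_pow, mul_one_div_cancel hn0.ne', one_pow, one_mul]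
      rw [this]
      exact mul_le_mul_of_nonneg_left hsum (by positivity)
    have e2 : ((univ.filter fun v => ¬ ((bad v).card : ℝ) ≤ 2 * (1/2)^p * S.card).card : ℝ) * (2 * (1/2)^p * S.card) ≤ ∑ v, ((bad v).card : ℝ) := by
      rw [← nsmul_eq_mul, ← sum_const]
      refine (sum_le_sum fun v hv => ?_).trans (sum_le_sum_of_subset_of_nonneg (subset_univ _) fun _ _ _ => Nat.cast_nonneg _)
      exact (not_le.1 (mem_filter.1 hv).2).le
    have e3 : (Good.card : ℝ) + (univ.filter fun v => ¬ ((bad v).card : ℝ) ≤ 2 * (1/2)^p * S.card).card = n^k := by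
      rw [← hcardv]
      exact_mod_cast card_filter_add_card_filter_not (s := univ) (fun v => ((bad v).card : ℝ) ≤ 2 * (1/2)^p * S.card)
    have e4 : (2 * ((univ.filter fun v => ¬ ((bad v).card : ℝ) ≤ 2 * (1/2)^p * S.card).card : ℝ)) * ((1/2)^p * S.card) ≤ n^k * ((1/2)^p * S.card) := by
      calc _ = _ := by ring
        _ ≤ _ := e2.trans e1
    have e5 := le_of_mul_le_mul_right e4 (by positivity)
    linarith
  set Z := Fintype.piFinset fun _ : Fin k => 2 • A with hZ
  have hZc : (Z.card : ℝ) ≤ (2^(2*κ) * n)^k := by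
    have := plun A κ hA h 2 0
    rw [zero_nsmul, sub_zero] at this
    rw [hZ, Fintype.card_piFinset_const]
    have h' : ((2 • A).card : ℝ) ≤ 2^(2*κ) * n := by
      rw [mul_comm 2 κ, hn]; exact_mod_cast this
    push_cast
    gcongr
  set F : (Fin k → {x // x ∈ A}) × G → (Fin k → G) := fun w j => (w.1 j).1 + w.2 with hF
  have hmaps : ∀ w ∈ Good ×ˢ A, F w ∈ Z := by
    intro w hw
    rw [hZ, Fintype.mem_piFinset]; intro j
    rw [two_nsmul]
    exact add_mem_add (w.1 j).2 (mem_product.1 hw).2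
  have hZne : Z.Nonempty := by
    obtain ⟨x, hx⟩ := hA
    exact ⟨fun _ => x + x, by rw [hZ, Fintype.mem_piFinset]; intro _; rw [two_nsmul]; exact add_mem_add hx hx⟩
  have hZ0 : (0:ℝ) < Z.card := by exact_mod_cast hZne.card_pos
  obtain ⟨z, hz, hzc⟩ := exists_le_card_fiber_of_nsmul_le_card_of_maps_to (b := ((Good ×ˢ A).card : ℝ) / Z.card) hmaps hZne (by
    rw [nsmul_eq_mul]; field_simp; exact le_rfl)
  set T0 := ((Good ×ˢ A).filter fun w => F w = z).image Prod.snd with hT0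
  have hT0c : T0.card = ((Good ×ˢ A).filter fun w => F w = z).card := by
    rw [hT0]; apply card_image_of_injOn
    rintro ⟨v, s⟩ h1 ⟨v', s'⟩ h2 heq
    simp only at heq; subst heq
    have h1' := (mem_filter.1 (mem_coe.1 h1)).2
    have h2' := (mem_filter.1 (mem_coe.1 h2)).2
    have : v = v' := by
      funext j
      have := congrFun (h1'.trans h2'.symm) j
      simp only [hF, add_left_inj] at this
      exact Subtype.ext this
    rw [this]
  refine ⟨T0, ?_, ?_, f, ?_, ?_, ?_⟩
  · intro s hs
    obtain ⟨w, hw, rfl⟩ := mem_image.1 hs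
    exact (mem_product.1 (mem_filter.1 hw).1).2
  · rw [← hT0c, div_le_iff₀ hZ0, card_product] at hzc
    push_cast at hzc
    rw [← hn] at hzc
    have e1 : n^k * n ≤ n^k * (2^(1+2*κ*k) * T0.card) := by
      calc n^k * n ≤ 2 * (Good.card * n) := by nlinarith
        _ ≤ 2 * (T0.card * Z.card) := by gcongr
        _ ≤ 2 * (T0.card * (2^(2*κ) * n)^k) := by gcongr
        _ = _ := by rw [mul_pow, ← pow_mul, pow_add]; ring
    have e2 := le_of_mul_le_mul_left e1 (by positivity)
    rw [hn] at e2
    exact_mod_cast e2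
  · intro y hy
    simp only [hf]
    have : ∀ i : {x // x ∈ A}, φ i y = 1 := by
      intro i; simp only [hφ]; rw [if_pos (sub_mem_sub hy i.2)]
    simp only [this, mul_one]
    exact_mod_cast hq1
  · intro y hy
    by_contra hyS
    apply hy
    simp only [hf]
    apply sum_eq_zero; intro i _
    simp only [hφ]
    rw [if_neg, mul_zero]
    intro hc
    apply hyS
    have := hSW i.1 i.2 _ hc
    rwa [add_sub_cancel] at this
  · have hφS : ∀ i y, y ∉ S → φ i y = 0 := by
      intro i y hyS
      simp only [hφ]
      rw [if_neg]
      intro hc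
      apply hyS
      have := hSW i.1 i.2 _ hc
      rwa [add_sub_cancel] at this
    set fz : G → ℂ := fun u => (1/k:ℂ) * ∑ j, (if u - z j ∈ W then 1 else 0 : ℂ) with hfz
    have hkey : ∀ s ∈ T0, ((univ.filter fun u => ε < ‖fz (u+s) - f u‖).card : ℝ) ≤ 2 * (1/2)^p * S.card := by
      intro s hs
      obtain ⟨⟨v, s'⟩, hw, rfl⟩ := mem_image.1 hs
      have hw' := mem_filter.1 hw
      have hv := (mem_filter.1 (mem_product.1 hw'.1).1).2
      refine le_trans ?_ hv
      have : (univ.filter fun u => ε < ‖fz (u+s') - f u‖) ⊆ bad v := by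
        intro u hu
        have hu' := (mem_filter.1 hu).2
        have e : fz (u+s') = (1 / k : ℂ) * ∑ j, φ (v j) u := by
          simp only [hfz, hφ]
          congr 1; apply sum_congr rfl; intro j _
          have : z j = (v j).1 + s' := by rw [← hw'.2]
          rw [this, add_sub_add_right_eq_sub]
        rw [e] at hu'
        rw [hbad, mem_filter]
        refine ⟨?_, hu'⟩
        by_contra hc
        have z1 : ∑ j, φ (v j) u = 0 := sum_eq_zero fun j _ => hφS _ _ hc
        have z2 : f u = 0 := by
          simp only [hf]; apply sum_eq_zero; intro i _; rw [hφS _ _ hc, mul_zero]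
        rw [z1, z2] at hu'
        simp at hu'
        linarith
      exact_mod_cast card_le_card this
    intro t ht
    obtain ⟨s, hs, s', hs', rfl⟩ := mem_sub.1 ht
    have k1 := hkey s hs
    have k2 := hkey s' hs'
    have hsub : (univ.filter fun u => 1/(2*l:ℝ) < ‖f u - f (u+(s-s'))‖) ⊆
        (univ.filter fun u => ε < ‖fz (u+s) - f u‖) ∪ (univ.filter fun u => ε < ‖fz (u+s) - f (u+(s-s'))‖) := by
      intro u hu
      have hu' := (mem_filter.1 hu).2
      rw [mem_union, mem_filter, mem_filter]
      by_contra hc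
      push Not at hc
      have c1 := hc.1 (mem_univ _)
      have c2 := hc.2 (mem_univ _)
      have e : f u - f (u+(s-s')) = (fz (u+s) - f (u+(s-s'))) - (fz (u+s) - f u) := by ring
      have := norm_sub_le (fz (u+s) - f (u+(s-s'))) (fz (u+s) - f u)
      rw [← e] at this
      have e2 : 1/(2*l:ℝ) = ε + ε := by rw [hε]; field_simp; norm_num
      linarith
    have hsec : ((univ.filter fun u => ε < ‖fz (u+s) - f (u+(s-s'))‖).card) ≤ (univ.filter fun u => ε < ‖fz (u+s') - f u‖).card := by
      apply card_le_card_of_injOn (fun u => u + (s - s'))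
      · intro u hu
        have hu' := (mem_filter.1 (mem_coe.1 hu)).2
        rw [mem_coe, mem_filter]
        refine ⟨mem_univ _, ?_⟩
        have e : u + (s - s') + s' = u + s := by abel
        rw [e]; exact hu'
      · intro a _ b _ hab
        exact add_right_cancel hab
    have h1 := (card_le_card hsub).trans (card_union_le _ _)
    have h2 : ((univ.filter fun u => 1/(2*l:ℝ) < ‖f u - f (u+(s-s'))‖).card : ℝ) ≤ ((univ.filter fun u => ε < ‖fz (u+s) - f u‖).card : ℝ) + (univ.filter fun u => ε < ‖fz (u+s') - f u‖).card := by
      have h3 := h1.trans (Nat.add_le_add_left hsec _)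
      exact_mod_cast h3
    calc _ ≤ _ := h2
      _ ≤ 2 * (1/2)^p * S.card + 2 * (1/2)^p * S.card := add_le_add k1 k2
      _ = _ := by ring

lemma croot_sisask (A : Finset G) (κ : ℕ) (hA : A.Nonempty) (h : (A - A).card ≤ 2^κ * A.card)
    (l p k : ℕ) (hl : 1 ≤ l) (hp : l * 2^(3*κ+3) ≤ 2^p) (hk : 4096 * (p + 2) * l^2 ≤ k) :
    ∃ T0 ⊆ A, A.card ≤ 2^(1+2*κ*k) * T0.card ∧ l • (T0 - T0) ⊆ 2 • A - 2 • A := by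
  obtain ⟨T0, hT0A, hT0c, f, hf1, hf2, hft⟩ := cs_shift A κ hA h (2*l) p k (by omega) (by
    calc _ = 4096 * (p + 2) * l^2 := by ring
      _ ≤ _ := hk)
  refine ⟨T0, hT0A, hT0c, ?_⟩
  set B : ℝ := 4 * (1/2)^p * (2 • A - A).card with hB
  have hl0 : (0:ℝ) < l := by exact_mod_cast hl
  have hmain : ∀ i : ℕ, ∀ t ∈ i • (T0 - T0), ((univ.filter fun u => (i:ℝ)/(4*l) < ‖f u - f (u+t)‖).card : ℝ) ≤ i * B := by
    intro i
    induction i with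
    | zero =>
      intro t ht
      rw [zero_nsmul, mem_zero] at ht
      subst ht
      simp
    | succ i ih =>
      intro t ht
      rw [succ_nsmul] at ht
      obtain ⟨t1, h1, t2, h2, rfl⟩ := mem_add.1 ht
      have k1 := ih t1 h1
      have k2 := hft t2 h2
      have hsub : (univ.filter fun u => ((i+1:ℕ):ℝ)/(4*l) < ‖f u - f (u+(t1+t2))‖) ⊆
          (univ.filter fun u => (i:ℝ)/(4*l) < ‖f u - f (u+t1)‖) ∪ ((univ.filter fun u => 1/(2*((2*l:ℕ):ℝ)) < ‖f (u+t1) - f (u+t1+t2)‖)) := by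
        intro u hu
        have hu' := (mem_filter.1 hu).2
        rw [mem_union, mem_filter, mem_filter]
        by_contra hc
        push Not at hc
        have c1 := hc.1 (mem_univ _)
        have c2 := hc.2 (mem_univ _)
        have := norm_add_le (f u - f (u+t1)) (f (u+t1) - f (u+t1+t2))
        rw [sub_add_sub_cancel, add_assoc] at this
        have e : ((i+1:ℕ):ℝ)/(4*l) = (i:ℝ)/(4*l) + 1/(2*((2*l:ℕ):ℝ)) := by push_cast; field_simp; ring
        rw [add_assoc] at c2
        linarith
      have hsec : ((univ.filter fun u => 1/(2*((2*l:ℕ):ℝ)) < ‖f (u+t1) - f (u+t1+t2)‖).card) ≤ (univ.filter fun u => 1/(2*((2*l:ℕ):ℝ)) < ‖f u - f (u+t2)‖).card := by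
        apply card_le_card_of_injOn (fun u => u + t1)
        · intro u hu
          have hu' := (mem_filter.1 (mem_coe.1 hu)).2
          rw [mem_coe, mem_filter]
          exact ⟨mem_univ _, hu'⟩
        · intro a _ b _ hab
          exact add_right_cancel hab
      have h1 := (card_le_card hsub).trans (card_union_le _ _)
      have h2 : ((univ.filter fun u => ((i+1:ℕ):ℝ)/(4*l) < ‖f u - f (u+(t1+t2))‖).card : ℝ) ≤ ((univ.filter fun u => (i:ℝ)/(4*l) < ‖f u - f (u+t1)‖).card : ℝ) + (univ.filter fun u => 1/(2*((2*l:ℕ):ℝ)) < ‖f u - f (u+t2)‖).card := by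
        exact_mod_cast h1.trans (Nat.add_le_add_left hsec _)
      push_cast at k2 h2 ⊢
      linarith
  intro t ht
  have hA0 : (0:ℝ) < A.card := by exact_mod_cast hA.card_pos
  have hlt : (l:ℝ) * B < A.card := by
    have e1 := plun A κ hA h 2 1
    rw [one_nsmul] at e1
    have e2 : ((2 • A - A).card : ℝ) ≤ 2^(3*κ) * A.card := by
      rw [mul_comm 3 κ]; exact_mod_cast e1
    have e3 : (l:ℝ) * 2^(3*κ+3) ≤ 2^p := by exact_mod_cast hp
    have e4 : (1/2:ℝ)^p * 2^p = 1 := by rw [← mul_pow]; norm_num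
    calc (l:ℝ) * B ≤ l * (4 * (1/2)^p * (2^(3*κ) * A.card)) := by rw [hB]; gcongr
      _ = (1/2) * (1/2)^p * (l * 2^(3*κ+3)) * A.card := by ring
      _ ≤ (1/2) * (1/2)^p * 2^p * A.card := by gcongr
      _ = (1/2) * A.card := by rw [mul_assoc (1/2:ℝ), e4]; ring
      _ < _ := by linarith
  have hcard := (hmain l t ht).trans_lt hlt
  have : ∃ u ∈ A, u ∉ (univ.filter fun u => (l:ℝ)/(4*l) < ‖f u - f (u+t)‖) := by
    by_contra hc
    push Not at hc
    have : A.card ≤ (univ.filter fun u => (l:ℝ)/(4*l) < ‖f u - f (u+t)‖).card := card_le_card hc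
    have : (A.card : ℝ) ≤ (univ.filter fun u => (l:ℝ)/(4*l) < ‖f u - f (u+t)‖).card := by exact_mod_cast this
    linarith
  obtain ⟨u, huA, hu⟩ := this
  rw [mem_filter, not_and, not_lt] at hu
  have hu' := hu (mem_univ _)
  have hne : f (u+t) ≠ 0 := by
    intro h0
    rw [hf1 u huA, h0] at hu'
    have : (l:ℝ)/(4*l) = 1/4 := by field_simp
    rw [this] at hu'
    norm_num at hu'
  obtain ⟨x, hx, y, hy, hxy⟩ := mem_sub.1 (hf2 _ hne)
  rw [two_nsmul A] at hx ⊢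
  refine mem_sub.2 ⟨x, hx, y + u, add_mem_add hy huA, ?_⟩
  rw [sub_add_eq_sub_sub, hxy]; abel

end P10

section P11
open scoped Classical
open Finset
variable {G : Type} [AddCommGroup G] [Fintype G]

/-- Subset sum translates of `D` are disjoint. -/
def Diss {H : Type*} [AddCommGroup H] (D Γ : Finset H) : Prop :=
  ∀ S ⊆ Γ, ∀ S' ⊆ Γ, ∀ d ∈ D, ∀ d' ∈ D, ∑ x ∈ S, x + d = ∑ x ∈ S', x + d' → S = S' ∧ d = d'

lemma diss_card {H : Type*} [AddCommGroup H] (D Γ U : Finset H) (h : Diss D Γ)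
    (hU : ∀ S ⊆ Γ, ∀ d ∈ D, ∑ x ∈ S, x + d ∈ U) : 2^Γ.card * D.card ≤ U.card := by
  rw [← card_powerset, ← card_product]
  apply card_le_card_of_injOn (fun p => ∑ x ∈ p.1, x + p.2)
  · rintro ⟨S, d⟩ hp
    have := mem_product.1 (mem_coe.1 hp)
    exact hU S (mem_powerset.1 this.1) d this.2
  · rintro ⟨S, d⟩ hp ⟨S', d'⟩ hp' heq
    have h1 := mem_product.1 (mem_coe.1 hp)
    have h2 := mem_product.1 (mem_coe.1 hp')
    have := h S (mem_powerset.1 h1.1) S' (mem_powerset.1 h2.1) d h1.2 d' h2.2 heq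
    rw [this.1, this.2]

lemma diss_mono {H : Type*} [AddCommGroup H] (D Γ Γ' : Finset H) (hs : Γ' ⊆ Γ) (h : Diss D Γ) : Diss D Γ' :=
  fun S hS S' hS' => h S (hS.trans hs) S' (hS'.trans hs)

lemma chang_cover {H : Type*} [AddCommGroup H] (B D : Finset H) (hD : D.Nonempty) (n : ℕ)
    (hn : ∀ Γ ⊆ B, Γ.card = n → ¬ Diss D Γ) :
    ∃ Γ ⊆ B, Γ.card < n ∧ ∀ b ∈ B, ∃ ε : H → ℤ, (∀ x, |ε x| ≤ 1) ∧
      ∃ d ∈ D, ∃ d' ∈ D, b = ∑ x ∈ Γ, ε x • x + d - d' := by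
  have hne : (B.powerset.filter fun Γ => Diss D Γ).Nonempty := by
    refine ⟨∅, mem_filter.2 ⟨empty_mem_powerset _, ?_⟩⟩
    intro S hS S' hS' d _ d' _ h
    rw [subset_empty] at hS hS'
    subst hS; subst hS'
    exact ⟨rfl, by simpa using h⟩
  obtain ⟨Γ, hΓ, hmax⟩ := exists_max_image _ card hne
  rw [mem_filter, mem_powerset] at hΓ
  refine ⟨Γ, hΓ.1, ?_, ?_⟩
  · by_contra hc
    obtain ⟨Γ', h1, h2⟩ := exists_subset_card_eq (not_lt.1 hc)
    exact hn Γ' (h1.trans hΓ.1) h2 (diss_mono _ _ _ h1 hΓ.2)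
  · intro b hb
    by_cases hbΓ : b ∈ Γ
    · obtain ⟨d, hd⟩ := hD
      refine ⟨fun x => if x = b then 1 else 0, fun x => by dsimp only; split_ifs <;> simp, d, hd, d, hd, ?_⟩
      simp only [ite_smul, one_smul, zero_smul]
      rw [sum_ite_eq' , if_pos hbΓ]; abel
    · have hnot : ¬ Diss D (insert b Γ) := by
        intro h
        have := hmax (insert b Γ) (mem_filter.2 ⟨mem_powerset.2 (insert_subset hb hΓ.1), h⟩)
        rw [card_insert_of_notMem hbΓ] at this
        omega
      have gen : ∀ S ⊆ insert b Γ, ∑ x ∈ S, x = ∑ x ∈ Γ, (if x ∈ S then 1 else 0 : ℤ) • x + (if b ∈ S then 1 else 0 : ℤ) • b := by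
        intro S hS
        have e1 : ∑ x ∈ S, x = ∑ x ∈ insert b Γ, (if x ∈ S then 1 else 0 : ℤ) • x := by
          simp only [ite_smul, one_smul, zero_smul]
          rw [← sum_filter, filter_mem_eq_inter, inter_eq_right.2 hS]
        rw [e1, sum_insert hbΓ, add_comm]
      unfold Diss at hnot
      push Not at hnot
      obtain ⟨S, hS, S', hS', d, hd, d', hd', heq, hne'⟩ := hnot
      rw [gen S hS, gen S' hS'] at heq
      by_cases h1 : b ∈ S <;> by_cases h2 : b ∈ S'
      · exfalso
        have e := hΓ.2 (S.erase b) (fun x hx => by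
            have := hS (mem_of_mem_erase hx); rw [mem_insert] at this
            exact this.resolve_left (ne_of_mem_erase hx)) (S'.erase b) (fun x hx => by
            have := hS' (mem_of_mem_erase hx); rw [mem_insert] at this
            exact this.resolve_left (ne_of_mem_erase hx)) d hd d' hd' (by
            rw [← gen S hS, ← gen S' hS', ← add_sum_erase _ _ h1, ← add_sum_erase _ _ h2, add_assoc, add_assoc] at heq
            exact add_left_cancel heq)
        exact hne' (by rw [← insert_erase h1, ← insert_erase h2, e.1]) e.2
      · rw [if_pos h1, if_neg h2, one_smul, zero_smul] at heq
        refine ⟨fun x => (if x ∈ S' then 1 else 0) - (if x ∈ S then 1 else 0), fun x => by dsimp only; split_ifs <;> simp, d', hd', d, hd, ?_⟩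
        simp only [sub_smul, sum_sub_distrib]
        have : b = (∑ x ∈ Γ, (if x ∈ S then 1 else 0 : ℤ) • x + b + d) - ∑ x ∈ Γ, (if x ∈ S then 1 else 0 : ℤ) • x - d := by abel
        rw [heq] at this
        rw [this]; abel
      · rw [if_neg h1, if_pos h2, one_smul, zero_smul] at heq
        refine ⟨fun x => (if x ∈ S then 1 else 0) - (if x ∈ S' then 1 else 0), fun x => by dsimp only; split_ifs <;> simp, d, hd, d', hd', ?_⟩
        simp only [sub_smul, sum_sub_distrib]
        have : b = (∑ x ∈ Γ, (if x ∈ S' then 1 else 0 : ℤ) • x + b + d') - ∑ x ∈ Γ, (if x ∈ S' then 1 else 0 : ℤ) • x - d' := by abel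
        rw [← heq] at this
        rw [this]; abel
      · exfalso
        have e := hΓ.2 S (fun x hx => by
            have := hS hx; rw [mem_insert] at this
            exact this.resolve_left (fun h => h1 (h ▸ hx))) S' (fun x hx => by
            have := hS' hx; rw [mem_insert] at this
            exact this.resolve_left (fun h => h2 (h ▸ hx))) d hd d' hd' (by
            rw [← gen S hS, ← gen S' hS'] at heq
            exact heq)
        exact hne' e.1 e.2

lemma growth (T A : Finset G) (h0 : 0 ∈ T) (hs : ∀ t ∈ T, -t ∈ T) (n : ℕ)
    (hn : ((3*n+1) • T).card < 2^n * T.card) (m : ℕ) :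
    (A + (m+2) • T).card ≤ (2*m+1)^n * (A + 2 • T).card := by
  obtain ⟨Γ, hΓB, hΓn, hcov⟩ := chang_cover (3 • T) T ⟨0, h0⟩ n (by
    intro Γ hΓ hcard hd
    have := diss_card T Γ ((3*n+1) • T) hd (by
      intro S hS d hd
      have hS' : ∀ S : Finset G, S ⊆ Γ → ∑ x ∈ S, x ∈ (3 * S.card) • T := by
        intro S
        induction S using Finset.induction_on with
        | empty => intro _; simp
        | insert a s ha ih =>
          intro hss
          rw [sum_insert ha, card_insert_of_notMem ha, mul_add, add_nsmul, add_comm a, mul_one]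
          exact add_mem_add (ih ((subset_insert _ _).trans hss)) (hΓ (hss (mem_insert_self _ _)))
      rw [add_nsmul, one_nsmul]
      refine add_mem_add (nsmul_subset_nsmul_right h0 ?_ (hS' S hS)) hd
      have := card_le_card hS
      omega)
    rw [hcard] at this
    omega)
  have hspan : ∀ m : ℕ, ∀ x ∈ (m+2) • T, ∃ ε : G → ℤ, (∀ y, |ε y| ≤ m) ∧ ∃ u ∈ 2 • T, x = ∑ y ∈ Γ, ε y • y + u := by
    intro m
    induction m with
    | zero =>
      intro x hx
      exact ⟨fun _ => 0, by simp, x, by simpa using hx, by simp⟩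
    | succ m ih =>
      intro x hx
      have e : (m+1+2) • T = (m+2) • T + T := by rw [← succ_nsmul]
      rw [e] at hx
      obtain ⟨y, hy, t, ht, rfl⟩ := mem_add.1 hx
      obtain ⟨ε, hε, u, hu, rfl⟩ := ih y hy
      have h3 : u + t ∈ 3 • T := by rw [succ_nsmul]; exact add_mem_add hu ht
      obtain ⟨ε', hε', d, hd, d', hd', he⟩ := hcov _ h3
      refine ⟨fun y => ε y + ε' y, fun y => ?_, d - d', ?_, ?_⟩
      · have := abs_add_le (ε y) (ε' y)
        have := hε y; have := hε' y; push_cast; linarith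
      · rw [two_nsmul, sub_eq_add_neg]; exact add_mem_add hd (hs _ hd')
      · simp only [add_smul, sum_add_distrib]
        rw [add_assoc, he]; abel
  set SP : Finset G := (Fintype.piFinset fun _ : {x // x ∈ Γ} => Icc (-(m:ℤ)) m).image fun ε => ∑ y : {x // x ∈ Γ}, ε y • y.1 with hSP
  have hSPc : SP.card ≤ (2*m+1)^n := by
    refine card_image_le.trans ?_
    rw [Fintype.card_piFinset, prod_const, card_univ, Int.card_Icc, Fintype.card_coe]
    have : ((m:ℤ) + 1 - -(m:ℤ)).toNat = 2*m+1 := by omega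
    rw [this]
    exact Nat.pow_le_pow_right (by omega) hΓn.le
  have hsub : A + (m+2) • T ⊆ SP + (A + 2 • T) := by
    intro x hx
    obtain ⟨a, ha, y, hy, rfl⟩ := mem_add.1 hx
    obtain ⟨ε, hε, u, hu, rfl⟩ := hspan m y hy
    refine mem_add.2 ⟨∑ y ∈ Γ, ε y • y, ?_, a + u, add_mem_add ha hu, by abel⟩
    rw [hSP, mem_image]
    refine ⟨fun y => ε y.1, ?_, ?_⟩
    · rw [Fintype.mem_piFinset]; intro y
      rw [mem_Icc]; exact abs_le.1 (hε _)
    · rw [← sum_coe_sort Γ (fun y => ε y • y)]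
  calc _ ≤ (SP + (A + 2 • T)).card := card_le_card hsub
    _ ≤ SP.card * (A + 2 • T).card := card_add_le
    _ ≤ _ := Nat.mul_le_mul_right _ hSPc

lemma freiman1 (A : Finset G) (κ : ℕ) (hκ : 1 ≤ κ) (hA : A.Nonempty) (h : (A - A).card ≤ 2^κ * A.card)
    (n : ℕ) (hn : n = 2^29 * κ^4) :
    ∃ T0 ⊆ A, A.card ≤ 2^n * T0.card ∧ 
      (∀ m, (A + (m+2) • (T0 - T0)).card ≤ (2*m+1)^n * (2^(5*κ) * A.card)) ∧
      (∀ m, ((m+2) • (T0 - T0)).card ≤ (2*m+1)^n * (2 • (T0 - T0)).card) := by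
  have hκ3 : 1 ≤ κ^3 := Nat.one_le_pow _ _ hκ
  have hκ4 : κ ≤ κ^4 := by calc κ = κ^1 := (pow_one _).symm
                            _ ≤ _ := Nat.pow_le_pow_right hκ (by norm_num)
  obtain ⟨T0, hT0A, hT0c, hl⟩ := croot_sisask A κ hA h (24*κ) (4*κ+8) (2^25*κ^3) (by omega) (by
      have : κ ≤ 2^κ := Nat.lt_two_pow_self.le
      calc 24*κ*2^(3*κ+3) ≤ 24*2^κ*2^(3*κ+3) := by gcongr
        _ = 192 * 2^(4*κ) := by rw [mul_assoc, ← pow_add, pow_add 2 (κ) , pow_add 2 (3*κ)]; rw [show 4*κ = κ+3*κ by ring, pow_add]; ring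
        _ ≤ 2^8 * 2^(4*κ) := by gcongr; norm_num
        _ = _ := by rw [← pow_add]; ring_nf)
      (by
      calc 4096 * (4*κ+8+2) * (24*κ)^2 ≤ 4096 * (14*κ) * (24*κ)^2 := by gcongr; omega
        _ = 33030144 * κ^3 := by ring
        _ ≤ _ := by gcongr; norm_num)
  have hT0ne : T0.Nonempty := by
    rw [← card_pos]
    by_contra hc
    have : T0.card = 0 := by omega
    rw [this, mul_zero] at hT0c
    have := hA.card_pos
    omega
  have hexp : 1+2*κ*(2^25*κ^3) ≤ n := by
    rw [hn]
    have : 1 ≤ κ^4 := hκ.trans hκ4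
    calc 1+2*κ*(2^25*κ^3) = 1 + 2^26*κ^4 := by ring
      _ ≤ κ^4 + 2^26*κ^4 := by omega
      _ ≤ _ := by omega
  have h0 : (0:G) ∈ T0 - T0 := by
    obtain ⟨x, hx⟩ := hT0ne
    exact mem_sub.2 ⟨x, hx, x, hx, sub_self _⟩
  have hs : ∀ t ∈ T0 - T0, -t ∈ T0 - T0 := by
    intro t ht
    obtain ⟨x, hx, y, hy, rfl⟩ := mem_sub.1 ht
    exact mem_sub.2 ⟨y, hy, x, hx, by abel⟩
  have hTT : T0.card ≤ (T0 - T0).card := by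
    exact card_le_card_sub_right hT0ne
  have hgr : ((3*n+1) • (T0 - T0)).card < 2^n * (T0 - T0).card := by
    set q := 2^26*κ^3+1 with hq
    have e1 : 3*n+1 ≤ 24*κ*q := by
      rw [hn, hq]
      have : 24*κ*(2^26*κ^3+1) = 3*(2^29*κ^4) + 24*κ := by ring
      omega
    have e2 : (3*n+1) • (T0 - T0) ⊆ (2*q) • A - (2*q) • A := by
      calc _ ⊆ (24*κ*q) • (T0 - T0) := nsmul_subset_nsmul_right h0 e1
        _ = q • ((24*κ) • (T0 - T0)) := by rw [mul_nsmul]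
        _ ⊆ q • (2 • A - 2 • A) := nsmul_subset_nsmul_left hl
        _ = _ := by rw [nsmul_sub, ← mul_nsmul, ]
    calc _ ≤ _ := card_le_card e2
      _ ≤ 2^(κ*(2*q+2*q)) * A.card := plun A κ hA h _ _
      _ ≤ 2^(κ*(2*q+2*q)) * (2^(1+2*κ*(2^25*κ^3)) * T0.card) := by gcongr
      _ = 2^(κ*(2*q+2*q) + (1+2*κ*(2^25*κ^3))) * T0.card := by rw [pow_add]; ring
      _ < 2^n * T0.card := by
        apply Nat.mul_lt_mul_of_pos_right _ hT0ne.card_pos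
        apply Nat.pow_lt_pow_right (by norm_num)
        rw [hn, hq]
        have : κ*(2*(2^26*κ^3+1)+2*(2^26*κ^3+1)) + (1+2*κ*(2^25*κ^3)) = 2^28*κ^4+4*κ+1+2^26*κ^4 := by ring
        omega
      _ ≤ _ := by gcongr
  refine ⟨T0, hT0A, hT0c.trans (Nat.mul_le_mul_right _ (Nat.pow_le_pow_right (by norm_num) hexp)), ?_, ?_⟩
  · intro m
    refine (growth (T0 - T0) A h0 hs n hgr m).trans (Nat.mul_le_mul_left _ ?_)
    have : A + 2 • (T0 - T0) ⊆ 3 • A - 2 • A := by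
      have e : 2 • (T0 - T0) ⊆ 2 • A - 2 • A := (nsmul_subset_nsmul_right h0 (by omega)).trans hl
      intro x hx
      obtain ⟨a, ha, u, hu, rfl⟩ := mem_add.1 hx
      obtain ⟨y, hy, z, hz, rfl⟩ := mem_sub.1 (e hu)
      refine mem_sub.2 ⟨y + a, ?_, z, hz, by abel⟩
      rw [succ_nsmul]; exact add_mem_add hy ha
    refine (card_le_card this).trans ((plun A κ hA h 3 2).trans ?_)
    rw [mul_comm κ]
  · intro m
    have := growth (T0 - T0) {0} h0 hs n hgr m
    rwa [singleton_zero, zero_add, zero_add] at this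

end P11

section P12
open scoped Classical
open Finset
variable {G : Type} [AddCommGroup G] [Fintype G]

/-- Mean square variation of a character over `X`. -/
noncomputable def dd (X : Finset G) (γ : AddChar G ℂ) : ℝ :=
  (∑ x ∈ X, ∑ y ∈ X, ‖γ x - γ y‖^2) / (2 * X.card^2)

noncomputable def ind (X : Finset G) : G → ℂ := fun x => if x ∈ X then 1 else 0

lemma ft_ind (X : Finset G) (γ : AddChar G ℂ) : ft (ind X) γ = ∑ x ∈ X, (starRingEnd ℂ) (γ x) := by
  simp only [ft, ind, ite_mul, one_mul, zero_mul]
  rw [← sum_filter, filter_mem_eq_inter, univ_inter]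

lemma norm_sq_sub_char (γ : AddChar G ℂ) (x y : G) : ‖γ x - γ y‖^2 = 2 - 2 * (γ x * (starRingEnd ℂ) (γ y)).re := by
  have h1 := norm_char γ x
  have h2 := norm_char γ y
  rw [← Complex.normSq_eq_norm_sq, Complex.normSq_sub, Complex.normSq_eq_norm_sq, Complex.normSq_eq_norm_sq, h1, h2]
  ring

lemma dd_eq (X : Finset G) (hX : X.Nonempty) (γ : AddChar G ℂ) :
    dd X γ = 1 - ‖ft (ind X) γ‖^2 / X.card^2 := by
  have hX0 : (0:ℝ) < X.card := by exact_mod_cast hX.card_pos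
  have h1 : ∑ x ∈ X, ∑ y ∈ X, ‖γ x - γ y‖^2 = 2 * X.card^2 - 2 * ‖ft (ind X) γ‖^2 := by
    simp only [norm_sq_sub_char, sum_sub_distrib, sum_const, ← mul_sum, nsmul_eq_mul]
    have : ‖ft (ind X) γ‖^2 = ∑ x ∈ X, ∑ y ∈ X, (γ x * (starRingEnd ℂ) (γ y)).re := by
      have e : ((‖ft (ind X) γ‖^2 : ℝ) : ℂ) = ∑ x ∈ X, ∑ y ∈ X, (γ x * (starRingEnd ℂ) (γ y)) := by
        push_cast
        rw [← Complex.conj_mul', ft_ind, map_sum, sum_mul_sum]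
        simp only [Complex.conj_conj]
      have e' := congrArg Complex.re e
      rw [Complex.ofReal_re] at e'
      rw [e']; simp only [Complex.re_sum]
    rw [this]; ring
  rw [dd, h1]; field_simp

lemma dd_nonneg (X : Finset G) (γ : AddChar G ℂ) : 0 ≤ dd X γ := by
  unfold dd; positivity

noncomputable def cv (X : Finset G) : ℕ → G → ℂ
  | 0 => fun y => if y = 0 then 1 else 0
  | (l+1) => fun y => ∑ x ∈ X, cv X l (y - x)

lemma ft_cv (X : Finset G) (l : ℕ) (γ : AddChar G ℂ) : ft (cv X l) γ = (ft (ind X) γ)^l := by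
  induction l with
  | zero => simp [ft, cv]
  | succ l ih =>
    rw [pow_succ, ← ih, ft_ind]
    simp only [ft, cv, sum_mul, mul_sum]
    rw [sum_comm]
    apply sum_congr rfl; intro x _
    apply Fintype.sum_equiv (Equiv.subRight x)
    intro y
    simp only [Equiv.subRight_apply]
    have : γ y = γ (y - x) * γ x := by rw [← AddChar.map_add_eq_mul, sub_add_cancel]
    rw [this, map_mul]; ring

lemma cv_supp (X : Finset G) (l : ℕ) (y : G) (h : cv X l y ≠ 0) : y ∈ l • X := by
  induction l generalizing y with
  | zero =>
    simp only [cv] at h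
    rw [zero_nsmul, mem_zero]
    by_contra hc
    exact h (if_neg hc)
  | succ l ih =>
    simp only [cv] at h
    obtain ⟨x, hx, hne⟩ := exists_ne_zero_of_sum_ne_zero h
    rw [succ_nsmul]
    exact mem_add.2 ⟨y - x, ih _ hne, x, hx, by abel⟩

lemma cv_sum (X : Finset G) (l : ℕ) : ∑ y, cv X l y = (X.card : ℂ)^l := by
  have h := ft_cv X l 0
  rw [ft_ind] at h
  simp only [ft, AddChar.zero_apply, map_one, mul_one] at h
  rw [h]; simp

lemma sum_ft_sq_char (u : G → ℂ) (y : G) :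
    ∑ γ, ((‖ft u γ‖^2 : ℝ) : ℂ) * γ y = Fintype.card G * ∑ x, u (x + y) * (starRingEnd ℂ) (u x) := by
  have hG : (Fintype.card G : ℂ) ≠ 0 := by exact_mod_cast Fintype.card_ne_zero
  have := inversion (fun t => ∑ x, u (x + t) * (starRingEnd ℂ) (u x)) y
  simp only [fourierCoeff_eq, ← ft_sq] at this
  rw [← this, mul_sum]
  apply sum_congr rfl; intro γ _
  field_simp

lemma spec_main (X : Finset G) (hX : X.Nonempty) (l : ℕ) (τ : ℝ) (hτ1 : τ ≤ 1)
    (hcond : 4 * (1 - τ)^l * (((l+1) • X).card : ℝ) ≤ X.card)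
    (Λ : Finset (AddChar G ℂ)) (hΛ : Λ = univ.filter fun γ => dd X γ ≤ τ) :
    Bo Λ 1 ⊆ (l+1) • X - (l+1) • X ∧ Fintype.card G ≤ 2 * ((l+1) • X).card * Λ.card := by
  have hX0 : (0:ℝ) < X.card := by exact_mod_cast hX.card_pos
  have hG0 : (0:ℝ) < Fintype.card G := by exact_mod_cast Fintype.card_pos
  obtain ⟨N, hN⟩ : ∃ N : ℝ, N = (Fintype.card G : ℝ) := ⟨_, rfl⟩
  obtain ⟨c, hc⟩ : ∃ c : ℝ, c = (X.card : ℝ) := ⟨_, rfl⟩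
  obtain ⟨L, hL⟩ : ∃ L : ℝ, L = (((l+1) • X).card : ℝ) := ⟨_, rfl⟩
  have hL0 : 0 < L := by rw [hL]; exact_mod_cast (hX.nsmul).card_pos
  rw [← hc] at hX0 hcond
  rw [← hL] at hcond
  rw [← hN] at hG0
  set S : AddChar G ℂ → ℝ := fun γ => ‖ft (ind X) γ‖^2 with hS
  have hS0 : ∀ γ, 0 ≤ S γ := fun γ => by positivity
  have hSle : ∀ γ, S γ ≤ c^2 := by
    intro γ
    simp only [hS]
    have : ‖ft (ind X) γ‖ ≤ c := by
      rw [ft_ind]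
      refine (norm_sum_le _ _).trans ?_
      simp only [RCLike.norm_conj, norm_char, sum_const, nsmul_eq_mul, mul_one]
      rw [hc]
    gcongr
  have hSout : ∀ γ, γ ∉ Λ → S γ ≤ (1 - τ) * c^2 := by
    intro γ hγ
    rw [hΛ, mem_filter, not_and, not_le, dd_eq X hX, ← hc] at hγ
    have := hγ (mem_univ _)
    have : ‖ft (ind X) γ‖^2 / c^2 < 1 - τ := by linarith
    rw [div_lt_iff₀ (by positivity)] at this
    exact this.le
  have hsumS : ∑ γ, S γ = N * c := by
    simp only [hS]
    rw [parseval, ← hN]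
    congr 1
    have : ∀ x, ‖ind X x‖^2 = if x ∈ X then 1 else 0 := by
      intro x; simp only [ind]; split_ifs <;> simp
    simp only [this]
    rw [← sum_filter, filter_mem_eq_inter, univ_inter, hc]; simp
  have hScv : ∀ γ, S γ ^ (l+1) = ‖ft (cv X (l+1)) γ‖^2 := by
    intro γ; rw [ft_cv, norm_pow]; simp only [hS]; ring
  obtain ⟨E, hE⟩ : ∃ E : ℝ, E = ∑ γ, S γ ^ (l+1) := ⟨_, rfl⟩
  have hElow : N * (c^2)^(l+1) ≤ L * E := by
    rw [hE, sum_congr rfl fun γ _ => hScv γ, parseval, ← hN]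
    have e1 : ‖∑ y ∈ (l+1) • X, cv X (l+1) y‖^2 ≤ L * ∑ y ∈ (l+1) • X, ‖cv X (l+1) y‖^2 := by
      calc _ ≤ (∑ y ∈ (l+1) • X, ‖cv X (l+1) y‖)^2 := by gcongr; exact norm_sum_le _ _
        _ ≤ _ := by rw [hL]; exact sq_sum_le_card_mul_sum_sq
    have e2 : ∑ y ∈ (l+1) • X, cv X (l+1) y = (X.card:ℂ)^(l+1) := by
      rw [← cv_sum]
      apply sum_subset (subset_univ _)
      intro y _ hy
      by_contra hne
      exact hy (cv_supp _ _ _ hne)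
    rw [e2, norm_pow, Complex.norm_natCast, ← hc] at e1
    have e3 : ∑ y ∈ (l+1) • X, ‖cv X (l+1) y‖^2 ≤ ∑ y, ‖cv X (l+1) y‖^2 :=
      sum_le_sum_of_subset_of_nonneg (subset_univ _) fun _ _ _ => by positivity
    calc N * (c^2)^(l+1) = N * (c^(l+1))^2 := by ring
      _ ≤ N * (L * ∑ y ∈ (l+1) • X, ‖cv X (l+1) y‖^2) := by gcongr
      _ ≤ N * (L * ∑ y, ‖cv X (l+1) y‖^2) := by gcongr
      _ = _ := by ring
  have hEpos : 0 < E := by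
    have : 0 < L * E := lt_of_lt_of_le (by positivity) hElow
    exact (pos_iff_pos_of_mul_pos this).1 hL0
  obtain ⟨out, hout⟩ : ∃ out : ℝ, out = ∑ γ ∈ univ \ Λ, S γ ^ (l+1) := ⟨_, rfl⟩
  have hout4 : 4 * out ≤ E := by
    have e1 : out ≤ ((1 - τ) * c^2)^l * (N * c) := by
      rw [← hsumS, hout]
      calc _ ≤ ∑ γ ∈ univ \ Λ, ((1 - τ) * c^2)^l * S γ := by
            apply sum_le_sum; intro γ hγ
            rw [pow_succ]
            have := hSout γ (mem_sdiff.1 hγ).2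
            have := hS0 γ
            gcongr
        _ ≤ ∑ γ, ((1 - τ) * c^2)^l * S γ := by
            apply sum_le_sum_of_subset_of_nonneg (subset_univ _)
            intro γ _ _
            have : 0 ≤ 1 - τ := by linarith
            have := hS0 γ
            positivity
        _ = _ := by rw [mul_sum]
    have e2 : L * (4 * out) ≤ L * E := by
      calc L * (4 * out) ≤ L * (4 * (((1 - τ) * c^2)^l * (N * c))) := by gcongr
        _ = (4 * (1 - τ)^l * L) * ((c^2)^l * N * c) := by rw [mul_pow]; ring
        _ ≤ c * ((c^2)^l * N * c) := by gcongr
        _ = N * (c^2)^(l+1) := by ring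
        _ ≤ _ := hElow
    exact le_of_mul_le_mul_left e2 hL0
  have hin : ∑ γ ∈ Λ, S γ ^ (l+1) = E - out := by
    rw [hE, hout, ← sum_sdiff (subset_univ Λ)]; ring
  constructor
  · intro y hy
    by_contra hne
    have hz : ∑ x, cv X (l+1) (x + y) * (starRingEnd ℂ) (cv X (l+1) x) = 0 := by
      apply sum_eq_zero; intro x _
      by_contra hcc
      have h1 := left_ne_zero_of_mul hcc
      have h2 := right_ne_zero_of_mul hcc
      rw [Ne, map_eq_zero] at h2
      apply hne
      exact mem_sub.2 ⟨_, cv_supp _ _ _ h1, _, cv_supp _ _ _ h2, by abel⟩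
    have e := sum_ft_sq_char (cv X (l+1)) y
    rw [hz, mul_zero] at e
    have e' := congrArg Complex.re e
    simp only [Complex.re_sum, Complex.re_ofReal_mul, Complex.zero_re, ← hScv] at e'
    rw [← sum_sdiff (subset_univ Λ)] at e'
    have h1 : ∑ γ ∈ Λ, S γ ^ (l+1) * (1/2) ≤ ∑ γ ∈ Λ, S γ ^ (l+1) * (γ y).re := by
      apply sum_le_sum; intro γ hγ
      have hb := mem_Bo.1 hy γ hγ
      have e1 := norm_sq_sub_char γ 0 y
      rw [AddChar.map_zero_eq_one, one_mul, Complex.conj_re] at e1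
      have : ‖1 - γ y‖^2 ≤ 1 := by
        have := norm_nonneg (1 - γ y)
        nlinarith
      have := hS0 γ
      have : (1/2:ℝ) ≤ (γ y).re := by linarith
      gcongr
    have h2 : ∑ γ ∈ univ \ Λ, -(S γ ^ (l+1)) ≤ ∑ γ ∈ univ \ Λ, S γ ^ (l+1) * (γ y).re := by
      apply sum_le_sum; intro γ _
      have h3 := Complex.abs_re_le_norm (γ y)
      rw [norm_char] at h3
      have h4 := (abs_le.1 h3).1
      have : 0 ≤ S γ ^ (l+1) := pow_nonneg (hS0 γ) _
      nlinarith
    rw [sum_neg_distrib, ← hout] at h2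
    rw [← sum_mul, hin] at h1
    linarith
  · have h1 : E - out ≤ Λ.card * (c^2)^(l+1) := by
      rw [← hin, ← nsmul_eq_mul, ← sum_const]
      apply sum_le_sum; intro γ _
      have := hS0 γ; have := hSle γ
      gcongr
    have h2 : N * (c^2)^(l+1) ≤ (2 * L * Λ.card) * (c^2)^(l+1) := by
      calc _ ≤ L * E := hElow
        _ ≤ L * (2 * (E - out)) := by gcongr; linarith
        _ ≤ L * (2 * (Λ.card * (c^2)^(l+1))) := by gcongr
        _ = _ := by ring
    have h3 := le_of_mul_le_mul_right h2 (by positivity)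
    rw [hN, hL] at h3
    exact_mod_cast h3

lemma spec_half (X : Finset G) (hX : X.Nonempty) (Λ : Finset (AddChar G ℂ))
    (hΛ : ∀ γ ∈ Λ, dd X γ ≤ 1/2) : Λ.card * X.card ≤ 2 * Fintype.card G := by
  have hX0 : (0:ℝ) < X.card := by exact_mod_cast hX.card_pos
  have hsumS : ∑ γ, ‖ft (ind X) γ‖^2 = Fintype.card G * X.card := by
    rw [parseval]
    congr 1
    have : ∀ x, ‖ind X x‖^2 = if x ∈ X then 1 else 0 := by
      intro x; simp only [ind]; split_ifs <;> simp
    simp only [this]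
    rw [← sum_filter, filter_mem_eq_inter, univ_inter]; simp
  have h1 : (Λ.card : ℝ) * (X.card^2 / 2) ≤ Fintype.card G * X.card := by
    rw [← hsumS, ← nsmul_eq_mul, ← sum_const]
    refine (sum_le_sum fun γ hγ => ?_).trans (sum_le_sum_of_subset_of_nonneg (subset_univ Λ) fun _ _ _ => by positivity)
    have := hΛ γ hγ
    rw [dd_eq X hX] at this
    have : 1/2 ≤ ‖ft (ind X) γ‖^2 / X.card^2 := by linarith
    rw [le_div_iff₀ (by positivity)] at this
    linarith
  have h2 : ((Λ.card : ℝ) * X.card) * X.card ≤ (2 * Fintype.card G) * X.card := by nlinarith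
  have h3 := le_of_mul_le_mul_right h2 hX0
  exact_mod_cast h3

lemma dd_sum (X : Finset G) (Γ : Finset (AddChar G ℂ)) : dd X (∑ γ ∈ Γ, γ) ≤ Γ.card * ∑ γ ∈ Γ, dd X γ := by
  have h1 : ∀ x y : G, ‖(∑ γ ∈ Γ, γ) x - (∑ γ ∈ Γ, γ) y‖ ≤ ∑ γ ∈ Γ, ‖γ x - γ y‖ := by
    intro x y
    induction Γ using Finset.induction_on with
    | empty => simp
    | insert a s ha ih =>
      rw [sum_insert ha, sum_insert ha]
      rw [← char_sub_norm, ← char_sub_norm, AddChar.add_apply]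
      rw [← char_sub_norm] at ih
      have e : (1:ℂ) - a (x-y) * (∑ γ ∈ s, γ) (x-y) = (1 - a (x-y)) + a (x-y) * (1 - (∑ γ ∈ s, γ) (x-y)) := by ring
      rw [e]
      refine (norm_add_le _ _).trans ?_
      rw [norm_mul, norm_char, one_mul]
      gcongr
  have h2 : ∀ x y : G, ‖(∑ γ ∈ Γ, γ) x - (∑ γ ∈ Γ, γ) y‖^2 ≤ Γ.card * ∑ γ ∈ Γ, ‖γ x - γ y‖^2 := by
    intro x y
    calc _ ≤ (∑ γ ∈ Γ, ‖γ x - γ y‖)^2 := by gcongr; exact h1 x y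
      _ ≤ _ := sq_sum_le_card_mul_sum_sq
  unfold dd
  rw [← sum_div, mul_div_assoc', mul_sum]
  gcongr
  calc _ ≤ ∑ x ∈ X, ∑ y ∈ X, Γ.card * ∑ γ ∈ Γ, ‖γ x - γ y‖^2 := sum_le_sum fun x _ => sum_le_sum fun y _ => h2 x y
    _ = _ := by
      simp only [← mul_sum]
      congr 1
      rw [sum_comm]
      rw [sum_congr rfl fun x _ => sum_comm, sum_comm]
      apply sum_congr rfl; intro x _
      rw [sum_comm]

lemma dd_add (X : Finset G) (γ γ' : AddChar G ℂ) : dd X (γ + γ') ≤ 2 * dd X γ + 2 * dd X γ' := by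
  have h2 : ∀ x y : G, ‖(γ+γ') x - (γ+γ') y‖^2 ≤ 2 * ‖γ x - γ y‖^2 + 2 * ‖γ' x - γ' y‖^2 := by
    intro x y
    have h1 : ‖(γ+γ') x - (γ+γ') y‖ ≤ ‖γ x - γ y‖ + ‖γ' x - γ' y‖ := by
      rw [← char_sub_norm, ← char_sub_norm, ← char_sub_norm, AddChar.add_apply]
      have e : (1:ℂ) - γ (x-y) * γ' (x-y) = (1 - γ (x-y)) + γ (x-y) * (1 - γ' (x-y)) := by ring
      rw [e]
      refine (norm_add_le _ _).trans ?_
      rw [norm_mul, norm_char, one_mul]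
    have := norm_nonneg ((γ+γ') x - (γ+γ') y)
    nlinarith [sq_nonneg (‖γ x - γ y‖ - ‖γ' x - γ' y‖)]
  unfold dd
  rw [mul_div_assoc', mul_div_assoc', ← add_div]
  gcongr
  calc _ ≤ ∑ x ∈ X, ∑ y ∈ X, (2 * ‖γ x - γ y‖^2 + 2 * ‖γ' x - γ' y‖^2) := sum_le_sum fun x _ => sum_le_sum fun y _ => h2 x y
    _ = _ := by simp only [sum_add_distrib, ← mul_sum]

lemma spec_close (X T : Finset G) (hX : X.Nonempty) (h0 : 0 ∈ T) (hs : ∀ t ∈ T, -t ∈ T) 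
    (hXT : 4 * (X + T).card ≤ 5 * X.card)
    (γ : AddChar G ℂ) (δ : ℝ) (hδ : 0 < δ) (hγ : dd X γ ≤ δ^2) (t : G) (ht : t ∈ T) : ‖1 - γ t‖ ≤ 6 * δ := by
  have hX0 : (0:ℝ) < X.card := by exact_mod_cast hX.card_pos
  -- choose a centre
  obtain ⟨x0, hx0, hc⟩ : ∃ x0 ∈ X, ∑ y ∈ X, ‖γ x0 - γ y‖^2 ≤ 2 * δ^2 * X.card := by
    by_contra hcon
    push Not at hcon
    have := sum_lt_sum_of_nonempty hX hcon
    rw [sum_const, nsmul_eq_mul] at this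
    rw [dd, div_le_iff₀ (by positivity)] at hγ
    nlinarith
  set X' := X.filter fun y => ‖γ x0 - γ y‖ ≤ 3 * δ with hX'
  have hX'c : 3 * X.card < 4 * X'.card := by
    have e1 : ((X.filter fun y => ¬ ‖γ x0 - γ y‖ ≤ 3 * δ).card : ℝ) * (9 * δ^2) ≤ ∑ y ∈ X, ‖γ x0 - γ y‖^2 := by
      rw [← nsmul_eq_mul, ← sum_const]
      refine (sum_le_sum fun y hy => ?_).trans (sum_le_sum_of_subset_of_nonneg (filter_subset _ _) fun _ _ _ => by positivity)
      have := (mem_filter.1 hy).2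
      push Not at this
      nlinarith
    have e2 : (((X.filter fun y => ¬ ‖γ x0 - γ y‖ ≤ 3 * δ).card : ℝ) * 9) * δ^2 ≤ (2 * X.card) * δ^2 := by nlinarith
    have e3 := le_of_mul_le_mul_right e2 (by positivity)
    have e4 : (X.filter fun y => ¬ ‖γ x0 - γ y‖ ≤ 3 * δ).card * 9 ≤ 2 * X.card := by exact_mod_cast e3
    have e5 : X'.card + _ = _ := card_filter_add_card_filter_not (s := X) (fun y => ‖γ x0 - γ y‖ ≤ 3 * δ)
    have := hX.card_pos
    omega
  have hinter : ∃ x ∈ X', x - t ∈ X' := by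
    by_contra hcon
    push Not at hcon
    have hdisj : Disjoint X' (X'.image fun y => y + t) := by
      rw [Finset.disjoint_left]
      intro x hx hx'
      obtain ⟨y, hy, rfl⟩ := mem_image.1 hx'
      exact hcon _ hx (by simpa using hy)
    have hsub : X' ∪ (X'.image fun y => y + t) ⊆ X + T := by
      apply union_subset
      · intro x hx
        exact mem_add.2 ⟨x, (mem_filter.1 hx).1, 0, h0, add_zero _⟩
      · intro x hx
        obtain ⟨y, hy, rfl⟩ := mem_image.1 hx
        exact add_mem_add (mem_filter.1 hy).1 ht
    have := card_le_card hsub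
    rw [card_union_of_disjoint hdisj, card_image_of_injective _ (add_left_injective t)] at this
    omega
  obtain ⟨x, hx, hxt⟩ := hinter
  have h1 := (mem_filter.1 hx).2
  have h2 := (mem_filter.1 hxt).2
  have e : t = x - (x - t) := by abel
  rw [e, char_sub_norm]
  have e2 : γ x - γ (x - t) = (γ x0 - γ (x - t)) - (γ x0 - γ x) := by ring
  rw [e2]
  refine (norm_sub_le _ _).trans ?_
  linarith

end P12

section P13
open scoped Classical
open Finset
variable {G : Type} [AddCommGroup G] [Fintype G]

lemma decay_num (N w : ℕ) (hN : 1 ≤ N) : (1 - 1/(N:ℝ))^(N*w) ≤ (1/2)^w := by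
  have hN0 : (0:ℝ) < N := by exact_mod_cast hN
  have hN1 : 1/(N:ℝ) ≤ 1 := by rw [div_le_one hN0]; exact_mod_cast hN
  rw [pow_mul]
  apply pow_le_pow_left₀ (pow_nonneg (by linarith) _)
  have h1 : 1 - 1/(N:ℝ) ≤ Real.exp (-(1/N)) := Real.one_sub_le_exp_neg _
  calc (1 - 1/(N:ℝ))^N ≤ (Real.exp (-(1/N)))^N := pow_le_pow_left₀ (by linarith) h1 _
    _ = Real.exp (-1) := by rw [← Real.exp_nat_mul]; congr 1; field_simp
    _ ≤ 1/2 := by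
      rw [Real.exp_neg, one_div]
      apply inv_anti₀ (by norm_num)
      have := Real.exp_one_gt_d9; linarith

lemma ratio_num (T : Finset G) (h0 : 0 ∈ T) (n : ℕ) 
    (hgr : ∀ m, ((m+2) • T).card ≤ (2*m+1)^n * (2 • T).card) (j : ℕ) (hj : 2 ≤ j) (L : ℕ) :
    ((L+1) • (j • T)).card ≤ (2*(L+1)*j)^n * (j • T).card := by
  rw [← mul_nsmul]
  obtain ⟨m, hm⟩ : ∃ m, j * (L+1) = m + 2 := ⟨j*(L+1) - 2, by
    have : j * 1 ≤ j * (L+1) := Nat.mul_le_mul_left _ (by omega)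
    omega⟩
  rw [hm]
  calc _ ≤ (2*m+1)^n * (2 • T).card := hgr m
    _ ≤ (2*(L+1)*j)^n * (j • T).card := by
      apply Nat.mul_le_mul
      · apply Nat.pow_le_pow_left
        have : 2*(L+1)*j = 2*(j*(L+1)) := by ring
        omega
      · exact card_le_card (nsmul_subset_nsmul_right h0 hj)

lemma spec_num (T : Finset G) (h0 : 0 ∈ T) (n : ℕ) (hn : 1 ≤ n)
    (hgr : ∀ m, ((m+2) • T).card ≤ (2*m+1)^n * (2 • T).card) (j J ν α : ℕ) (hj : 2 ≤ j) (hjJ : j ≤ 2^J)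
    (hα : n * (ν + J + 3) ≤ 2^α) :
    ∃ L : ℕ, L + 1 ≤ 2^(ν+2*α+7) ∧ 
      4 * (1 - 1/((2^ν:ℕ):ℝ))^L * (((L+1) • (j • T)).card : ℝ) ≤ (j • T).card := by
  obtain ⟨a, ha⟩ : ∃ a, a = n * (ν + J + 3) := ⟨_, rfl⟩
  have hna : n ≤ a := by rw [ha]; exact Nat.le_mul_of_pos_right _ (by omega)
  have ha1 : 1 ≤ a := hn.trans hna
  rw [← ha] at hα
  refine ⟨2^ν * (64*a^2), ?_, ?_⟩
  · have e1 : 64 * a^2 ≤ 2^6 * (2^α)^2 := by gcongr; norm_num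
    have e2 : 1 ≤ 2^ν * (2^6 * (2^α)^2) := Nat.one_le_iff_ne_zero.2 (by positivity)
    calc 2^ν * (64*a^2) + 1 ≤ 2^ν * (2^6 * (2^α)^2) + 2^ν * (2^6 * (2^α)^2) := by gcongr
      _ = _ := by rw [← pow_mul]; rw [show ν+2*α+7 = ν + 6 + α*2 + 1 by ring]; simp only [pow_add]; ring
  · have hrat := ratio_num T h0 n hgr j hj (2^ν * (64*a^2))
    have hb : (2*(2^ν * (64*a^2)+1)*j)^n * 4 ≤ 2^(64*a^2) := by
      have haa : a ≤ 2^a := Nat.lt_two_pow_self.le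
      have e1 : 64 * a^2 ≤ 2^6 * (2^a)^2 := by gcongr; norm_num
      have e2 : 1 ≤ 2^ν * (2^6 * (2^a)^2) := Nat.one_le_iff_ne_zero.2 (by positivity)
      have e3 : 2*(2^ν * (64*a^2)+1)*j ≤ 2^(ν+J+8+2*a) := by
        calc 2*(2^ν * (64*a^2)+1)*j ≤ 2*(2^ν * (2^6 * (2^a)^2) + 2^ν * (2^6 * (2^a)^2))*2^J := by gcongr
          _ = _ := by rw [← pow_mul]; rw [show ν+J+8+2*a = ν + 6 + a*2 + 2 + J by ring]; simp only [pow_add]; ring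
      calc _ ≤ (2^(ν+J+8+2*a))^n * 2^2 := by gcongr; norm_num
        _ = 2^((ν+J+8+2*a)*n+2) := by rw [← pow_mul, pow_add]
        _ ≤ 2^(64*a^2) := by
          apply Nat.pow_le_pow_right (by norm_num)
          have : (ν+J+8+2*a)*n = n*(ν+J+3) + 5*n + 2*a*n := by ring
          rw [this, ← ha]
          nlinarith
    have hX0 : (0:ℝ) ≤ (j • T).card := Nat.cast_nonneg _
    have hb' : ((2*(2^ν * (64*a^2)+1)*j : ℕ) : ℝ)^n * 4 ≤ 2^(64*a^2) := by exact_mod_cast hb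
    have hrat' : (((2^ν * (64*a^2)+1) • (j • T)).card : ℝ) ≤ ((2*(2^ν * (64*a^2)+1)*j : ℕ) : ℝ)^n * (j • T).card := by exact_mod_cast hrat
    have hdec := decay_num (2^ν) (64*a^2) Nat.one_le_two_pow
    have hp : (1/2:ℝ)^(64*a^2) * 2^(64*a^2) = 1 := by rw [← mul_pow]; norm_num
    calc _ ≤ 4 * (1/2)^(64*a^2) * (((2*(2^ν * (64*a^2)+1)*j : ℕ) : ℝ)^n * (j • T).card) := by gcongr
      _ = (1/2)^(64*a^2) * (((2*(2^ν * (64*a^2)+1)*j : ℕ) : ℝ)^n * 4) * (j • T).card := by ring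
      _ ≤ (1/2)^(64*a^2) * 2^(64*a^2) * (j • T).card := by gcongr
      _ = _ := by rw [hp, one_mul]

lemma find_j (T : Finset G) (h0 : 0 ∈ T) (n : ℕ) (hn : 2 ≤ n)
    (hgr : ∀ m, ((m+2) • T).card ≤ (2*m+1)^n * (2 • T).card) : 
    ∃ j, 2 ≤ j ∧ j ≤ 17*n^2 ∧ 4 * (j • T + T).card ≤ 5 * (j • T).card := by
  by_contra hcon
  push Not at hcon
  have hT : (0:ℝ) < (2 • T).card := by
    have : (2 • T).Nonempty := Finset.Nonempty.nsmul ⟨0, h0⟩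
    exact_mod_cast this.card_pos
  have hind : ∀ m ≤ 16*n^2, (5/4:ℝ)^m * (2 • T).card ≤ ((m+2) • T).card := by
    intro m
    induction m with
    | zero => intro _; simp
    | succ m ih =>
      intro hm
      have h1 := ih (by omega)
      have h2 := hcon (m+2) (by omega) (by nlinarith)
      rw [← succ_nsmul] at h2
      have h3 : (5:ℝ) * ((m+2) • T).card < 4 * ((m+2+1) • T).card := by exact_mod_cast h2
      rw [show m+1+2 = m+2+1 by ring, pow_succ]
      nlinarith
  have h1 := hind (16*n^2) le_rfl
  have h2 := hgr (16*n^2)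
  have h3 : (((16*n^2+2) • T).card : ℝ) ≤ ((2*(16*n^2)+1 : ℕ):ℝ)^n * (2 • T).card := by exact_mod_cast h2
  have h4 : (5/4:ℝ)^(16*n^2) ≤ ((2*(16*n^2)+1 : ℕ):ℝ)^n := le_of_mul_le_mul_right (h1.trans h3) hT
  have h5 : 2*(16*n^2)+1 ≤ 2^(5*n) := by
    have : ∀ n : ℕ, 2 ≤ n → 2*(16*n^2)+1 ≤ 2^(5*n) := by
      intro n hn
      induction n, hn using Nat.le_induction with
      | base => norm_num
      | succ k hk ih =>
        rw [show 5*(k+1) = 5*k+5 by ring, pow_add]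
        nlinarith
    exact this n hn
  have h6 : ((2*(16*n^2)+1 : ℕ):ℝ)^n ≤ (2:ℝ)^(5*n^2) := by
    calc ((2*(16*n^2)+1 : ℕ):ℝ)^n ≤ ((2:ℝ)^(5*n))^n := by gcongr; exact_mod_cast h5
      _ = _ := by rw [← pow_mul]; ring_nf
  have h7 : (2:ℝ)^(5*n^2) < (5/4:ℝ)^(16*n^2) := by
    rw [pow_mul, pow_mul]
    apply pow_lt_pow_left₀ (by norm_num) (by norm_num)
    positivity
  linarith

lemma char_sum_close (Γ : Finset (AddChar G ℂ)) (ε : AddChar G ℂ → ℤ) (hε : ∀ x, |ε x| ≤ 1) (t : G) (η : ℝ) (hη : 0 ≤ η)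
    (h : ∀ γ ∈ Γ, ‖1 - γ t‖ ≤ η) : ‖1 - (∑ γ ∈ Γ, ε γ • γ) t‖ ≤ Γ.card * η := by
  induction Γ using Finset.induction_on with
  | empty => simp
  | insert a s ha ih =>
    rw [sum_insert ha, card_insert_of_notMem ha, AddChar.add_apply]
    have e : (1:ℂ) - (ε a • a) t * (∑ γ ∈ s, ε γ • γ) t = (1 - (ε a • a) t) + (ε a • a) t * (1 - (∑ γ ∈ s, ε γ • γ) t) := by ring
    rw [e]
    refine (norm_add_le _ _).trans ?_
    rw [norm_mul, norm_char, one_mul]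
    have h1 := ih fun γ hγ => h γ (mem_insert_of_mem hγ)
    have h2 : ‖1 - (ε a • a) t‖ ≤ η := by
      have h3 := h a (mem_insert_self _ _)
      have : ε a = 0 ∨ ε a = 1 ∨ ε a = -1 := by
        have := abs_le.1 (hε a); omega
      rcases this with h4 | h4 | h4
      · rw [h4]; simp [hη]
      · rw [h4, one_smul]; exact h3
      · rw [h4, neg_one_smul, AddChar.neg_apply, char_neg_norm]; exact h3
    rw [Nat.cast_add, Nat.cast_one, add_mul, one_mul]
    linarith

lemma char_dist_add (γ γ' : AddChar G ℂ) (t : G) : ‖1 - (γ + γ') t‖ ≤ ‖1 - γ t‖ + ‖1 - γ' t‖ := by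
  rw [AddChar.add_apply]
  have e : (1:ℂ) - γ t * γ' t = (1 - γ t) + γ t * (1 - γ' t) := by ring
  rw [e]
  refine (norm_add_le _ _).trans ?_
  rw [norm_mul, norm_char, one_mul]

set_option maxHeartbeats 1000000 in
lemma freiman2 (A : Finset G) (κ : ℕ) (hκ : 1 ≤ κ) (hA : A.Nonempty) (h : (A - A).card ≤ 2^κ * A.card)
    (n J r R0 α α' β : ℕ) (hn : n = 2^29 * κ^4) (hJ : 17*n^2 ≤ 2^J)
    (hα' : n*(2*(r+5)+J+3) ≤ 2^α') (hR0 : n*(2*(r+5)+2*α'+8+J)+2 < R0) (hβ : R0 ≤ 2^β)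
    (hα : n*(2*β+3+J+3) ≤ 2^α) :
    ∃ Λ0 : Finset (AddChar G ℂ), (A - Bo Λ0 1).card ≤ 2^(n*(2*β+3+2*α+9+J)+5*κ) * A.card ∧
      A.card ≤ 2^(n + 2*R0*(β+r+4)) * (Bo Λ0 ((1/2)^r)).card := by
  obtain ⟨T0, hT0A, hT0c, hg1, hg2⟩ := freiman1 A κ hκ hA h n hn
  have hT0ne : T0.Nonempty := by
    rw [← card_pos]
    by_contra hc
    have : T0.card = 0 := by omega
    rw [this, mul_zero] at hT0c
    have := hA.card_pos
    omega
  set T := T0 - T0 with hT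
  have h0 : (0:G) ∈ T := by
    obtain ⟨x, hx⟩ := hT0ne
    exact mem_sub.2 ⟨x, hx, x, hx, sub_self _⟩
  have hs : ∀ t ∈ T, -t ∈ T := by
    intro t ht
    obtain ⟨x, hx, y, hy, rfl⟩ := mem_sub.1 ht
    exact mem_sub.2 ⟨y, hy, x, hx, by abel⟩
  have hn2 : 2 ≤ n := by
    rw [hn]
    have : 1 ≤ κ^4 := Nat.one_le_pow _ _ hκ
    omega
  obtain ⟨j, hj2, hjn, hjT⟩ := find_j T h0 n hn2 hg2
  have hjJ := hjn.trans hJ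
  set X := j • T with hX
  have hXne : X.Nonempty := Finset.Nonempty.nsmul ⟨0, h0⟩
  -- the fine spectrum
  obtain ⟨L', hL'1, hL'2⟩ := spec_num T h0 n (by omega) hg2 j J (2*(r+5)) α' hj2 hjJ hα'
  set τ' : ℝ := 1/((2^(2*(r+5)):ℕ):ℝ) with hτ'
  have hτ'1 : τ' ≤ 1/8 := by
    rw [hτ']
    apply one_div_le_one_div_of_le (by norm_num)
    have : 2^3 ≤ 2^(2*(r+5)) := Nat.pow_le_pow_right (by norm_num) (by omega)
    exact_mod_cast this
  set Λ' := univ.filter fun γ => dd X γ ≤ τ' with hΛ'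
  obtain ⟨-, hG⟩ := spec_main X hXne L' τ' (by linarith) hL'2 Λ' hΛ'
  have hr' := ratio_num T h0 n hg2 j hj2 L'
  have hτ'0 : 0 < τ' := by rw [hτ']; positivity
  have hΛ'ne : Λ'.Nonempty := by
    refine ⟨0, mem_filter.2 ⟨mem_univ _, ?_⟩⟩
    simp [dd]; exact hτ'0.le
  -- the coarse spectrum
  obtain ⟨L, hL1, hL2⟩ := spec_num T h0 n (by omega) hg2 j J (2*β+3) α hj2 hjJ hα
  set τ : ℝ := 1/((2^(2*β+3):ℕ):ℝ) with hτ
  have hτ0 : 0 < τ := by rw [hτ]; positivity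
  have hτR : (R0:ℝ) * (R0 * τ) ≤ 1/8 := by
    have e1 : (R0:ℝ) ≤ 2^β := by exact_mod_cast hβ
    have e2 : τ = 1/(8*(2^β*2^β)) := by
      rw [hτ]; push_cast; rw [show 2*β+3 = β+β+3 by ring, pow_add, pow_add]; congr 1; ring
    calc (R0:ℝ) * (R0 * τ) ≤ 2^β * (2^β * τ) := by gcongr
      _ = 1/8 := by rw [e2]; field_simp
  have hτ1 : τ ≤ 1 := by
    rw [hτ]
    apply div_le_one_of_le₀ _ (by positivity)
    exact_mod_cast Nat.one_le_two_pow
  set Λ := univ.filter fun γ => dd X γ ≤ τ with hΛ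
  obtain ⟨hBo, -⟩ := spec_main X hXne L τ hτ1 hL2 Λ hΛ
  refine ⟨Λ, ?_, ?_⟩
  · have hneg : ∀ i : ℕ, ∀ t ∈ i • T, -t ∈ i • T := by
      intro i
      induction i with
      | zero =>
        intro t ht
        rw [zero_nsmul] at ht ⊢
        rw [Finset.mem_zero] at ht ⊢
        rw [ht, neg_zero]
      | succ i ihi =>
        intro t ht
        rw [succ_nsmul] at ht ⊢
        obtain ⟨u, hu, v, hv, rfl⟩ := mem_add.1 ht
        exact mem_add.2 ⟨-u, ihi u hu, -v, hs v hv, by abel⟩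
    have hX2 : A - Bo Λ 1 ⊆ A + (2*((L+1)*j)) • T := by
      intro x hx
      obtain ⟨a, ha, b, hb, rfl⟩ := mem_sub.1 hx
      obtain ⟨u, hu, v, hv, rfl⟩ := mem_sub.1 (hBo hb)
      rw [hX, ← mul_nsmul, mul_comm] at hu hv
      refine mem_add.2 ⟨a, ha, v + -u, ?_, by abel⟩
      rw [two_mul, add_nsmul]
      exact add_mem_add hv (hneg _ _ hu)
    obtain ⟨m, hm⟩ : ∃ m, 2*((L+1)*j) = m + 2 := ⟨2*((L+1)*j) - 2, by
      have : 1 * 2 ≤ (L+1) * j := Nat.mul_le_mul (by omega) hj2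
      omega⟩
    rw [hm] at hX2
    have e1 : 2*m+1 ≤ 2^(2*β+3+2*α+9+J) := by
      calc 2*m+1 ≤ 2*(2*((L+1)*j)) := by omega
        _ ≤ 2*(2*(2^(2*β+3+2*α+7)*2^J)) := by gcongr
        _ = _ := by rw [show 2*β+3+2*α+9+J = (2*β+3+2*α+7)+(J+2) by ring, pow_add 2 (2*β+3+2*α+7) (J+2), pow_add 2 J 2]; ring
    calc _ ≤ _ := card_le_card hX2
      _ ≤ (2*m+1)^n * (2^(5*κ) * A.card) := hg1 m
      _ ≤ (2^(2*β+3+2*α+9+J))^n * (2^(5*κ) * A.card) := by gcongr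
      _ = _ := by rw [← pow_mul, mul_comm _ n, pow_add]; ring
  · -- dual covering
    obtain ⟨Γ, hΓΛ, hΓc, hcov⟩ := chang_cover Λ Λ' hΛ'ne R0 (by
      intro Γ hΓ hcard hdiss
      set U := univ.filter fun γ : AddChar G ℂ => dd X γ ≤ 1/2 with hU
      have h1 := diss_card Λ' Γ U hdiss (by
        intro S hS d hd
        rw [hU, mem_filter]
        refine ⟨mem_univ _, (dd_add X _ _).trans ?_⟩
        have h2 := dd_sum X S
        have h3 : ∑ γ ∈ S, dd X γ ≤ S.card * τ := by
          rw [← nsmul_eq_mul, ← sum_const]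
          exact sum_le_sum fun γ hγ => (mem_filter.1 (hΓ (hS hγ))).2
        have h4 : (S.card : ℝ) ≤ R0 := by
          rw [← hcard]; exact_mod_cast card_le_card hS
        have h5 : dd X (∑ γ ∈ S, γ) ≤ R0 * (R0 * τ) := by
          calc _ ≤ _ := h2
            _ ≤ (S.card : ℝ) * (S.card * τ) := by gcongr
            _ ≤ _ := by gcongr
        have h6 := (mem_filter.1 hd).2
        linarith)
      have h2 := spec_half X hXne U fun γ hγ => (mem_filter.1 hγ).2
      rw [hcard] at h1
      have h3 : (2*(L'+1)*j)^n ≤ 2^(n*(2*(r+5)+2*α'+8+J)) := by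
        calc (2*(L'+1)*j)^n ≤ (2*2^(2*(r+5)+2*α'+7)*2^J)^n := by gcongr
          _ = (2^(2*(r+5)+2*α'+8+J))^n := by
            rw [show 2*(r+5)+2*α'+8+J = (2*(r+5)+2*α'+7)+1+J by ring, pow_add _ _ J, pow_add _ _ 1]; ring
          _ = _ := by rw [← pow_mul, mul_comm n]
      have h4 : 2^R0 * (Λ'.card * X.card) ≤ 2^(n*(2*(r+5)+2*α'+8+J)+2) * (Λ'.card * X.card) := by
        calc _ = 2^R0 * Λ'.card * X.card := by ring
          _ ≤ U.card * X.card := by gcongr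
          _ ≤ 2 * Fintype.card G := h2
          _ ≤ 2 * (2 * ((L'+1) • X).card * Λ'.card) := by gcongr
          _ ≤ 2 * (2 * ((2*(L'+1)*j)^n * X.card) * Λ'.card) := by gcongr
          _ ≤ 2 * (2 * (2^(n*(2*(r+5)+2*α'+8+J)) * X.card) * Λ'.card) := by gcongr
          _ = _ := by rw [pow_add]; ring
      have h5 := Nat.le_of_mul_le_mul_right h4 (Nat.mul_pos hΛ'ne.card_pos hXne.card_pos)
      exact absurd h5 (not_le.2 (Nat.pow_lt_pow_right (by norm_num) hR0)))
    have hR00 : 0 < R0 := by omega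
    obtain ⟨T1, hT1, hT1c, hT1d⟩ := cell_exists T0 Γ (4*R0*2^r) (Nat.one_le_iff_ne_zero.2 (by positivity))
    have hsub : T1.card ≤ (Bo Λ ((1/2)^r)).card := by
      apply card_le_Bo_of_sub
      intro t ht t' ht' 
      intro γ hγ
      obtain ⟨ε, hε, d, hd, d', hd', rfl⟩ := hcov γ hγ
      have htT : t - t' ∈ T := sub_mem_sub (hT1 ht) (hT1 ht')
      have hclose : ∀ d ∈ Λ', ‖1 - d (t - t')‖ ≤ 6 * (1/2)^(r+5) := by
        intro d hd
        apply spec_close X T hXne h0 hs hjT d _ (by positivity) _ _ htT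
        refine (mem_filter.1 hd).2.trans (le_of_eq ?_)
        rw [hτ', ← pow_mul, one_div_pow]; push_cast; rw [mul_comm 2]
      have k1 := hclose d hd
      have k2 := hclose d' hd'
      have hm0 : (0:ℝ) < ((4*R0*2^r : ℕ):ℝ) := by exact_mod_cast (by positivity : 0 < 4*R0*2^r)
      have k3 := char_sum_close Γ ε hε (t - t') (2/((4*R0*2^r : ℕ):ℝ)) (by positivity) (by
        intro γ hγ
        rw [char_sub_norm]
        exact hT1d t ht t' ht' γ hγ)
      have k4 : (Γ.card : ℝ) * (2/((4*R0*2^r : ℕ):ℝ)) ≤ (1/2)^r / 2 := by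
        have : (Γ.card : ℝ) ≤ R0 := by exact_mod_cast hΓc.le
        have hR : (0:ℝ) < R0 := by exact_mod_cast hR00
        calc _ ≤ (R0:ℝ) * (2/((4*R0*2^r : ℕ):ℝ)) := by gcongr
          _ = _ := by push_cast; rw [one_div_pow]; field_simp; norm_num
      have t1 := char_dist_add (∑ x ∈ Γ, ε x • x + d) (-d') (t - t')
      have t2 := char_dist_add (∑ x ∈ Γ, ε x • x) d (t - t')
      rw [AddChar.neg_apply, char_neg_norm] at t1
      have : (6:ℝ) * (1/2)^(r+5) ≤ (1/2)^r / 4 := by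
        rw [pow_add]
        have : (0:ℝ) < (1/2)^r := by positivity
        nlinarith
      rw [← char_sub_norm, sub_eq_add_neg (∑ x ∈ Γ, ε x • x + d) d']
      linarith
    have e1 : 2*(4*R0*2^r)+1 ≤ 2^(β+r+4) := by
      have : 1 ≤ R0 * 2^r := Nat.one_le_iff_ne_zero.2 (by positivity)
      calc 2*(4*R0*2^r)+1 ≤ 16 * (R0 * 2^r) := by nlinarith
        _ ≤ 16 * (2^β * 2^r) := by gcongr
        _ = _ := by rw [pow_add, pow_add]; ring
    calc A.card ≤ 2^n * T0.card := hT0c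
      _ ≤ 2^n * ((2*(4*R0*2^r)+1)^(2*Γ.card) * T1.card) := by gcongr
      _ ≤ 2^n * ((2*(4*R0*2^r)+1)^(2*R0) * T1.card) := by gcongr; omega
      _ ≤ 2^n * ((2^(β+r+4))^(2*R0) * (Bo Λ ((1/2)^r)).card) := by gcongr
      _ = _ := by rw [← pow_mul, mul_comm (β+r+4), pow_add]; ring

/-- Numerical form of the Freiman-type theorem. -/
lemma freiman3 (A : Finset G) (κ r l : ℕ) (hκ : 1 ≤ κ) (hl : 1 ≤ l) (hκl : κ ≤ 2^l) (hrl : r ≤ 2^l)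
    (hA : A.Nonempty) (h : (A - A).card ≤ 2^κ * A.card) :
    ∃ Λ0 : Finset (AddChar G ℂ), (A - Bo Λ0 1).card ≤ 2^(2^38*κ^4*l) * A.card ∧
      A.card ≤ 2^(2^45*κ^4*(r+l)^2) * (Bo Λ0 ((1/2)^r)).card := by
  have hk4 : 1 ≤ κ^4 := Nat.one_le_pow _ _ hκ
  have hk4' : κ^4 ≤ 2^(4*l) := by
    rw [mul_comm, pow_mul]; exact Nat.pow_le_pow_left hκl 4
  have hll : l ≤ 2^l := Nat.lt_two_pow_self.le
  have hkk : κ ≤ κ^4 := Nat.le_self_pow (by norm_num) κ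
  obtain ⟨q, hq⟩ : ∃ q, q = κ^4 := ⟨_, rfl⟩
  obtain ⟨Λ0, h1, h2⟩ := freiman2 A κ hκ hA h (2^29*κ^4) (63+8*l) r (2^37*κ^4*(r+l)) (37+5*l) (37+5*l) (38+5*l) rfl
    (by
      have : (κ^4)^2 ≤ (2^(4*l))^2 := Nat.pow_le_pow_left hk4' 2
      calc 17*(2^29*κ^4)^2 = 17*2^58*(κ^4)^2 := by ring
        _ ≤ 2^63 * (2^(4*l))^2 := Nat.mul_le_mul (by norm_num) this
        _ = _ := by rw [← pow_mul, ← pow_add]; congr 1; ring)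
    (by
      calc 2^29*κ^4*(2*(r+5)+(63+8*l)+3) ≤ 2^29*2^(4*l)*(2^8*2^l) := by gcongr; omega
        _ = _ := by rw [show 37+5*l = 29+4*l+(8+l) by ring, pow_add _ (29+4*l), pow_add, pow_add])
    (by
      rw [← hq] at hk4 ⊢
      have : 1 ≤ q * l := Nat.mul_pos hk4 hl
      nlinarith [Nat.zero_le (q*r), this])
    (by
      calc 2^37*κ^4*(r+l) ≤ 2^37*2^(4*l)*(2^l+2^l) := by gcongr
        _ = _ := by rw [show 38+5*l = 37+4*l+(1+l) by ring, pow_add _ (37+4*l), pow_add, pow_add]; ring)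
    (by
      calc 2^29*κ^4*(2*(38+5*l)+3+(63+8*l)+3) ≤ 2^29*2^(4*l)*(2^8*2^l) := by gcongr; omega
        _ = _ := by rw [show 37+5*l = 29+4*l+(8+l) by ring, pow_add _ (29+4*l), pow_add, pow_add])
  refine ⟨Λ0, h1.trans ?_, h2.trans ?_⟩
  · gcongr 2^?_ * _
    · norm_num
    rw [← hq] at hk4 hkk ⊢
    have : q ≤ q * l := Nat.le_mul_of_pos_right _ hl
    nlinarith
  · gcongr 2^?_ * _
    · norm_num
    rw [← hq] at hk4 hkk ⊢
    obtain ⟨s, hs⟩ : ∃ s, s = r + l := ⟨_, rfl⟩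
    have e1 : 38+5*l+r+4 ≤ 2^6 * s := by omega
    have e2 : 1 ≤ s := by omega
    rw [← hs]
    calc 2^29*q + 2*(2^37*q*s)*(38+5*l+r+4) ≤ 2^29*q*(s*s) + 2*(2^37*q*s)*(2^6*s) := by
          apply Nat.add_le_add
          · exact Nat.le_mul_of_pos_right _ (Nat.mul_pos e2 e2)
          · gcongr
      _ ≤ 2^45*q*s^2 := by nlinarith [Nat.zero_le (q*s*s)]

end P13

section P14
open scoped Classical
open Finset
variable {G : Type} [AddCommGroup G] [Fintype G]

lemma pop (A T : Finset G) (hA : A.Nonempty) (hT : T.Nonempty) :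
    ∃ x0, A.card * T.card ≤ (A - T).card * (T.filter fun s => x0 + s ∈ A).card := by
  by_contra! hcon
  have h1 : A.card * T.card ≤ ∑ x ∈ A - T, (T.filter fun s => x + s ∈ A).card := by
    have e : ∑ x ∈ A - T, (T.filter fun s => x + s ∈ A).card
        = ∑ s ∈ T, ((A - T).filter fun x => x + s ∈ A).card := by
      simp only [card_filter]
      rw [sum_comm]
    rw [e, mul_comm, ← smul_eq_mul, ← sum_const]
    refine sum_le_sum fun s hs => ?_
    apply card_le_card_of_injOn (fun a => a - s)
    · intro a ha
      simp only [coe_filter, Set.mem_ofPred_eq]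
      exact ⟨sub_mem_sub ha hs, by simpa using ha⟩
    · intro a _ b _ hab
      simpa using hab
  have hne : (A - T).Nonempty := hA.sub hT
  have h2 : (A - T).card * ∑ x ∈ A - T, (T.filter fun s => x + s ∈ A).card
      < (A - T).card * (A.card * T.card) := by
    rw [mul_sum]
    calc _ < ∑ x ∈ A - T, A.card * T.card := sum_lt_sum_of_nonempty hne fun x _ => hcon x
      _ = _ := by rw [sum_const, smul_eq_mul]
  have h3 := Nat.mul_le_mul_left (A - T).card h1
  omega

lemma core_bsg (c : AddChar G ℂ → ℂ) (F : G → ℤ) (M ℓ : ℕ) (hM : 1 ≤ M) (hℓ : 1 ≤ ℓ) (hMℓ : M ≤ 2 ^ ℓ)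
    (hcF : ∀ γ, c γ = 0 ∨ c γ = fourierCoeff (fun x => (F x : ℂ)) γ)
    (hc : ∑ γ, ‖c γ‖ ≤ M) (hF : ∀ x, ‖gfun c x - F x‖ ≤ 1/16) (A : Finset G)
    (hA : A = univ.filter fun x => F x ≠ 0) (hne : A.Nonempty) :
    ∃ A' ⊆ A, A'.Nonempty ∧ A.card ≤ 2^(16*ℓ) * A'.card ∧ (A' - A').card ≤ 2^(2^8*ℓ) * A'.card := by
  have h1 := energy_lower c F M hM hcF hc hF A hA
  have hM' : (1:ℝ) ≤ M := by exact_mod_cast hM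
  have hMr : (M:ℝ) ≤ 2^ℓ := by exact_mod_cast hMℓ
  have hM1 : (M:ℝ) + 1 ≤ 2^(ℓ+1) := by rw [pow_succ]; linarith
  have hK1 : (1:ℝ) ≤ 8 * M^2 * (M+1)^4 := by
    have e1 : (1:ℝ) ≤ (M:ℝ)^2 := one_le_pow₀ hM'
    have e2 : (1:ℝ) ≤ ((M:ℝ)+1)^4 := one_le_pow₀ (by linarith)
    nlinarith
  have hK2 : (8:ℝ) * M^2 * (M+1)^4 ≤ 2^(6*ℓ+7) := by
    calc (8:ℝ) * M^2 * (M+1)^4 ≤ 8 * (2^ℓ)^2 * (2^(ℓ+1))^4 := by gcongr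
      _ = _ := by rw [← pow_mul, ← pow_mul, show (8:ℝ) = 2^3 by norm_num, ← pow_add, ← pow_add]; congr 1; ring
  obtain ⟨A', hs, hn, h2, h3⟩ := bsg A _ hK1 hne h1
  refine ⟨A', hs, hn, ?_, ?_⟩
  · have : (A.card : ℝ) ≤ 2^(16*ℓ) * A'.card := by
      refine h2.trans ?_
      gcongr
      calc (8:ℝ) * (8 * M^2 * (M+1)^4) ≤ 2^3 * 2^(6*ℓ+7) := by 
            have : (8:ℝ) = 2^3 := by norm_num
            nlinarith
        _ = 2^(3+(6*ℓ+7)) := by rw [← pow_add]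
        _ ≤ _ := pow_le_pow_right₀ (by norm_num) (by omega)
    exact_mod_cast this
  · have : ((A' - A').card : ℝ) ≤ 2^(2^8*ℓ) * A'.card := by
      refine h3.trans ?_
      gcongr
      calc (2:ℝ)^24 * (8 * M^2 * (M+1)^4)^10 ≤ 2^24 * (2^(6*ℓ+7))^10 := by gcongr
        _ = 2^(24+(6*ℓ+7)*10) := by rw [← pow_mul, ← pow_add]
        _ ≤ _ := pow_le_pow_right₀ (by norm_num) (by omega)
    exact_mod_cast this

lemma Bo_union_card' (Λ Γ : Finset (AddChar G ℂ)) (r N : ℕ) (hr : r + 4 ≤ N) :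
    (Bo Λ ((1/2)^N)).card ≤ 2^(N*(2*Γ.card)) * (Bo (Λ ∪ Γ) ((1/2)^(r+1))).card := by
  have h := Bo_union_card Λ Γ (2^(r+2)) Nat.one_le_two_pow
  have e1 : (1:ℝ)/((2^(r+2):ℕ):ℝ) = (1/2)^(r+2) := by push_cast; rw [one_div_pow]
  have e2 : (2:ℝ)/((2^(r+2):ℕ):ℝ) = (1/2)^(r+1) := by push_cast; rw [one_div_pow, pow_succ 2 (r+1)]; field_simp
  rw [e1, e2] at h
  have h1 : (Bo Λ ((1/2)^N)).card ≤ (Bo Λ ((1/2)^(r+2))).card :=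
    card_le_card (Bo_mono (Finset.Subset.refl _) (pow_le_pow_of_le_one (by norm_num) (by norm_num) (by omega)))
  refine h1.trans (h.trans ?_)
  rw [pow_mul 2 N]
  apply Nat.mul_le_mul_right
  apply Nat.pow_le_pow_left
  calc 2 * 2^(r+2) + 1 ≤ 2^(r+4) := by
        have : 1 ≤ 2^(r+2) := Nat.one_le_two_pow
        rw [show r+4 = r+2+2 by ring, pow_add _ (r+2)]; omega
    _ ≤ _ := Nat.pow_le_pow_right (by norm_num) hr

lemma num_s (M ℓ : ℕ) (hℓ : 1 ≤ ℓ) : 64*(ℓ+4)*M ≤ 2^9*ℓ*M := by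
  apply Nat.mul_le_mul_right; omega

lemma num_r (M ℓ : ℕ) (hM : 1 ≤ M) (hℓ : 1 ≤ ℓ) :
    2*(2^8*ℓ)*(64*(ℓ+4)*M) + 2^8*ℓ + 4 ≤ 2^19*ℓ^2*M := by
  have h := num_s M ℓ hℓ
  have h1 : 1 ≤ ℓ*M := Nat.mul_pos hℓ hM
  have h2 : ℓ ≤ ℓ*(ℓ*M) := Nat.le_mul_of_pos_right _ h1
  calc 2*(2^8*ℓ)*(64*(ℓ+4)*M) + 2^8*ℓ + 4 ≤ 2*(2^8*ℓ)*(2^9*ℓ*M) + 2^8*(ℓ*(ℓ*M)) + 4*(ℓ*(ℓ*M)) := by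
        gcongr
        · nlinarith
    _ ≤ _ := by nlinarith [Nat.zero_le (ℓ*(ℓ*M))]

lemma num_K (M ℓ : ℕ) (hM : 1 ≤ M) (hℓ : 1 ≤ ℓ) (hMℓ : M ≤ 2^ℓ) :
    2^76*ℓ^5 + 2^117*ℓ^8*M^2 + 2^19*ℓ^2*M*(2*(2^16*((2^77*ℓ^5+2^5*M)+ℓ+12)*((64*(ℓ+4)*M)^2+4^(ℓ+3)))) ≤ 2^(137+13*ℓ) := by
  have hll : ℓ ≤ 2^ℓ := Nat.lt_two_pow_self.le
  have hs := num_s M ℓ hℓ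
  obtain ⟨p, hp⟩ : ∃ p, p = 2^ℓ := ⟨_, rfl⟩
  have hp1 : 1 ≤ p := by rw [hp]; exact Nat.one_le_two_pow
  rw [← hp] at hll hMℓ
  have e4 : 4^(ℓ+3) = 64*p^2 := by
    rw [hp, show 4 = 2^2 by norm_num, ← pow_mul, ← pow_mul, show 2*(ℓ+3) = ℓ*2+6 by ring, pow_add]; ring
  have e5 : 2^(137+13*ℓ) = 2^137*p^13 := by
    rw [hp, pow_add, ← pow_mul, mul_comm 13]
  rw [e4, e5]
  have a1 : 2^76*ℓ^5 ≤ 2^76*p^13 := by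
    calc 2^76*ℓ^5 ≤ 2^76*p^5 := by gcongr
      _ ≤ _ := by gcongr; norm_num
  have a2 : 2^117*ℓ^8*M^2 ≤ 2^117*p^13 := by
    calc 2^117*ℓ^8*M^2 ≤ 2^117*p^8*p^2 := by gcongr
      _ = 2^117*p^10 := by ring
      _ ≤ _ := by gcongr; norm_num
  have a3 : (64*(ℓ+4)*M)^2+64*p^2 ≤ 2^19*p^4 := by
    calc (64*(ℓ+4)*M)^2+64*p^2 ≤ (2^9*p*p)^2 + 64*p^4 := by
          apply Nat.add_le_add
          · apply Nat.pow_le_pow_left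
            exact hs.trans (by gcongr)
          · gcongr; norm_num
      _ ≤ _ := by nlinarith [Nat.zero_le (p^4)]
  have a4 : (2^77*ℓ^5+2^5*M)+ℓ+12 ≤ 2^78*p^5 := by
    have b1 : p ≤ p^5 := Nat.le_self_pow (by norm_num) p
    have b2 : ℓ^5 ≤ p^5 := by gcongr
    have b3 : M ≤ p^5 := hMℓ.trans b1
    have b4 : ℓ ≤ p^5 := hll.trans b1
    have b5 : 1 ≤ p^5 := hp1.trans b1
    omega
  have a5 : 2^19*ℓ^2*M*(2*(2^16*((2^77*ℓ^5+2^5*M)+ℓ+12)*((64*(ℓ+4)*M)^2+64*p^2))) ≤ 2^133*p^13 := by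
    calc _ ≤ 2^19*p^2*p*(2*(2^16*(2^78*p^5)*(2^19*p^4))) := by gcongr
      _ = 2^133*p^12 := by ring
      _ ≤ _ := by gcongr; norm_num
  have a6 : 0 ≤ p^13 := Nat.zero_le _
  omega

lemma num_fin (M ℓ : ℕ) (hM : 1 ≤ M) (hℓ : 1 ≤ ℓ) (hℓM : ℓ ≤ 2*M) :
    (ℓ+3) + 16*ℓ + 2^117*ℓ^8*M^2 + 2^19*ℓ^2*M*(2*(2^16*((2^77*ℓ^5+2^5*M)+ℓ+12)*(64*(ℓ+4)*M)^2)) ≤ 2^136*ℓ^8*M^4 := by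
  have hs := num_s M ℓ hℓ
  have h1 : (2^77*ℓ^5+2^5*M)+ℓ+12 ≤ 2^79*(ℓ^4*M) := by
    have b1 : ℓ^5 ≤ 2*(ℓ^4*M) := by
      calc ℓ^5 = ℓ^4*ℓ := by ring
        _ ≤ ℓ^4*(2*M) := by gcongr
        _ = _ := by ring
    have b2 : M ≤ ℓ^4*M := Nat.le_mul_of_pos_left _ (by positivity)
    omega
  have h2 : 2^19*ℓ^2*M*(2*(2^16*((2^77*ℓ^5+2^5*M)+ℓ+12)*(64*(ℓ+4)*M)^2)) ≤ 2^133*(ℓ^8*M^4) := by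
    calc _ ≤ 2^19*ℓ^2*M*(2*(2^16*(2^79*(ℓ^4*M))*(2^9*ℓ*M)^2)) := by gcongr
      _ = _ := by ring
  have h3 : 2^117*ℓ^8*M^2 ≤ 2^117*(ℓ^8*M^4) := by
    rw [mul_assoc]; gcongr; norm_num
  have h4 : ℓ ≤ ℓ^8*M^4 := by
    calc ℓ ≤ ℓ^8 := Nat.le_self_pow (by norm_num) ℓ
      _ ≤ _ := Nat.le_mul_of_pos_right _ (by positivity)
  rw [mul_assoc (2^136)]
  omega

set_option maxHeartbeats 1000000 in
lemma core (c : AddChar G ℂ → ℂ) (F : G → ℤ) (M ℓ : ℕ) (ε : ℝ) (hM : 1 ≤ M) (hℓ : 1 ≤ ℓ) (hMℓ : M ≤ 2 ^ ℓ)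
    (hℓM : ℓ ≤ 2*M) (hcF : ∀ γ, c γ = 0 ∨ c γ = fourierCoeff (fun x => (F x : ℂ)) γ)
    (hc : ∑ γ, ‖c γ‖ ≤ M) (hε : ε ≤ 1/16) (hF : ∀ x, ‖gfun c x - F x‖ ≤ ε) (hne : ∃ x, F x ≠ 0) :
    ∃ (H : AddSubgroup G) (R : G → ℤ), (∀ x, ∀ h ∈ H, R (x + h) = R x) ∧
      (∀ x, ‖(1 / (Hf H).card : ℂ) * ∑ h ∈ Hf H, gfun c (x + h) - R x‖ ≤ ε + (1/2)^(4*M+4)) ∧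
      (∑ x, |R x| : ℤ) ≤ 2^(2^136*ℓ^8*M^4) * (Hf H).card ∧ ∃ x0, R x0 ≠ 0 := by
  have hF' : ∀ x, ‖gfun c x - F x‖ ≤ 1/16 := fun x => (hF x).trans hε
  obtain ⟨A, hA⟩ : ∃ A : Finset G, A = univ.filter fun x => F x ≠ 0 := ⟨_, rfl⟩
  have hAne : A.Nonempty := by
    obtain ⟨x, hx⟩ := hne
    exact ⟨x, by rw [hA]; simp [hx]⟩
  obtain ⟨A', hA'A, hA'ne, hAA', hdoub⟩ := core_bsg c F M ℓ hM hℓ hMℓ hcF hc hF' A hA hAne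
  have hll : ℓ ≤ 2^ℓ := Nat.lt_two_pow_self.le
  obtain ⟨N, hN⟩ : ∃ N, N = 2^19*ℓ^2*M := ⟨_, rfl⟩
  obtain ⟨a, ha⟩ : ∃ a, a = 2^77*ℓ^5+2^5*M := ⟨_, rfl⟩
  obtain ⟨K1, hK1⟩ : ∃ K1, K1 = 2^76*ℓ^5 := ⟨_, rfl⟩
  obtain ⟨K2, hK2⟩ : ∃ K2, K2 = 2^117*ℓ^8*M^2 := ⟨_, rfl⟩
  have hℓ5 : 1 ≤ ℓ^5 := Nat.one_le_pow _ _ hℓ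
  obtain ⟨Λ0, hL1', hL2'⟩ := freiman3 A' (2^8*ℓ) N (2^6*ℓ) (by omega) (by omega)
    (by
      calc 2^8*ℓ ≤ 2^8*2^ℓ := by gcongr
        _ = 2^(8+ℓ) := by rw [pow_add]
        _ ≤ _ := Nat.pow_le_pow_right (by norm_num) (by omega))
    (by
      calc N ≤ 2^19*(2^ℓ)^2*2^ℓ := by rw [hN]; gcongr
        _ = 2^(19+3*ℓ) := by rw [pow_add, ← pow_mul, mul_assoc, ← pow_add]; congr 2; ring
        _ ≤ _ := Nat.pow_le_pow_right (by norm_num) (by omega)) hA'ne hdoub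
  have hL1 : (A' - Bo Λ0 1).card ≤ 2^K1 * A'.card := by
    refine hL1'.trans (le_of_eq ?_)
    rw [hK1]; congr 2; ring
  have hL2 : A'.card ≤ 2^K2 * (Bo Λ0 ((1/2)^N)).card := by
    refine hL2'.trans ?_
    apply Nat.mul_le_mul_right
    apply Nat.pow_le_pow_right (by norm_num)
    have : N + 2^6*ℓ ≤ 2^20*ℓ^2*M := by
      have h1 : ℓ ≤ ℓ^2*M := by
        calc ℓ ≤ ℓ^2 := Nat.le_self_pow (by norm_num) ℓ
          _ ≤ _ := Nat.le_mul_of_pos_right _ hM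
      rw [hN, mul_assoc, mul_assoc]; omega
    calc 2^45*(2^8*ℓ)^4*(N+2^6*ℓ)^2 ≤ 2^45*(2^8*ℓ)^4*(2^20*ℓ^2*M)^2 := by gcongr
      _ = K2 := by rw [hK2]; ring
  clear hL1' hL2'
  have hnr := num_r M ℓ hM hℓ
  have hnK := num_K M ℓ hM hℓ hMℓ
  have hnf := num_fin M ℓ hM hℓ hℓM
  rw [← hN] at hnr
  rw [← hN, ← ha, ← hK1, ← hK2] at hnK
  rw [← hN, ← ha, ← hK2] at hnf
  obtain ⟨Γ, r, ρ, hΓ, hr, hρ1, hρ2, hgood⟩ := iterate c F M ℓ a hM hMℓ hc hF' Λ0 (2^(137+13*ℓ)) (2^8*ℓ)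
    (by
      have : 1 ≤ 2^(137+13*ℓ) := Nat.one_le_two_pow
      calc 2*(128*M)*(2^(137+13*ℓ)+1) ≤ 2*(128*2^ℓ)*(2^(137+13*ℓ)+2^(137+13*ℓ)) := by gcongr
        _ = 2^(ℓ+(137+13*ℓ)+9) := by rw [pow_add, pow_add]; ring
        _ ≤ _ := Nat.pow_le_pow_right (by norm_num) (by omega))
    (by omega)
    (by
      intro Γ r hΓ hr
      have h1 : (Bo (Λ0 ∪ Γ) ((1/2)^r)).card ≤ (Bo Λ0 1).card :=
        card_le_card (Bo_mono subset_union_left (pow_le_one₀ (by norm_num) (by norm_num)))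
      have h2 : (Bo Λ0 1).card ≤ (A' - Bo Λ0 1).card := card_le_card_sub_left hA'ne
      have h3 := Bo_union_card' Λ0 Γ r N (by omega)
      calc _ ≤ 2^K1 * (2^K2 * (2^(N*(2*Γ.card)) * (Bo (Λ0 ∪ Γ) ((1/2)^(r+1))).card)) :=
            h1.trans (h2.trans (hL1.trans (Nat.mul_le_mul_left _ (hL2.trans (Nat.mul_le_mul_left _ h3)))))
        _ = 2^(K1+K2+N*(2*Γ.card)) * (Bo (Λ0 ∪ Γ) ((1/2)^(r+1))).card := by rw [pow_add, pow_add]; ring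
        _ ≤ _ := by
          apply Nat.mul_le_mul_right
          apply Nat.pow_le_pow_right (by norm_num)
          refine le_trans ?_ hnK
          gcongr)
  obtain ⟨T, hT⟩ : ∃ T, T = Bo (Λ0 ∪ Γ) ρ := ⟨_, rfl⟩
  rw [← hT] at hgood
  have hT1 : T ⊆ Bo Λ0 1 := by
    rw [hT]
    exact Bo_mono subset_union_left (hρ2.trans (pow_le_one₀ (by norm_num) (by norm_num)))
  have hTne : T.Nonempty := by
    refine ⟨0, ?_⟩
    rw [hT]
    exact Bo_zero_mem _ (le_trans (by positivity) hρ1)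
  have hTcard : (Bo Λ0 ((1/2)^N)).card ≤ 2^(N*(2*(2^16*(a+ℓ+12)*(64*(ℓ+4)*M)^2))) * T.card := by
    have h3 := Bo_union_card' Λ0 Γ r N (by omega)
    have h4 : (Bo (Λ0 ∪ Γ) ((1/2)^(r+1))).card ≤ T.card := by
      rw [hT]; exact card_le_card (Bo_mono (Finset.Subset.refl _) hρ1)
    refine h3.trans (Nat.mul_le_mul (Nat.pow_le_pow_right (by norm_num) ?_) h4)
    gcongr
  obtain ⟨x0, hx0⟩ := pop A' T hA'ne hTne
  have hx1 : T.card ≤ 2^K1 * (T.filter fun s => x0 + s ∈ A').card := by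
    have h1 : (A' - T).card ≤ 2^K1 * A'.card := (card_le_card (sub_subset_sub_left hT1)).trans hL1
    have h2 : A'.card * T.card ≤ A'.card * (2^K1 * (T.filter fun s => x0 + s ∈ A').card) := by
      calc _ ≤ _ := hx0
        _ ≤ 2^K1 * A'.card * (T.filter fun s => x0 + s ∈ A').card := Nat.mul_le_mul_right _ h1
        _ = _ := by ring
    exact Nat.le_of_mul_le_mul_left h2 hA'ne.card_pos
  have hx2 : (T.filter fun s => x0 + s ∈ A').card ≤ (T.filter fun s => F (x0 + s) ≠ 0).card := by
    apply card_le_card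
    intro s hs
    rw [mem_filter] at hs ⊢
    have := hA'A hs.2
    rw [hA, mem_filter] at this
    exact ⟨hs.1, this.2⟩
  have hx3 : (1/2:ℝ)^a * T.card < (T.filter fun s => F (x0 + s) ≠ 0).card := by
    have h1 : T.card ≤ 2^K1 * (T.filter fun s => F (x0 + s) ≠ 0).card := hx1.trans (Nat.mul_le_mul_left _ hx2)
    have hpos : 0 < (T.filter fun s => F (x0 + s) ≠ 0).card := by
      by_contra h0
      have h0 : (T.filter fun s => F (x0 + s) ≠ 0).card = 0 := by omega
      rw [h0] at h1
      have := hTne.card_pos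
      omega
    have h2 : (T.card:ℝ) ≤ 2^K1 * (T.filter fun s => F (x0 + s) ≠ 0).card := by exact_mod_cast h1
    have hKa : K1 < a := by omega
    have hp : (0:ℝ) < (T.filter fun s => F (x0 + s) ≠ 0).card := by exact_mod_cast hpos
    calc (1/2:ℝ)^a * T.card ≤ (1/2)^a * (2^K1 * (T.filter fun s => F (x0 + s) ≠ 0).card) := by gcongr
      _ < (1/2)^K1 * (2^K1 * (T.filter fun s => F (x0 + s) ≠ 0).card) := by
        apply mul_lt_mul_of_pos_right _ (by positivity)
        exact pow_lt_pow_right_of_lt_one₀ (by norm_num) (by norm_num) hKa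
      _ = _ := by rw [← mul_assoc, ← mul_pow]; norm_num
  obtain ⟨H, R, hH1, hH2, hH3, hH4, hH5⟩ := final_struct c F M a ε hM (by omega) hc hε hF T hTne hgood x0 hx3
  refine ⟨H, R, hH2, ?_, ?_, x0, hH5⟩
  · intro x
    refine (hH3 x).trans ?_
    have h1 : (2:ℝ)*(M+1)*(1/2)^a ≤ (1/2)^(4*M+4) := by
      have e1 : ((M:ℝ)+1) ≤ 2^(2*M) := by
        have : M + 1 ≤ 2^(2*M) := Nat.lt_two_pow_self.trans_le (Nat.pow_le_pow_right (by norm_num) (by omega))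
        exact_mod_cast this
      calc (2:ℝ)*(M+1)*(1/2)^a ≤ 2*2^(2*M)*(1/2)^((2*M+1)+(4*M+4)) := by
            gcongr ?_ * ?_
            · gcongr
            · exact pow_le_pow_of_le_one (by norm_num) (by norm_num) (by omega)
        _ = (2*2^(2*M)*(1/2)^(2*M+1))*(1/2)^(4*M+4) := by rw [pow_add]; ring
        _ = _ := by
          rw [← pow_succ', ← mul_pow]; norm_num
    linarith
  · have hFA : ∑ x, |F x| ≤ (M+1) * A.card := by
      have h1 : ∀ x, |F x| ≤ if F x ≠ 0 then (M+1:ℤ) else 0 := by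
        intro x
        by_cases hx : F x = 0
        · simp [hx]
        · rw [if_pos hx]
          have h2 : ‖gfun c x‖ ≤ M := by
            refine (norm_sum_le _ _).trans (le_trans (sum_le_sum fun γ _ => ?_) hc)
            rw [norm_mul, norm_char, mul_one]
          have h3 : ‖(F x : ℂ)‖ ≤ M + 1 := by
            have := norm_sub_norm_le (F x : ℂ) (gfun c x)
            have h4 := hF' x
            rw [norm_sub_rev] at h4
            linarith
          rw [Complex.norm_intCast] at h3
          exact_mod_cast h3
      calc _ ≤ ∑ x, if F x ≠ 0 then (M+1:ℤ) else 0 := sum_le_sum fun x _ => h1 x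
        _ = _ := by rw [← sum_filter, sum_const, ← hA, nsmul_eq_mul, mul_comm]
    have hchain : 2*((M+1)*A.card) ≤ 2^(2^136*ℓ^8*M^4) * (Hf H).card := by
      have hM3 : 2*(M+1) ≤ 2^(ℓ+3) := by
        have : 1 ≤ 2^ℓ := Nat.one_le_two_pow
        rw [pow_add]; omega
      calc 2*((M+1)*A.card) = 2*(M+1)*A.card := by ring
        _ ≤ 2^(ℓ+3) * (2^(16*ℓ) * (2^K2 * (2^(N*(2*(2^16*(a+ℓ+12)*(64*(ℓ+4)*M)^2))) * (Hf H).card))) :=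
          Nat.mul_le_mul hM3 (hAA'.trans (Nat.mul_le_mul_left _ (hL2.trans (Nat.mul_le_mul_left _
            (hTcard.trans (Nat.mul_le_mul_left _ hH1))))))
        _ = 2^((ℓ+3)+16*ℓ+K2+N*(2*(2^16*(a+ℓ+12)*(64*(ℓ+4)*M)^2))) * (Hf H).card := by
          rw [pow_add _ (ℓ+3+16*ℓ+K2), pow_add _ (ℓ+3+16*ℓ), pow_add _ (ℓ+3)]; ring
        _ ≤ _ := Nat.mul_le_mul_right _ (Nat.pow_le_pow_right (by norm_num) hnf)
    have hchain' : (2*((M+1)*A.card) : ℤ) ≤ 2^(2^136*ℓ^8*M^4) * (Hf H).card := by exact_mod_cast hchain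
    linarith

end P14

section P15
open scoped Classical
open Finset
variable {G : Type} [AddCommGroup G] [Fintype G]

/-- `F` is an integer combination of coset indicators with total weight at most `N`. -/
def Rp (F : G → ℤ) (N : ℕ) : Prop :=
  ∃ z : Set G → ℤ, (∀ W, W ∉ cosets G → z W = 0) ∧
    (∀ x, F x = ∑ W : Set G, if x ∈ W then z W else 0) ∧ ∑ W : Set G, |z W| ≤ N

lemma Rp_zero (F : G → ℤ) (hF : ∀ x, F x = 0) (N : ℕ) : Rp F N :=
  ⟨fun _ => 0, fun _ _ => rfl, fun x => by simp [hF x], by simp⟩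

lemma Rp_add (F R : G → ℤ) (N N' : ℕ) (h : Rp (fun x => F x - R x) N) (h' : Rp R N') : Rp F (N + N') := by
  obtain ⟨z, h1, h2, h3⟩ := h
  obtain ⟨z', h1', h2', h3'⟩ := h'
  refine ⟨fun W => z W + z' W, fun W hW => by simp [h1 W hW, h1' W hW], fun x => ?_, ?_⟩
  · have e : F x = (F x - R x) + R x := by ring
    have h2x : F x - R x = ∑ W : Set G, if x ∈ W then z W else 0 := h2 x
    rw [e, h2x, h2' x, ← sum_add_distrib]
    refine sum_congr rfl fun W _ => ?_
    split_ifs <;> simp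
  · calc _ ≤ ∑ W : Set G, (|z W| + |z' W|) := sum_le_sum fun W _ => abs_add_le _ _
      _ = ∑ W : Set G, |z W| + ∑ W : Set G, |z' W| := sum_add_distrib
      _ ≤ _ := by push_cast; linarith

lemma Rp_inv (H : AddSubgroup G) (R : G → ℤ) (hR : ∀ x, ∀ h ∈ H, R (x + h) = R x) (N : ℕ)
    (hN : (∑ x, |R x| : ℤ) ≤ N * (Hf H).card) : Rp R N := by
  let co : G → Set G := fun x => (fun h => x + h) '' (H : Set G)
  have hco : ∀ x y, y ∈ co x ↔ y - x ∈ H := by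
    intro x y
    constructor
    · rintro ⟨h, hh, rfl⟩
      simpa using hh
    · intro h
      exact ⟨y - x, h, by simp⟩
  have hRco : ∀ x y, y ∈ co x → R y = R x := by
    intro x y h
    have := hR x _ ((hco x y).1 h)
    rwa [add_sub_cancel] at this
  have hself : ∀ x, x ∈ co x := fun x => (hco x x).2 (by simp)
  have hcoeq : ∀ x y, y ∈ co x → co x = co y := by
    intro x y h
    rw [hco] at h
    ext w
    rw [hco, hco]
    constructor
    · intro h'
      have := H.sub_mem h' h
      rwa [sub_sub_sub_cancel_right] at this
    · intro h'
      have := H.add_mem h' h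
      rwa [sub_add_sub_cancel] at this
  let z : Set G → ℤ := fun W => if h : ∃ x, W = co x then R h.choose else 0
  have hz : ∀ x, z (co x) = R x := by
    intro x
    have h : ∃ y, co x = co y := ⟨x, rfl⟩
    have e : z (co x) = R h.choose := dif_pos h
    rw [e]
    apply (hRco _ _ _).symm
    rw [← h.choose_spec]; exact hself x
  have hz0 : ∀ W, (¬ ∃ x, W = co x) → z W = 0 := fun W hW => dif_neg hW
  have key : ∀ x W, W ≠ co x → x ∈ W → z W = 0 := by
    intro x W hW hx
    apply hz0
    rintro ⟨y, rfl⟩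
    exact hW (hcoeq y x hx)
  have sum1 : ∀ φ : ℤ → ℤ, φ 0 = 0 → ∀ x, ∑ W : Set G, (if x ∈ W then φ (z W) else 0) = φ (R x) := by
    intro φ hφ x
    rw [sum_eq_single (co x)]
    · rw [if_pos (hself x), hz]
    · intro W _ hW
      split_ifs with hx
      · rw [key x W hW hx, hφ]
      · rfl
    · simp
  refine ⟨z, ?_, ?_, ?_⟩
  · intro W hW
    apply hz0
    rintro ⟨x, rfl⟩
    exact hW ⟨H, x, rfl⟩
  · intro x
    exact (sum1 id rfl x).symm
  · have hpos : 0 < (Hf H).card := Hf_pos H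
    have e1 : ∑ x, |R x| = (∑ W : Set G, |z W|) * (Hf H).card := by
      have : ∀ x, |R x| = ∑ W : Set G, (if x ∈ W then |z W| else 0) := fun x => (sum1 (fun t => |t|) abs_zero x).symm
      simp_rw [this]
      rw [sum_comm, sum_mul]
      refine sum_congr rfl fun W _ => ?_
      by_cases hW : ∃ x, W = co x
      · obtain ⟨x, rfl⟩ := hW
        rw [← sum_filter, sum_const, nsmul_eq_mul, mul_comm]
        congr 2
        apply card_bij' (fun y _ => y - x) (fun h _ => x + h)
        · intro y hy
          rw [mem_filter] at hy
          exact mem_Hf.2 ((hco x y).1 hy.2)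
        · intro h hh
          rw [mem_filter]
          exact ⟨mem_univ _, (hco x _).2 (by simpa using mem_Hf.1 hh)⟩
        · intro y _; simp
        · intro y _; simp
      · simp [hz0 W hW]
    rw [e1] at hN
    exact le_of_mul_le_mul_right hN (by exact_mod_cast hpos)

lemma sum_char_H (H : AddSubgroup G) (γ : AddChar G ℂ) :
    (1 / (Hf H).card : ℂ) * ∑ h ∈ Hf H, γ h = if ∀ h ∈ H, γ h = 1 then 1 else 0 := by
  have hpos : 0 < (Hf H).card := Hf_pos H
  have hne : ((Hf H).card : ℂ) ≠ 0 := by exact_mod_cast hpos.ne'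
  split_ifs with hγ
  · rw [sum_congr rfl fun h hh => hγ h (mem_Hf.1 hh), sum_const, nsmul_eq_mul, mul_one]
    field_simp
  · push Not at hγ
    obtain ⟨h0, hh0, h1⟩ := hγ
    have : γ h0 * ∑ h ∈ Hf H, γ h = ∑ h ∈ Hf H, γ h := by
      rw [mul_sum]
      apply sum_bij' (fun h _ => h0 + h) (fun h _ => -h0 + h)
      · intro h hh; exact mem_Hf.2 (H.add_mem hh0 (mem_Hf.1 hh))
      · intro h hh; exact mem_Hf.2 (H.add_mem (H.neg_mem hh0) (mem_Hf.1 hh))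
      · intro h _; simp
      · intro h _; simp
      · intro h _; rw [AddChar.map_add_eq_mul]
    have h2 : (γ h0 - 1) * ∑ h ∈ Hf H, γ h = 0 := by rw [sub_mul, this]; ring
    rcases mul_eq_zero.1 h2 with h3 | h3
    · exact absurd (sub_eq_zero.1 h3) h1
    · rw [h3, mul_zero]

lemma avg_gfun (H : AddSubgroup G) (c : AddChar G ℂ → ℂ) (x : G) :
    (1 / (Hf H).card : ℂ) * ∑ h ∈ Hf H, gfun c (x + h) = ∑ γ, (if ∀ h ∈ H, γ h = 1 then c γ else 0) * γ x := by
  unfold gfun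
  rw [sum_comm, mul_sum]
  refine sum_congr rfl fun γ _ => ?_
  have : ∑ h ∈ Hf H, c γ * γ (x + h) = c γ * γ x * ∑ h ∈ Hf H, γ h := by
    rw [mul_sum]
    refine sum_congr rfl fun h _ => ?_
    rw [AddChar.map_add_eq_mul]; ring
  rw [this]
  calc _ = c γ * γ x * ((1 / (Hf H).card : ℂ) * ∑ h ∈ Hf H, γ h) := by ring
    _ = _ := by rw [sum_char_H]; split_ifs <;> simp

lemma fc_inv (H : AddSubgroup G) (R : G → ℤ) (hR : ∀ x, ∀ h ∈ H, R (x + h) = R x) (γ : AddChar G ℂ)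
    (hγ : ¬ ∀ h ∈ H, γ h = 1) : fourierCoeff (fun x => (R x : ℂ)) γ = 0 := by
  push Not at hγ
  obtain ⟨h0, hh0, h1⟩ := hγ
  unfold fourierCoeff
  have : (starRingEnd ℂ) (γ h0) * ∑ x, (R x : ℂ) * (starRingEnd ℂ) (γ x) = ∑ x, (R x : ℂ) * (starRingEnd ℂ) (γ x) := by
    rw [mul_sum]
    apply Fintype.sum_equiv (Equiv.addRight h0)
    intro x
    rw [Equiv.coe_addRight, hR x h0 hh0, AddChar.map_add_eq_mul, map_mul]; ring
  have h2 : ((starRingEnd ℂ) (γ h0) - 1) * ∑ x, (R x : ℂ) * (starRingEnd ℂ) (γ x) = 0 := by rw [sub_mul, this]; ring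
  rcases mul_eq_zero.1 h2 with h3 | h3
  · exfalso
    apply h1
    have := congrArg (starRingEnd ℂ) (sub_eq_zero.1 h3)
    simpa using this
  · rw [h3, mul_zero]

lemma outer (M ℓ : ℕ) (hM : 1 ≤ M) (hℓ : 1 ≤ ℓ) (hMℓ : M ≤ 2 ^ ℓ) (hℓM : ℓ ≤ 2*M) (n : ℕ) :
    ∀ (c : AddChar G ℂ → ℂ) (F : G → ℤ), n ≤ 2*M → 
      (∀ γ, c γ = 0 ∨ c γ = fourierCoeff (fun x => (F x : ℂ)) γ) → ∑ γ, ‖c γ‖ ≤ n/2 →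
      (∀ x, ‖gfun c x - F x‖ ≤ (1/4)^(n+2)) → Rp F (n * 2^(2^136*ℓ^8*M^4)) := by
  induction n with
  | zero =>
    intro c F _ _ hc hF
    apply Rp_zero
    intro x
    have h0 : ∀ γ, c γ = 0 := by
      intro γ
      have h1 : ‖c γ‖ ≤ ∑ γ, ‖c γ‖ := single_le_sum (f := fun γ => ‖c γ‖) (fun _ _ => norm_nonneg _) (mem_univ γ)
      have : ‖c γ‖ ≤ 0 := by simp at hc; linarith
      exact norm_le_zero_iff.1 this
    have h1 := hF x
    have h2 : gfun c x = 0 := by simp [gfun, h0]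
    rw [h2, zero_sub, norm_neg, Complex.norm_intCast] at h1
    have h3 : |F x| < 1 := by
      have : |(F x : ℝ)| < 1 := h1.trans_lt (by norm_num)
      exact_mod_cast this
    exact Int.abs_lt_one_iff.1 h3
  | succ n ih =>
    intro c F hn hcF hc hF
    by_cases hne : ∃ x, F x ≠ 0
    swap
    · push Not at hne
      exact Rp_zero F hne _
    have hnM : ((n:ℝ)+1) ≤ 2*M := by exact_mod_cast hn
    have hε16 : (1/4:ℝ)^(n+1+2) ≤ 1/64 := by
      calc (1/4:ℝ)^(n+1+2) ≤ (1/4)^3 := pow_le_pow_of_le_one (by norm_num) (by norm_num) (by omega)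
        _ = 1/64 := by norm_num
    obtain ⟨H, R, hR1, hR2, hR3, x0, hx0⟩ := core c F M ℓ ((1/4)^(n+1+2)) hM hℓ hMℓ hℓM hcF
      (hc.trans (by push_cast; linarith)) (by linarith) hF hne
    have hη : (1/2:ℝ)^(4*M+4) ≤ (1/4)^(n+1+2) := by
      rw [show (1/4:ℝ) = (1/2)^2 by norm_num, ← pow_mul]
      exact pow_le_pow_of_le_one (by norm_num) (by norm_num) (by omega)
    rw [show (n+1) * 2^(2^136*ℓ^8*M^4) = n * 2^(2^136*ℓ^8*M^4) + 2^(2^136*ℓ^8*M^4) by ring]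
    refine Rp_add F R _ _ ?_ (Rp_inv H R hR1 _ (by rw [Nat.cast_pow]; exact_mod_cast hR3))
    apply ih (fun γ => if ∀ h ∈ H, γ h = 1 then 0 else c γ) _ (by omega)
    · intro γ
      by_cases hγ : ∀ h ∈ H, γ h = 1
      · left; exact if_pos hγ
      · rw [if_neg hγ]
        rcases hcF γ with h | h
        · left; exact h
        · right
          have h1 := fc_inv H R hR1 γ hγ
          rw [h]
          unfold fourierCoeff at h1 ⊢
          have e : ∑ x, (((F x - R x : ℤ)) : ℂ) * (starRingEnd ℂ) (γ x)
            = ∑ x, (F x : ℂ) * (starRingEnd ℂ) (γ x) - ∑ x, (R x : ℂ) * (starRingEnd ℂ) (γ x) := by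
            rw [← sum_sub_distrib]
            refine sum_congr rfl fun x _ => ?_
            push_cast; ring
          rw [e, mul_sub, h1, sub_zero]
    · have h1 := hR2 x0
      rw [avg_gfun] at h1
      have h2 : ‖∑ γ, (if ∀ h ∈ H, γ h = 1 then c γ else 0) * γ x0‖ ≤ ∑ γ, ‖if ∀ h ∈ H, γ h = 1 then c γ else 0‖ := by
        refine (norm_sum_le _ _).trans (sum_le_sum fun γ _ => ?_)
        rw [norm_mul, norm_char, mul_one]
      have h3 : (1:ℝ) ≤ ‖(R x0 : ℂ)‖ := by
        rw [Complex.norm_intCast]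
        exact_mod_cast Int.one_le_abs hx0
      have h4 := norm_sub_norm_le (R x0 : ℂ) (∑ γ, (if ∀ h ∈ H, γ h = 1 then c γ else 0) * γ x0)
      rw [norm_sub_rev] at h4
      have h5 : ∑ γ, ‖if ∀ h ∈ H, γ h = 1 then 0 else c γ‖ + ∑ γ, ‖if ∀ h ∈ H, γ h = 1 then c γ else 0‖ = ∑ γ, ‖c γ‖ := by
        rw [← sum_add_distrib]
        refine sum_congr rfl fun γ _ => ?_
        split_ifs <;> simp
      push_cast at hc
      linarith
    · intro x
      have h1 := hR2 x
      rw [avg_gfun] at h1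
      have h2 := hF x
      have e : gfun (fun γ => if ∀ h ∈ H, γ h = 1 then 0 else c γ) x - ((F x - R x : ℤ) : ℂ)
          = (gfun c x - F x) - (∑ γ, (if ∀ h ∈ H, γ h = 1 then c γ else 0) * γ x - R x) := by
        have : gfun (fun γ => if ∀ h ∈ H, γ h = 1 then 0 else c γ) x
            = gfun c x - ∑ γ, (if ∀ h ∈ H, γ h = 1 then c γ else 0) * γ x := by
          unfold gfun
          rw [← sum_sub_distrib]
          refine sum_congr rfl fun γ _ => ?_
          by_cases hγ : ∀ h ∈ H, γ h = 1
          · simp only [if_pos hγ]; ring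
          · simp only [if_neg hγ]; ring
        rw [this]; push_cast; ring
      rw [e]
      refine (norm_sub_le _ _).trans ?_
      have e2 : (1/4:ℝ)^(n+2) = 4 * (1/4)^(n+1+2) := by
        rw [show n+1+2 = (n+2)+1 by ring, pow_succ (1/4:ℝ) (n+2)]; ring
      have : (0:ℝ) < (1/4)^(n+1+2) := by positivity
      linarith

lemma num_exp (M : ℝ) (hM : 1 ≤ M) (M0 ℓ : ℕ) (hM0 : M0 = ⌈M⌉₊) (hℓ : ℓ = Nat.log 2 M0 + 1) :
    ((2*M0 * 2^(2^136*ℓ^8*M0^4) : ℕ) : ℝ) ≤ Real.exp (2^160 * M^4 * Real.log (2*M)^8) := by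
  have hM0' : 1 ≤ M0 := by rw [hM0]; exact Nat.one_le_ceil_iff.2 (by linarith)
  have h1 : (M0:ℝ) ≤ 2*M := by
    have := Nat.ceil_lt_add_one (show 0 ≤ M by linarith)
    rw [hM0]; linarith
  have hl2 : (1/2:ℝ) ≤ Real.log 2 := by have := Real.log_two_gt_d9; linarith
  have hlM : Real.log 2 ≤ Real.log (2*M) := Real.log_le_log (by norm_num) (by linarith)
  have h2 : (ℓ:ℝ) ≤ 4 * Real.log (2*M) := by
    have e1 : 2^(Nat.log 2 M0) ≤ M0 := Nat.pow_log_le_self 2 (by omega)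
    have e2 : (2:ℝ)^(Nat.log 2 M0) ≤ 2*M := by
      refine le_trans ?_ h1; exact_mod_cast e1
    have e3 := Real.log_le_log (by positivity) e2
    rw [Real.log_pow] at e3
    have e4 : (Nat.log 2 M0 : ℝ) * (1/2) ≤ Real.log (2*M) := le_trans (by gcongr) e3
    rw [hℓ]; push_cast; linarith
  have hℓ1 : 1 ≤ ℓ := by omega
  have h3 : 2*M0 ≤ 2^(2^136*ℓ^8*M0^4) := by
    have e1 : M0 < 2^ℓ := by rw [hℓ]; exact Nat.lt_pow_succ_log_self (by norm_num) _
    have e2 : ℓ ≤ ℓ^8*M0^4 := by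
      calc ℓ ≤ ℓ^8 := Nat.le_self_pow (by norm_num) ℓ
        _ ≤ _ := Nat.le_mul_of_pos_right _ (by positivity)
    calc 2*M0 ≤ 2^(ℓ+1) := by rw [pow_succ]; omega
      _ ≤ _ := Nat.pow_le_pow_right (by norm_num) (by rw [mul_assoc]; omega)
  have h4 : 2*M0 * 2^(2^136*ℓ^8*M0^4) ≤ 2^(2^137*ℓ^8*M0^4) := by
    calc _ ≤ 2^(2^136*ℓ^8*M0^4) * 2^(2^136*ℓ^8*M0^4) := Nat.mul_le_mul_right _ h3
      _ = 2^(2^136*ℓ^8*M0^4+2^136*ℓ^8*M0^4) := by rw [pow_add]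
      _ = _ := by congr 1; ring
  have h5 : (2:ℝ)^(2^137*ℓ^8*M0^4) ≤ Real.exp ((2^137*ℓ^8*M0^4 : ℕ) : ℝ) := by
    rw [← mul_one ((2^137*ℓ^8*M0^4 : ℕ) : ℝ), Real.exp_nat_mul]
    apply pow_le_pow_left₀ (by norm_num)
    have := Real.add_one_le_exp (1:ℝ); linarith
  calc ((2*M0 * 2^(2^136*ℓ^8*M0^4) : ℕ) : ℝ) ≤ ((2^(2^137*ℓ^8*M0^4) : ℕ) : ℝ) := Nat.cast_le.2 h4
    _ = (2:ℝ)^(2^137*ℓ^8*M0^4) := by rw [Nat.cast_pow, Nat.cast_ofNat]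
    _ ≤ _ := h5
    _ ≤ _ := by
      apply Real.exp_le_exp.2
      rw [Nat.cast_mul, Nat.cast_mul, Nat.cast_pow, Nat.cast_pow, Nat.cast_pow, Nat.cast_ofNat]
      have hlog : 0 ≤ Real.log (2*M) := by linarith
      calc (2:ℝ)^137*ℓ^8*M0^4 ≤ 2^137*(4*Real.log (2*M))^8*(2*M)^4 := by gcongr
        _ = 2^157 * (M^4 * Real.log (2*M)^8) := by ring
        _ ≤ 2^160 * (M^4 * Real.log (2*M)^8) := by gcongr <;> norm_num
        _ = _ := by ring

lemma final_main (M : ℝ) (f : G → ℤ) (hM : 1 ≤ M) (hf : wienerNorm (fun x => (f x : ℂ)) ≤ M) :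
    ∃ z : Set G → ℤ, (∀ x : G, (f x : ℝ) = ∑ᶠ W ∈ cosets G, (z W : ℝ) * W.indicator (1 : G → ℝ) x) ∧
      (∑ᶠ W ∈ cosets G, |(z W : ℝ)|) ≤ Real.exp (2^160 * M ^ 4 * Real.log (2 * M) ^ 8) := by
  obtain ⟨M0, hM0⟩ : ∃ M0, M0 = ⌈M⌉₊ := ⟨_, rfl⟩
  obtain ⟨ℓ, hℓ⟩ : ∃ ℓ, ℓ = Nat.log 2 M0 + 1 := ⟨_, rfl⟩
  have hM0' : 1 ≤ M0 := by rw [hM0]; exact Nat.one_le_ceil_iff.2 (by linarith)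
  have hlog : Nat.log 2 M0 < M0 := Nat.log_lt_self 2 (by omega)
  have hMM0 : M ≤ M0 := by rw [hM0]; exact Nat.le_ceil M
  have hrp := outer M0 ℓ hM0' (by omega)
    (by rw [hℓ]; exact (Nat.lt_pow_succ_log_self (by norm_num) _).le) (by omega) (2*M0)
    (fun γ => fourierCoeff (fun x => (f x : ℂ)) γ) f le_rfl (fun γ => Or.inr rfl)
    (by
      unfold wienerNorm at hf
      rw [finsum_eq_sum_of_fintype] at hf
      push_cast
      linarith)
    (by
      intro x
      unfold gfun
      rw [inversion]
      simp)
  obtain ⟨z, h1, h2, h3⟩ := hrp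
  refine ⟨z, ?_, ?_⟩
  · intro x
    rw [finsum_mem_eq_finite_toFinset_sum _ (Set.toFinite _)]
    rw [h2 x]
    push_cast
    symm
    apply sum_subset_zero_on_sdiff (subset_univ _)
    · intro W hW
      have : W ∉ cosets G := by simpa using hW
      simp [h1 W this]
    · intro W _
      by_cases hx : x ∈ W <;> simp [hx]
  · rw [finsum_mem_eq_finite_toFinset_sum _ (Set.toFinite _)]
    refine le_trans ?_ (num_exp M hM M0 ℓ hM0 hℓ)
    have h4 : (∑ W : Set G, |(z W : ℝ)|) ≤ ((2*M0 * 2^(2^136*ℓ^8*M0^4) : ℕ) : ℝ) := by exact_mod_cast h3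
    refine le_trans ?_ h4
    exact sum_le_sum_of_subset_of_nonneg (subset_univ _) fun _ _ _ => abs_nonneg _

end P15

/-- Theorem 1.1 / quantitative idempotent theorem.  There is an absolute
constant `C > 0` such that for every finite abelian group `G`, every `M ≥ 1` and every
integer-valued `f : G → ℤ` with `‖f‖_{A(G)} ≤ M`, there is `z : 𝒲(G) → ℤ` with
`f = ∑_{W ∈ 𝒲(G)} z(W)·1_W` and `∑_W |z(W)| ≤ exp(C·M⁴·log⁸(2M))`. -/
theorem statement0 :
    ∃ C : ℝ, 0 < C ∧
      ∀ (G : Type) [AddCommGroup G] [Fintype G], ∀ (M : ℝ) (f : G → ℤ),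
        1 ≤ M → wienerNorm (fun x => (f x : ℂ)) ≤ M →
        ∃ z : Set G → ℤ,
          (∀ x : G, (f x : ℝ) = ∑ᶠ W ∈ cosets G, (z W : ℝ) * W.indicator (1 : G → ℝ) x) ∧
          (∑ᶠ W ∈ cosets G, |(z W : ℝ)|) ≤ Real.exp (C * M ^ 4 * Real.log (2 * M) ^ 8) := by
  refine ⟨2^160, by positivity, ?_⟩
  intro G _ _ M f hM hf
  exact final_main M f hM hf

end Paper
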